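/- arXiv:1308.0423 — 3 statements merged into one kernel-verified Lean document; each statement's English description precedes it below -/
import Mathlib

section
/- Let k be any field and let G be any subgroup of the symmetric group S₅, acting on the rational function field k(x₁,...,x₅) by permuting the variables: σ·xᵢ = x_{σ(i)}. Then the fixed field k(x₁,...,x₅)^G is purely transcendental over k. -/
/-- An intermediate field `L` of `E/k` is purely transcendental (rational) over `k`
if `L = k(s)` for some set `s` of elements algebraically independent over `k`. -/
def IsRationalExtension (k : Type*) {E : Type*} [Field k] [Field E] [Algebra k E]
    (L : IntermediateField k E) : Prop :=
  ∃ s : Set E, AlgebraicIndependent k ((↑) : s → E) ∧ IntermediateField.adjoin k s = L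

open IntermediateField in
/-- Adjoining a root of a polynomial of degree at most `n` to `L` lowers the degree of the
ambient field by a factor of at most `n`. -/
theorem rank_le_mul_of_root {k K : Type*} [Field k] [Field K] [Algebra k K]
    {L : IntermediateField k K} (z : K) (n : ℕ) {m : ℕ} (c : K) (a : Fin n → K)
    (hc0 : c ≠ 0) (hc : c ∈ L) (ha : ∀ i, a i ∈ L)
    (hz : c * z ^ n + ∑ i, a i * z ^ (i : ℕ) = 0)
    (h : ∀ M : IntermediateField k K, L ≤ M → z ∈ M → Module.rank M K ≤ m) :
    Module.rank L K ≤ (n * m : ℕ) := by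
  set N : IntermediateField L K := adjoin L {z} with hN
  have hLN : L ≤ N.restrictScalars k := fun y hy => N.algebraMap_mem ⟨y, hy⟩
  have hr := h (N.restrictScalars k) hLN (mem_adjoin_simple_self L z)
  have hmul := rank_mul_rank L N K
  let p : Polynomial L := Polynomial.C ⟨c, hc⟩ * Polynomial.X ^ n +
    ∑ i : Fin n, Polynomial.C ⟨a i, ha i⟩ * Polynomial.X ^ (i : ℕ)
  have hdeg : (∑ i : Fin n, Polynomial.C (⟨a i, ha i⟩ : L) * Polynomial.X ^ (i : ℕ)).degree <
      (n : WithBot ℕ) :=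
    Polynomial.degree_sum_fin_lt _
  have hcL : (⟨c, hc⟩ : L) ≠ 0 := fun e => hc0 (congrArg Subtype.val e)
  have hp : p.degree = n := by
    rw [Polynomial.degree_add_eq_left_of_degree_lt] <;>
      rw [Polynomial.degree_C_mul_X_pow _ hcL]
    exact hdeg
  have hp0 : p ≠ 0 := fun e => by simp [e] at hp
  have hpz : Polynomial.aeval z p = 0 := by
    simpa [p, map_sum, IntermediateField.algebraMap_apply] using hz
  have hzL : IsIntegral L z := (show IsAlgebraic L z from ⟨p, hp0, hpz⟩).isIntegral
  have hfin : Module.finrank L N ≤ n := by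
    rw [hN, adjoin.finrank hzL, ← Polynomial.natDegree_eq_of_degree_eq_some hp]
    exact Polynomial.natDegree_le_natDegree (minpoly.degree_le_of_ne_zero L z hp0 hpz)
  have : FiniteDimensional L N := adjoin.finiteDimensional hzL
  rw [← hmul, ← Module.finrank_eq_rank L N, Nat.cast_mul]
  exact mul_le_mul' (by exact_mod_cast hfin) hr

open IntermediateField in
theorem rank_le_one_of_adjoin_eq_top {k K ι : Type*} [Field k] [Field K] [Algebra k K] {x : ι → K}
    (hgen : adjoin k (Set.range x) = ⊤) {L : IntermediateField k K} (h : ∀ i, x i ∈ L) :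
    Module.rank L K ≤ (1 : ℕ) := by
  have : L = ⊤ := by
    rw [← top_le_iff, ← hgen, adjoin_le_iff]
    rintro _ ⟨i, rfl⟩
    exact h i
  rw [← relrank_top_right, this]
  simp

open IntermediateField in
/-- A family of as many elements as a transcendence basis, over whose field of definition the
ambient field is finite, is algebraically independent. -/
theorem algebraicIndependent_of_rank_le {k K ι : Type*} [Finite ι] [Field k] [Field K] [Algebra k K]
    {x f : ι → K} (hx : AlgebraicIndependent k x)
    {n : ℕ} (h : Module.rank (adjoin k (Set.range f)) K ≤ n) : AlgebraicIndependent k f := by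
  have hfin : FiniteDimensional (adjoin k (Set.range f)) K :=
    Module.rank_lt_aleph0_iff.mp (h.trans_lt (Cardinal.natCast_lt_aleph0))
  have halg : Algebra.IsAlgebraic (Algebra.adjoin k (Set.range f)) K :=
    isAlgebraic_adjoin_iff_top.mp inferInstance
  exact (Algebra.IsAlgebraic.isTranscendenceBasis_of_lift_le_trdeg_of_finite k f
    (hx.lift_cardinalMk_le_trdeg)).1

open IntermediateField in
/-- A family of invariants of the right size and degree generates the fixed field rationally. -/
theorem isRationalExtension_fixedField_of_rank_le {k K ι : Type*} [Finite ι] [Field k] [Field K]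
    [Algebra k K] {x f : ι → K} (hx : AlgebraicIndependent k x)
    (H : Subgroup (K ≃ₐ[k] K)) [Finite H]
    (hf : ∀ φ ∈ H, ∀ i, φ (f i) = f i)
    (h : Module.rank (adjoin k (Set.range f)) K ≤ (Nat.card H : ℕ)) :
    IsRationalExtension k (fixedField H) := by
  refine ⟨Set.range f, (algebraicIndependent_of_rank_le hx h).to_subtype_range, ?_⟩
  have hle : adjoin k (Set.range f) ≤ fixedField H := by
    rw [adjoin_le_iff]
    rintro _ ⟨i, rfl⟩ ⟨φ, hφ⟩
    exact hf φ hφ i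
  have hcard : Module.finrank (fixedField H) K = Nat.card H := by
    have := Fintype.ofFinite H
    rw [Nat.card_eq_fintype_card]
    exact FixedPoints.finrank_eq_card H K
  have hlt := h.trans_lt (Cardinal.natCast_lt_aleph0)
  have hfin : FiniteDimensional (adjoin k (Set.range f)) K := Module.rank_lt_aleph0_iff.mp hlt
  have h2 : Module.finrank (adjoin k (Set.range f)) K ≤ Nat.card H := by
    rw [← Module.finrank_eq_rank] at h
    exact_mod_cast h
  have hmul := relfinrank_mul_finrank_top hle
  have hpos : 0 < Module.finrank (adjoin k (Set.range f)) K := Module.finrank_pos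
  have hH : 0 < Nat.card H := Nat.card_pos
  rw [hcard] at hmul
  have h1 : (adjoin k (Set.range f)).relfinrank (fixedField H) = 1 := by
    have : 0 < (adjoin k (Set.range f)).relfinrank (fixedField H) :=
      Nat.pos_of_ne_zero fun e => by simp [e] at hmul; omega
    nlinarith
  exact le_antisymm hle (relfinrank_eq_one_iff.mp h1)

theorem AlgebraicIndependent.aeval_ne_zero_of {k K A ι : Type*} [Field k] [CommRing K] [Algebra k K]
    [CommRing A] [Algebra k A] {x : ι → K} (hx : AlgebraicIndependent k x) (p : MvPolynomial ι k)
    (a : ι → A) (h : MvPolynomial.aeval a p ≠ 0) : MvPolynomial.aeval x p ≠ 0 := by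
  intro e
  rw [hx.eq_zero_of_aeval_eq_zero p e, map_zero] at h
  exact h rfl

/-- The base-five digit of `c` in position `i`. -/
def fiveDigit (c i : ℕ) : ℕ := Nat.mod (Nat.div c (Nat.pow 5 i)) 5

/-- The product of two permutations of `Fin 5` encoded in base five. -/
def codeMul (a b : ℕ) : ℕ :=
  Nat.add (fiveDigit a (fiveDigit b 0)) (Nat.mul 5 (Nat.add (fiveDigit a (fiveDigit b 1))
    (Nat.mul 5 (Nat.add (fiveDigit a (fiveDigit b 2))
      (Nat.mul 5 (Nat.add (fiveDigit a (fiveDigit b 3))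
    (Nat.mul 5 (fiveDigit a (fiveDigit b 4)))))))))

/-- The number with base-five digits `g 0, g 1, g 2, g 3, g 4`. -/
def permCode (g : Equiv.Perm (Fin 5)) : ℕ :=
  g 0 + 5 * g 1 + 25 * g 2 + 125 * g 3 + 625 * g 4

/-- Whether the base-five digits of `c` exhaust `0, 1, 2, 3, 4`. -/
def isPermCode (c : ℕ) : Bool :=
  Nat.blt c 3125 && Nat.beq (2 ^ fiveDigit c 0 + 2 ^ fiveDigit c 1 + 2 ^ fiveDigit c 2 + 
    2 ^ fiveDigit c 3 + 2 ^ fiveDigit c 4) 31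

def permCodes : List ℕ :=
  [194, 198, 214, 222, 238, 242, 294, 298, 334, 346, 358, 366, 414, 422, 434, 446, 482, 486,
  538, 542, 558, 566, 582, 586, 694, 698, 714, 722, 738, 742, 894, 898, 954, 970, 978, 990,
  1014, 1022, 1054, 1070, 1102, 1110, 1138, 1142, 1178, 1190, 1202, 1210, 1294, 1298, 1334,
  1346, 1358, 1366, 1394, 1398, 1454, 1470, 1478, 1490, 1634, 1646, 1654, 1670, 1726, 1730,
  1758, 1766, 1778, 1790, 1826, 1830, 1914, 1922, 1934, 1946, 1982, 1986, 2014, 2022, 2054,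
  2070, 2102, 2110, 2134, 2146, 2154, 2170, 2226, 2230, 2382, 2386, 2402, 2410, 2426, 2430,
  2538, 2542, 2558, 2566, 2582, 2586, 2638, 2642, 2678, 2690, 2702, 2710, 2758, 2766, 2778,
  2790, 2826, 2830, 2882, 2886, 2902, 2910, 2926, 2930]

/-- The product of the entries of `gens` with positions listed in `w`. -/
def codeWord (gens w : List ℕ) : ℕ := w.foldr (fun i c => codeMul (gens.getD i 2930) c) 2930

/-- All powers `0, …, n - 1` of `c`. -/
def codePowers (c n : ℕ) : List ℕ := (List.range n).map fun i => (codeMul c)^[i] 2930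

/-- A conjugacy class of subgroups of the symmetric group on five letters: generators of a
representative, a factorization of it as a product of cyclic subsets, and, for every permutation
outside it, the data witnessing that together they generate a conjugate of a later class. -/
structure PermClass where
  gens : List ℕ
  factors : List (List ℕ × ℕ)
  overs : List (ℕ × List (List ℕ))
  conj : ℕ

/-- The codes of the elements of the representative, obtained from its factorization. -/
def PermClass.elems (C : PermClass) : List ℕ :=
  C.factors.foldr
    (fun p L => (codePowers (codeWord C.gens p.1) p.2).flatMap fun a => L.map (codeMul a))
    [2930]

/-- The conjugacy classes of subgroups of the symmetric group on five letters, by increasing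
order. -/
def permClasses : List PermClass := [
  ⟨[],
    [],
    [(3, [[0, 0]]), (6, [[0]]), (7, [[0]]), (2, [[0]]), (1, [[0]])],
    5314298326530923261277708715061409629070940042427997714337283997721663381612891466294395744987145116349412766199003943397494436751006307080121046315197701199772407675479084360246965320680748785178877933720913467750438103781702192887699606653776289893594064146278778715917526147314612079698475003239821008939947503988896076521050405838132333215182861402329250579527110246633852336487644506021732415812814827463965954373398289180294⟩,
  ⟨[2926],
    [([0], 2)],
    [(6, [[1, 1, 0]]), (6, [[1]]), (6, [[1, 0]]), (3, [[1, 1]]), (2, [[1]]), (3, [[1, 0]]), (4,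
      [[1], [0]])],
    1288586780457694812751824162280605921454903481613539748513860922285979317893110865798982671587732910794829274250241943511544967115252112254878175389886812347786507147780059620303489874297254967433335963741553794523032519571237989628414146904702652784313198916022191572783758526559206520519821794347451201107778883831072293276997414267876726621861364804505711413193519011506308960260562273299547378119223428013725160058695706366⟩,
  ⟨[2826],
    [([0], 2)],
    [(3, [[1, 1]]), (6, [[1]]), (7, [[1]]), (7, [[1, 0]]), (11, [[1], [0]]), (3, [[1, 0]]), (14,
      [[1, 0], [1]]), (5, [[1], [0]]), (4, [[1], [0, 1]])],
    5314298326530923261276583639236835060453514238218406577784896401769291210211792689461395629059687807099381487578997687706452095877573068633715754990173301102179811032441683355590558002459702820342608390630070312765304042673597214814431974602780736125714887802490125030222824045196426508400177603746896059901057500267560688005206637484249876588828587421634759753442981696824867340440406914160923666991111458884557220866827828062850⟩,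
  ⟨[2886],
    [([0], 3)],
    [(7, [[1, 1, 0]]), (6, [[1]]), (7, [[1]]), (6, [[1, 0]]), (7, [[1, 0]]), (13, [[0], [1]]), (6,
      [[1, 0, 0]]), (13, [[1], [1, 0]]), (13, [[1], [0, 0, 1]]), (9, [[0], [1]]), (10, [[0],
      [1]]), (8, [[0], [1]]), (8, [[0], [0, 1]]), (8, [[0], [0, 0, 1]])],
    5314298009773444813093674542640345925106069340716107446958129451839616910756777178081782857716765347359412425141580442782049506995251673281944561510232341053888589213516764483484904166007653273395657358610419124867565495241632597855713143009945400093875487620961228518169202788931039912701710951235396094834569459483174801488393942911240599090521989540392500423153734764497405269869610980607838765162575871463483305104899641961190⟩,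
  ⟨[2926, 2830],
    [([0], 2), ([1], 2)],
    [(6, [[0, 2, 2]]), (6, [[2, 2, 1]]), (6, [[1, 2]]), (6, [[2]]), (10, [[2, 2], [0, 1]]), (9,
      [[2, 1], [2]]), (14, [[2, 1], [1]]), (9, [[2, 0], [2]]), (14, [[2, 0], [0]])],
    1145150525199726680404514761908395380335759223564822059939554711873115449327807138357387325741666374142263225911935903984717705200278114206120912899577461795482018055968814889138754132176596776646249972962313298760447473782158524439230875295118753900248557081037692154025047012799501818076200417564101869762024561911696086501976732729639640812300505549011135199486908248298930164379176020804048712770065187982613338456671119850⟩,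
  ⟨[2826, 2642],
    [([0], 2), ([1], 2)],
    [(7, [[2, 2, 1]]), (7, [[2, 2, 0]]), (13, [[2, 2], [1]]), (7, [[2, 1]]), (7, [[2, 0]]), (6,
      [[2]]), (11, [[2], [1]]), (14, [[2, 1], [2]]), (11, [[2], [0]])],
    5314165512162049898560711084266884949319323916830951755304850657359006540561548913752737428723934990404103550121091464787425064735004766124598316792509834429605914542693144937488621767801419606534458058512816863198183418066647069535826537741387617203680649010856450139855918025938662105270969141286932904207628378493622339940526608510513280337091443186640586943911500259193833879977661339580982135265938192575866333591525825882754⟩,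
  ⟨[2586],
    [([0], 4)],
    [(7, [[0, 0, 1, 1]]), (7, [[1, 0]]), (7, [[1]]), (13, [[1, 1], [0, 0]]), (7, [[1, 0, 0]]),
      (13, [[1, 0], [0, 0]]), (13, [[1, 0, 1, 0, 1], [0, 0]]), (7, [[1, 0, 0, 0]]), (11, [[1], [1,
      0]]), (11, [[1, 0], [1]])],
    4639666286133796478632746821464034938363117249814781633385776533757557893538692400479379879085851358620131944338100164818672078938116307706058311449763339827514260435926545395813930877215364099055261070354771578267163851023500505801442726928992244234045381701658957242116971384912527103613004778673327938379877358882473658245322497197546143496557104855940205213217114950830853823827690374318133275045587231609408731028801959307974⟩,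
  ⟨[586],
    [([0], 5)],
    [(8, [[1, 1], [1, 1, 1]]), (12, [[0], [1, 1]]), (17, [[0, 0], [1, 1, 0]]), (13, [[1, 0], [1,
      0, 0, 1]]), (17, [[0], [1, 1, 0, 0, 0]]), (13, [[0, 0, 0, 1], [0, 1, 1]]), (17, [[1, 0, 1],
      [1, 0, 0, 0]]), (13, [[0, 0, 1, 0, 0], [1, 0, 1, 0, 0]]), (18, [[0], [1]]), (17, [[0],
      [1]]), (12, [[0], [1]]), (18, [[0, 0], [1]]), (17, [[0, 0], [1, 1]])],
    5313279869754646109808173354774298715055174100968715729387251426016037936037866744531465445298964808768874949494555871540278819361077496370328543315025484000068625348524737226831321754010457500295549068771830897025957934752555517314413346520911045337714148010766056957332889100148370665107506299655228593729456954956739434859370540434795765719848803634091607056938215338485949077536033496380907671193346943201481846919562440368870⟩,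
  ⟨[2886, 2430],
    [([0], 3), ([1], 2)],
    [(16, [[2, 2, 1], [1]]), (16, [[2, 0, 1, 2], [1]]), (16, [[2, 0, 2, 1], [1]]), (16, [[2],
      [1]]), (16, [[2, 1, 2, 0, 0], [1]]), (11, [[1], [2]]), (11, [[1], [2, 1]]), (13, [[0], [2,
      2]]), (9, [[0], [2]]), (10, [[0], [2]])],
    5314298009773444810840794851985955408958423778732236593270729396360995979290399644638388751474730484819489876506960259843530702309135862195873877305857563361174256853618235695058161200306550373714363009086036918431045634935655384207537818969613103706104803139208077593658716942167328491205373628275857739291739899020096807664233086879108206829678358459555439485555050172158684660090899418494966539450830257338023346361296001393938⟩,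
  ⟨[2886, 2926],
    [([0], 3), ([1], 2)],
    [(16, [[2, 2, 1], [1]]), (16, [[2, 1, 2], [1]]), (18, [[0, 0, 2, 0, 2], [1, 0]]), (18, [[2, 0,
      0, 2], [1]]), (13, [[0], [2]]), (14, [[2], [1]]), (13, [[0], [1, 2]]), (10, [[0], [2, 2]]),
      (10, [[0], [1, 2, 1, 2]]), (16, [[2, 0], [2]]), (16, [[1, 0, 2], [1, 0]]), (10, [[0], [2]]),
      (10, [[0], [1, 2]])],
    4609435927650721904925789564523627693580687818839992773848822303299571929954031087609033082041061616319504730257822014256124735153320309392267682182785939575332594024291187750710840899507245342186584537014538581329316111177565176470596808572783390656549478902636665712234240116945515100453403287743703934503057288771653660208753461147261559095249386148514146706635639304610210483247356919998249701862020541262706⟩,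
  ⟨[2886, 2426],
    [([0], 3), ([1], 2)],
    [(13, [[2, 2], [1]]), (12, [[2, 2, 1], [1]]), (13, [[2, 2], [1, 0]]), (13, [[2, 0, 2], [1]]),
      (13, [[0, 2, 0, 2], [1, 0]]), (12, [[2], [0, 1]]), (13, [[0, 1, 2], [1]]), (13, [[0, 0, 2,
      2], [1]]), (17, [[1, 2, 0, 2], [0]]), (13, [[0, 2, 0, 0, 2], [1, 0]]), (14, [[1, 2], [0,
      2]]), (14, [[0, 0, 2], [1, 2]]), (12, [[2, 0], [1, 0]]), (13, [[0], [2, 0, 2]]), (14, [[2],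
      [2, 1]]), (14, [[0, 1, 2], [2]])],
    5314317488770355424393071423670581735469703322791262838277900616074039485227777764892714199147638640052476615030139660008078467670497021556647840701833980688780848506456539665016451055633878885088420327507102047695422182545970521059865987835093826902350044564712355131563661007250132945951398949133697280926283596722548965432432530348553745420464341185861552544543275936992189915377296971599372195362929602897234125895366459468518⟩,
  ⟨[2926, 2642],
    [([0], 2), ([1, 0, 1], 2), ([1], 2)],
    [(16, [[0, 2, 2], [0]]), (16, [[2, 0, 2], [0]]), (18, [[2, 1, 2], [1, 0, 1]]), (18, [[2],
      [0]]), (12, [[2, 1], [2]]), (13, [[2, 2], [1]]), (18, [[0, 2], [0]]), (16, [[0, 2, 1, 2, 1],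
      [0]]), (16, [[0, 1], [2]]), (16, [[0, 2, 1], [0]]), (18, [[2, 1, 2], [0]])],
    1143376686277363458625157869632863133824590561398012101125597706372402417597131289615460697977684867502918300132220471705761984513946554870073647545155646406970146140697587601422293536474707261170989096276121677891460486818435061594212369691584282383071818225128652285701649819671934997712691241238149615335180143865900517218018598196711041345345114882753735733574494580343287957983838346966138627371116518767326047632554387834⟩,
  ⟨[586, 970],
    [([0], 5), ([1], 2)],
    [(13, [[2, 2], [1]]), (13, [[0, 2, 0, 2], [1]]), (13, [[2, 0, 2], [1]]), (13, [[0, 0, 2, 2],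
      [1, 0]]), (13, [[2, 1, 2, 1], [0, 0, 1]]), (13, [[2, 0, 2], [1, 0, 0]]), (13, [[0, 0, 0, 2],
      [1]]), (18, [[0], [2]]), (15, [[0], [2]]), (15, [[0], [1, 2]]), (13, [[0, 0, 2], [1]]), (13,
      [[0, 2, 0, 2], [1, 0]]), (18, [[0], [2, 0]]), (13, [[0, 1, 2], [1]]), (13, [[0, 0, 2, 0],
      [1]]), (14, [[2], [2, 1]]), (17, [[0], [2, 2, 0, 1]]), (18, [[0, 0], [2]])],
    5313279948369942194714834081946979088688394327665249401559946189093232782556962959864688673325832400854315998100253030861369470017415370110721597562811327384164106298665884840300003641213708678521932184551839671176067772459304236744510256517840082138004705920896418662598025214918743235304262970426532928175325188166832749393689435543309613286860828112513099227860755746232051311980144934556057228403079586566383148832262941941760⟩,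
  ⟨[2886, 2826],
    [([0], 3), ([1], 2), ([0, 1, 0, 0], 2)],
    [(15, [[2, 1, 2], [2, 2, 2, 1]]), (17, [[2, 0, 2], [0, 0]]), (17, [[2, 2, 0], [0]]), (17, [[2,
      1, 2], [0, 0]]), (17, [[0, 1, 2, 2], [0]]), (16, [[0, 2], [2]]), (17, [[2, 0], [2, 1]]),
      (17, [[1, 2, 0, 2], [1, 0, 0]]), (17, [[0, 2], [1, 0]]), (17, [[2, 0], [0, 1]]), (16, [[0,
      1, 2], [1, 2]]), (16, [[1, 2], [0, 2]]), (16, [[2, 1], [2, 2, 2]]), (17, [[0, 2, 1, 2, 1],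
      [0, 0, 1]]), (17, [[2, 1], [0]]), (17, [[2, 0, 1], [2]]), (16, [[2], [0, 1, 2]]), (17, [[2,
      0, 0, 2], [0]]), (17, [[2, 1, 0], [0]]), (17, [[2, 2, 2], [0]]), (17, [[2, 2, 1], [0]])],
    4792037769510043638044148422158095282976648714144031680441288948496688705132816762561905511837992064888069604627910638113414350497312427828727690093788640323416710876017638872169038704792386140775405895116452930439694329197879924407883651825278095194278028820681014386202171388842629356015694323817052686902593363544088428036478569028254110250376283615563013947283415996195201281599364575896705329572092395370751110953963319929350⟩,
  ⟨[2386, 2926],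
    [([0], 6), ([1], 2)],
    [(16, [[2, 2, 1], [1]]), (16, [[2, 1, 2], [1]]), (16, [[0, 2, 0, 0, 2], [1, 0, 0]]), (16, [[0,
      2, 0, 1, 2], [0, 0, 1]]), (18, [[2], [1]]), (18, [[2, 0], [1]]), (18, [[2, 0, 1], [1]]),
      (16, [[0, 2, 0], [0, 0, 0]]), (18, [[0, 2, 0], [1]]), (18, [[0, 1, 2, 2], [1]])],
    1733929504680579259224104241101975136347414476289369789979046023067443179648000136298408306549463958571653558419287661168511179742159028667321459658558119793059235023548291486853698173155153446211019108505904399338191187896547961549439621360209473955201212739602234296123631843760020810521717574524451780569002690393348718867719127432069605744797173755479985121634016212233487573313906741169515987026670511728818⟩,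
  ⟨[586, 2110],
    [([0], 5), ([1], 4)],
    [(17, [[0], [2, 2]]), (17, [[0], [2, 2, 0]]), (17, [[0, 0], [2, 2]]), (17, [[0, 0, 0], [2,
      2]]), (17, [[0], [0, 2, 0, 2]]), (17, [[2, 0, 2], [0, 0, 0, 2]]), (17, [[0, 0, 0], [0, 2, 0,
      2]]), (18, [[0], [2]]), (18, [[0, 0], [2]]), (18, [[0], [2, 0]]), (17, [[2], [0, 2, 0]]),
      (16, [[2], [0, 0, 2, 0]]), (17, [[0, 0, 0], [0, 2]]), (18, [[0], [0, 2, 2, 2]])],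
    5313280106180649062912173964106123522331303736473245587504121246763858607906842355016838804765771771855699573975584048398306427457150224427271517268208160674503860061259874625645299643332307488307944724490313301674901342892564854091045757137551834537668492767054805889166691656490194289942956454871687670116645059544460864444354066011431082971318351009801020704031985727416019343456104345328594787923027080070959356627322304634880⟩,
  ⟨[2586, 2926],
    [([0], 4), ([0, 1], 3), ([0, 0, 0, 1, 0], 2)],
    [(18, [[0, 0, 2, 2], [0, 1, 0, 0, 1]]), (18, [[2, 0, 2, 1], [1]]), (18, [[0, 1, 2, 2], [0, 1,
      0, 0, 1]]), (18, [[0, 2, 1], [1, 0, 0, 1, 0]]), (18, [[0, 0, 2, 0], [0, 0, 1, 0, 0]]), (18,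
      [[0, 1, 2], [1]]), (18, [[0, 2, 0, 2], [1]]), (18, [[0, 0, 2], [1]]), (18, [[2, 0, 1, 0],
      [1]]), (17, [[2, 2, 2], [0, 1]]), (18, [[0, 0, 0, 2], [1]]), (17, [[2, 0, 1], [2]]), (18,
      [[0, 2, 0, 0], [1]])],
    3565132602260241012169727762094154682082993753719120624939520095435753460698277577207401270406664653775211567725565819213798878568142536488119227360677709877912907822993164396485018271695688072355692757863289689419864432630154086059750039142879210130993106025461434379486055149768380646998005681565488146079749203051821500328623867234662467167934⟩,
  ⟨[586, 2886],
    [([0], 5), ([1], 3), ([0, 0, 1, 1, 0], 2), ([0, 0, 0, 1, 0, 1, 1], 2)],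
    [(18, [[0, 0], [2, 2, 2]]), (18, [[0], [2, 2, 2]]), (18, [[0], [2]]), (18, [[0, 0], [2]]),
      (18, [[0], [2, 0]]), (18, [[0], [0, 2, 2, 2]]), (18, [[0, 0], [0, 0, 2]]), (18, [[0, 0], [0,
      0, 0, 2]]), (18, [[1, 0], [1, 2]]), (18, [[1, 0], [0, 1, 2]]), (18, [[0, 1], [2, 1, 0]]),
      (18, [[0, 1], [2, 0, 1, 0]]), (18, [[0, 0], [1, 0, 2, 0, 1]]), (18, [[0], [1, 1, 2]])],
    5313279789480378208766335218281957025638280986901135837618098449593555430356596679983405965153331718769627162820066483396982663736793229633130012665888518681423524243561398785057145331766879053623966095009340863167560141894637348314505215803245564691284297888472427501486968283331381286733214508448199296141960013841396477544895322524409944399043045997789472475629037100914558286421559157572876287880216321415169486912257795973120⟩,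
  ⟨[586, 2926],
    [([0], 5), ([0, 1], 4), ([1, 0, 0, 0, 1, 0], 3), ([0, 0, 1, 0, 0, 0], 2)],
    [],
    0⟩]

/-- The words `ws` in `C.gens` and `c` are the conjugates by `t` of the generators of class `j'`. -/
def PermClass.leads (C : PermClass) (c t j' : ℕ) (ws : List (List ℕ)) : Bool :=
  match permClasses[j']? with
  | none => false
  | some D => Nat.beq D.gens.length ws.length && isPermCode t &&
      (D.gens.zip ws).all fun p =>
        Nat.beq (codeMul t p.1) (codeMul (codeWord (C.gens ++ [c]) p.2) t)

def PermClass.check (C : PermClass) (j : ℕ) : Bool :=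
  decide (C.elems.Pairwise fun a b => Nat.beq a b = false) && C.elems.all isPermCode &&
  C.gens.all isPermCode &&
  permCodes.zipIdx.all fun p => C.elems.any (Nat.beq p.1) ||
    C.overs.any fun o => Nat.blt j o.1 && C.leads p.1 (C.conj / 4096 ^ p.2 % 4096) o.1 o.2

theorem permClasses_check : (permClasses.zipIdx.all fun p => p.1.check p.2) = true := by
  decide +kernel

theorem fiveDigit_permCode (g : Equiv.Perm (Fin 5)) (i : Fin 5) :
    fiveDigit (permCode g) i = g i := by
  have h0 := (g 0).isLt
  have h1 := (g 1).isLt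
  have h2 := (g 2).isLt
  have h3 := (g 3).isLt
  have h4 := (g 4).isLt
  change permCode g / 5 ^ (i : ℕ) % 5 = g i
  unfold permCode
  fin_cases i <;> simp <;> omega

theorem permCode_injective : Function.Injective permCode := fun g h e =>
  Equiv.ext fun i => Fin.ext (by rw [← fiveDigit_permCode, e, fiveDigit_permCode])

theorem permCode_mul (g h : Equiv.Perm (Fin 5)) :
    permCode (g * h) = codeMul (permCode g) (permCode h) := by
  have H : ∀ i : Fin 5, fiveDigit (permCode g) (fiveDigit (permCode h) i) = g (h i) := fun i => by
    rw [fiveDigit_permCode, fiveDigit_permCode]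
  have h0 := H 0
  have h1 := H 1
  have h2 := H 2
  have h3 := H 3
  have h4 := H 4
  simp only [Fin.isValue, Fin.coe_ofNat_eq_mod,
    Nat.reduceMod] at h0 h1 h2 h3 h4
  change _ = _ + 5 * (_ + 5 * (_ + 5 * (_ + 5 * _)))
  rw [h0, h1, h2, h3, h4]
  simp only [permCode, Equiv.Perm.mul_apply]
  ring

theorem permCode_one : permCode 1 = 2930 := rfl

theorem exists_permCode_eq {c : ℕ} (hc : isPermCode c = true) :
    ∃ g, permCode g = c := by
  simp only [isPermCode, Bool.and_eq_true, Nat.blt_eq] at hc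
  obtain ⟨hlt, hc⟩ := hc
  have H : ∀ a b c d e : Fin 5, 2 ^ (a : ℕ) + 2 ^ (b : ℕ) + 2 ^ (c : ℕ) +
      2 ^ (d : ℕ) + 2 ^ (e : ℕ) = 31 →
      a ≠ b ∧ a ≠ c ∧ a ≠ d ∧ a ≠ e ∧ b ≠ c ∧ b ≠ d ∧ b ≠ e ∧ c ≠ d ∧ c ≠ e ∧ d ≠ e := by
    decide +kernel
  let f : Fin 5 → Fin 5 := fun i => ⟨fiveDigit c i, Nat.mod_lt _ (by norm_num)⟩
  obtain ⟨h1, h2, h3, h4, h5, h6, h7, h8, h9, h10⟩ := H (f 0) (f 1) (f 2) (f 3) (f 4)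
    (Nat.eq_of_beq_eq_true hc)
  have hf : Function.Injective f := by
    intro i j hij
    fin_cases i <;> fin_cases j <;> first | rfl | exact absurd hij ‹_› | exact absurd hij.symm ‹_›
  refine ⟨Equiv.ofBijective f (Finite.injective_iff_bijective.mp hf), ?_⟩
  change c / 5 ^ 0 % 5 + 5 * (c / 5 ^ 1 % 5) + 25 * (c / 5 ^ 2 % 5) + 125 * (c / 5 ^ 3 % 5) +
    625 * (c / 5 ^ 4 % 5) = c
  norm_num
  omega

theorem permCode_mem_permCodes (g : Equiv.Perm (Fin 5)) : permCode g ∈ permCodes := by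
  have H : ∀ a b c d e : Fin 5, 
      a ≠ b → a ≠ c → a ≠ d → a ≠ e → b ≠ c → b ≠ d → b ≠ e → c ≠ d → c ≠ e → d ≠ e →
      (a + 5 * b + 25 * c + 125 * d + 625 * e : ℕ) ∈ permCodes := by
    decide +kernel
  apply H <;> exact fun e => absurd (g.injective e) (by decide)

/-- The codes of the elements of a subgroup of the symmetric group. -/
def Subgroup.HasCode (Q : Subgroup (Equiv.Perm (Fin 5))) (c : ℕ) : Prop :=
  ∃ s ∈ Q, permCode s = c

namespace Subgroup.HasCode

variable {Q : Subgroup (Equiv.Perm (Fin 5))}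

theorem mul {a b : ℕ} (ha : Q.HasCode a) (hb : Q.HasCode b) : Q.HasCode (codeMul a b) := by
  obtain ⟨s, hs, rfl⟩ := ha
  obtain ⟨t, ht, rfl⟩ := hb
  exact ⟨s * t, Q.mul_mem hs ht, permCode_mul s t⟩

theorem word {gens : List ℕ} (h : ∀ c ∈ gens, Q.HasCode c) (w : List ℕ) :
    Q.HasCode (codeWord gens w) := by
  induction w with
  | nil => exact ⟨1, Q.one_mem, permCode_one⟩
  | cons i w ih =>
    refine mul ?_ ih
    by_cases hi : i < gens.length
    · rw [List.getD_eq_getElem _ _ hi]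
      exact h _ (List.getElem_mem hi)
    · rw [List.getD_eq_default _ _ (by omega)]
      exact ⟨1, Q.one_mem, permCode_one⟩

theorem elems {C : PermClass} (h : ∀ c ∈ C.gens, Q.HasCode c) :
    ∀ c ∈ C.elems, Q.HasCode c := by
  unfold PermClass.elems
  induction C.factors with
  | nil =>
    intro c hc
    obtain rfl : c = 2930 := by simpa using hc
    exact ⟨1, Q.one_mem, permCode_one⟩
  | cons p l ih =>
    intro c hc
    simp only [List.foldr_cons, List.mem_flatMap, List.mem_map, codePowers] at hc
    obtain ⟨a, ⟨i, -, rfl⟩, b, hb, rfl⟩ := hc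
    refine mul ?_ (ih b hb)
    induction i with
    | zero => exact ⟨1, Q.one_mem, permCode_one⟩
    | succ i hi =>
      rw [Function.iterate_succ_apply']
      exact mul (word h _) hi

end Subgroup.HasCode

/-- Every subgroup of the symmetric group on five letters is conjugate to a listed one. -/
theorem exists_permClass_aux (G : Subgroup (Equiv.Perm (Fin 5))) (n : ℕ) :
    ∀ (j : ℕ) (C : PermClass) (τ : Equiv.Perm (Fin 5)), permClasses.length ≤ n + j →
      permClasses[j]? = some C →
      (∀ c ∈ C.gens, (G.comap (MulAut.conj τ).toMonoidHom).HasCode c) →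
      ∃ C ∈ permClasses, ∃ τ : Equiv.Perm (Fin 5),
        (∀ s, permCode s ∈ C.gens → τ * s * τ⁻¹ ∈ G) ∧
        (∀ P : Subgroup (Equiv.Perm (Fin 5)), (∀ s, permCode s ∈ C.gens → τ * s * τ⁻¹ ∈ P) →
          ∀ g ∈ G, g ∈ P) ∧
        C.elems.length ≤ Nat.card G := by
  induction n with
  | zero =>
    intro j C τ hj hC
    rw [List.getElem?_eq_none (by omega)] at hC
    cases hC
  | succ n ih =>
    intro j C τ hj hC hgens
    have hcheck := List.all_eq_true.mp permClasses_check (C, j)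
      (List.mem_zipIdx_iff_getElem?.mpr hC)
    simp only [PermClass.check, Bool.and_eq_true, decide_eq_true_eq, List.all_eq_true] at hcheck
    obtain ⟨⟨⟨hnodup, helems⟩, hgc⟩, hall⟩ := hcheck
    set Q := G.comap (MulAut.conj τ).toMonoidHom with hQ
    have hmem : C ∈ permClasses := List.mem_of_getElem? hC
    by_cases hsub : ∀ g ∈ Q, permCode g ∈ C.elems
    · refine ⟨C, hmem, τ, fun s hs => ?_, fun P hP g hg => ?_, ?_⟩
      · obtain ⟨t, ht, hts⟩ := hgens _ hs
        rw [permCode_injective hts] at ht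
        exact ht
      · have hPg : ∀ c ∈ C.gens, (P.comap (MulAut.conj τ).toMonoidHom).HasCode c := by
          intro c hc
          obtain ⟨s, rfl⟩ := exists_permCode_eq (hgc c hc)
          exact ⟨s, hP s hc, rfl⟩
        have hgQ : τ⁻¹ * g * τ ∈ Q := by
          change τ * (τ⁻¹ * g * τ) * τ⁻¹ ∈ G
          simpa [mul_assoc] using hg
        obtain ⟨s, hs, hsg⟩ := Subgroup.HasCode.elems hPg _ (hsub _ hgQ)
        rw [permCode_injective hsg] at hs
        change τ * (τ⁻¹ * g * τ) * τ⁻¹ ∈ P at hs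
        simpa [mul_assoc] using hs
      · have hnd : C.elems.Nodup := hnodup.imp fun {a b} h e => by
          rw [e, Nat.beq_refl] at h
          cases h
        have hle : C.elems.toFinset.card ≤
            ((Set.toFinite (Q : Set (Equiv.Perm (Fin 5)))).toFinset.image
            permCode).card := by
          refine Finset.card_le_card fun c hc => ?_
          obtain ⟨s, hs, rfl⟩ := Subgroup.HasCode.elems hgens c (List.mem_toFinset.mp hc)
          exact Finset.mem_image_of_mem _ (by simpa using hs)
        rw [List.toFinset_card_of_nodup hnd] at hle
        refine hle.trans (Finset.card_image_le.trans ?_)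
        rw [← Nat.card_eq_card_finite_toFinset]
        exact Nat.card_le_card_of_injective (fun s : Q => (⟨_, s.2⟩ : G))
          fun a b e => Subtype.ext ((MulAut.conj τ).injective (congrArg Subtype.val e))
    · push Not at hsub
      obtain ⟨g, hg, hgC⟩ := hsub
      obtain ⟨i, hi⟩ := List.mem_iff_getElem?.mp (permCode_mem_permCodes g)
      have hp := hall (permCode g, i) (List.mem_zipIdx_iff_getElem?.mpr hi)
      rw [Bool.or_eq_true, List.any_eq_true, List.any_eq_true] at hp
      obtain ⟨c, hc, hgc'⟩ | ⟨o, -, ho⟩ := hp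
      · rw [← show permCode g = c from Nat.eq_of_beq_eq_true hgc'] at hc
        exact absurd hc hgC
      · rw [Bool.and_eq_true, Nat.blt_eq] at ho
        obtain ⟨hjo, hleads⟩ := ho
        unfold PermClass.leads at hleads
        cases hD : permClasses[o.1]? with
        | none => simp [hD] at hleads
        | some D =>
          simp only [hD, Bool.and_eq_true, List.all_eq_true] at hleads
          obtain ⟨⟨hlen, ht⟩, hzip⟩ := hleads
          obtain ⟨t, ht⟩ := exists_permCode_eq ht
          refine ih o.1 D (τ * t) (by omega) hD fun c hc => ?_
          obtain ⟨m, hm, rfl⟩ := List.mem_iff_getElem.mp hc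
          have hm' : m < o.2.length := by
            rw [← Nat.eq_of_beq_eq_true hlen]
            exact hm
          have hz := Nat.eq_of_beq_eq_true (hzip (D.gens[m], o.2[m]) (by
            rw [List.mem_iff_getElem]
            exact ⟨m, by simp [hm, hm'], by simp⟩))
          have hw : Q.HasCode (codeWord (C.gens ++ [permCode g]) o.2[m]) := by
            refine Subgroup.HasCode.word (fun c hc => ?_) _
            rcases List.mem_append.mp hc with h | h
            · exact hgens c h
            · exact ⟨g, hg, (List.mem_singleton.mp h).symm⟩
          obtain ⟨w, hw, hwc⟩ := hw
          have hs : permCode (t⁻¹ * w * t) = D.gens[m] := by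
            have hDc := permClasses_check
            rw [List.all_eq_true] at hDc
            have := hDc (D, o.1) (List.mem_zipIdx_iff_getElem?.mpr hD)
            simp only [PermClass.check, Bool.and_eq_true, List.all_eq_true] at this
            obtain ⟨s, hs⟩ := exists_permCode_eq (this.1.2 _ hc)
            simp only at hz
            rw [← hs, ← ht, ← hwc, ← permCode_mul, ← permCode_mul] at hz
            rw [← hs, mul_assoc, ← permCode_injective hz, inv_mul_cancel_left]
          refine ⟨_, ?_, hs⟩
          change τ * t * (t⁻¹ * w * t) * (τ * t)⁻¹ ∈ G
          have : τ * w * τ⁻¹ ∈ G := hw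
          simpa [mul_assoc] using this

theorem exists_permClass (G : Subgroup (Equiv.Perm (Fin 5))) :
    ∃ C ∈ permClasses, ∃ τ : Equiv.Perm (Fin 5),
      (∀ s, permCode s ∈ C.gens → τ * s * τ⁻¹ ∈ G) ∧
      (∀ P : Subgroup (Equiv.Perm (Fin 5)), (∀ s, permCode s ∈ C.gens → τ * s * τ⁻¹ ∈ P) →
        ∀ g ∈ G, g ∈ P) ∧
      C.elems.length ≤ Nat.card G :=
  exists_permClass_aux G permClasses.length 0 _ 1 le_rfl rfl (by simp)

/-- For the permutations of five generators of `K` with the given codes, there are five common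
invariants such that the degree of `K` over the field they generate is at most `n`. -/
def HasInvariants (k K : Type*) [Field k] [Field K] [Algebra k K] (gens : List ℕ) (n : ℕ) : Prop :=
  ∀ x : Fin 5 → K, AlgebraicIndependent k x → IntermediateField.adjoin k (Set.range x) = ⊤ →
    ∃ f : Fin 5 → K,
      (∀ c ∈ gens, ∀ φ : K ≃ₐ[k] K, (∀ i : Fin 5, φ (x i) = x (Fin.ofNat 5 (fiveDigit c i))) →
        ∀ i, φ (f i) = f i) ∧
      ∀ L : IntermediateField k K, (∀ i, f i ∈ L) → Module.rank L K ≤ n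

theorem isRationalExtension_of_hasInvariants {k K : Type*} [Field k] [Field K] [Algebra k K]
    (x : Fin 5 → K) (hx : AlgebraicIndependent k x)
    (hgen : IntermediateField.adjoin k (Set.range x) = ⊤)
    (G : Subgroup (Equiv.Perm (Fin 5)))
    (ρ : G →* (K ≃ₐ[k] K)) (hρ : ∀ (g : G) (i : Fin 5), ρ g (x i) = x (g.1 i))
    (h : ∀ C ∈ permClasses, HasInvariants k K C.gens C.elems.length) :
    IsRationalExtension k (IntermediateField.fixedField ρ.range) := by
  obtain ⟨C, hC, τ, hτ, hP, hcard⟩ := exists_permClass G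
  obtain ⟨f, hf, hrank⟩ := h C hC (x ∘ τ) (hx.comp τ τ.injective) (by
    rw [Set.range_comp, τ.range_eq_univ, Set.image_univ, hgen])
  have hinj : Function.Injective ρ := fun g g' e => Subtype.ext <| Equiv.ext fun i =>
    hx.injective (by rw [← hρ, ← hρ, e])
  have : Finite ρ.range := Finite.of_surjective _ ρ.rangeRestrict_surjective
  refine isRationalExtension_fixedField_of_rank_le hx (f := f) ρ.range ?_ ?_
  · rintro _ ⟨g, rfl⟩ i
    let P : Subgroup (Equiv.Perm (Fin 5)) :=
      ((MulAction.stabilizer (K ≃ₐ[k] K) (f i)).comap ρ).map G.subtype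
    have hPs : ∀ s, permCode s ∈ C.gens → τ * s * τ⁻¹ ∈ P := fun s hs => by
      refine ⟨⟨_, hτ s hs⟩, hf _ hs _ (fun m => ?_) i, rfl⟩
      rw [fiveDigit_permCode]
      simp [hρ]
    obtain ⟨g', hg', hgg⟩ := hP P hPs g.1 g.2
    rw [← show g' = g from Subtype.ext hgg]
    exact hg'
  · rw [Nat.card_congr (MonoidHom.ofInjective hinj).toEquiv.symm]
    refine (hrank _ fun i => IntermediateField.subset_adjoin _ _ (Set.mem_range_self i)).trans ?_
    exact_mod_cast hcard

section chains

variable {k K : Type*} [Field k] [Field K] [Algebra k K] {L : IntermediateField k K} {m : ℕ}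

theorem rank_le_of_quadratic {z : K} (a b : K) (ha : a ∈ L) (hb : b ∈ L)
    (hz : z ^ 2 + b * z + a = 0)
    (h : ∀ M : IntermediateField k K, L ≤ M → z ∈ M → Module.rank M K ≤ m) :
    Module.rank L K ≤ (2 * m : ℕ) := by
  refine rank_le_mul_of_root z 2 1 ![a, b] one_ne_zero (one_mem L) ?_ ?_ h
  · simp [Fin.forall_fin_succ, ha, hb]
  · simp only [Fin.sum_univ_succ, Matrix.cons_val_zero, Matrix.cons_val_succ, Fin.val_zero,
      Fin.val_succ, Finset.univ_eq_empty, Finset.sum_empty]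
    linear_combination hz

theorem rank_le_of_cubic {z : K} (a b c : K) (ha : a ∈ L) (hb : b ∈ L) (hc : c ∈ L)
    (hz : z ^ 3 + c * z ^ 2 + b * z + a = 0)
    (h : ∀ M : IntermediateField k K, L ≤ M → z ∈ M → Module.rank M K ≤ m) :
    Module.rank L K ≤ (3 * m : ℕ) := by
  refine rank_le_mul_of_root z 3 1 ![a, b, c] one_ne_zero (one_mem L) ?_ ?_ h
  · simp [Fin.forall_fin_succ, ha, hb, hc]
  · simp only [Fin.sum_univ_succ, Matrix.cons_val_zero, Matrix.cons_val_succ, Fin.val_zero,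
      Fin.val_succ, Finset.univ_eq_empty, Finset.sum_empty]
    linear_combination hz

theorem rank_le_of_quartic {z : K} (a b c d : K) (ha : a ∈ L) (hb : b ∈ L) (hc : c ∈ L)
    (hd : d ∈ L) (hz : z ^ 4 + d * z ^ 3 + c * z ^ 2 + b * z + a = 0)
    (h : ∀ M : IntermediateField k K, L ≤ M → z ∈ M → Module.rank M K ≤ m) :
    Module.rank L K ≤ (4 * m : ℕ) := by
  refine rank_le_mul_of_root z 4 1 ![a, b, c, d] one_ne_zero (one_mem L) ?_ ?_ h
  · simp [Fin.forall_fin_succ, ha, hb, hc, hd]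
  · simp only [Fin.sum_univ_succ, Matrix.cons_val_zero, Matrix.cons_val_succ, Fin.val_zero,
      Fin.val_succ, Finset.univ_eq_empty, Finset.sum_empty]
    linear_combination hz

theorem rank_le_of_quintic {z : K} (a b c d e : K) (ha : a ∈ L) (hb : b ∈ L) (hc : c ∈ L)
    (hd : d ∈ L) (he : e ∈ L) (hz : z ^ 5 + e * z ^ 4 + d * z ^ 3 + c * z ^ 2 + b * z + a = 0)
    (h : ∀ M : IntermediateField k K, L ≤ M → z ∈ M → Module.rank M K ≤ m) :
    Module.rank L K ≤ (5 * m : ℕ) := by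
  refine rank_le_mul_of_root z 5 1 ![a, b, c, d, e] one_ne_zero (one_mem L) ?_ ?_ h
  · simp [Fin.forall_fin_succ, ha, hb, hc, hd, he]
  · simp only [Fin.sum_univ_succ, Matrix.cons_val_zero, Matrix.cons_val_succ, Fin.val_zero,
      Fin.val_succ, Finset.univ_eq_empty, Finset.sum_empty]
    linear_combination hz

theorem rank_le_of_sextic {z : K} (a b c d e f : K) (ha : a ∈ L) (hb : b ∈ L) (hc : c ∈ L)
    (hd : d ∈ L) (he : e ∈ L) (hf : f ∈ L)
    (hz : z ^ 6 + f * z ^ 5 + e * z ^ 4 + d * z ^ 3 + c * z ^ 2 + b * z + a = 0)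
    (h : ∀ M : IntermediateField k K, L ≤ M → z ∈ M → Module.rank M K ≤ m) :
    Module.rank L K ≤ (6 * m : ℕ) := by
  refine rank_le_mul_of_root z 6 1 ![a, b, c, d, e, f] one_ne_zero (one_mem L) ?_ ?_ h
  · simp [Fin.forall_fin_succ, ha, hb, hc, hd, he, hf]
  · simp only [Fin.sum_univ_succ, Matrix.cons_val_zero, Matrix.cons_val_succ, Fin.val_zero,
      Fin.val_succ, Finset.univ_eq_empty, Finset.sum_empty]
    linear_combination hz

theorem mem_of_mul_mem {z c : K} (hc : c ∈ L) (hc0 : c ≠ 0) (h : c * z ∈ L) : z ∈ L := by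
  rw [← mul_div_cancel_left₀ z hc0]
  exact div_mem h hc

theorem mem_of_add_mem {z c : K} (hc : c ∈ L) (h : c + z ∈ L) : z ∈ L := by
  rw [← add_sub_cancel_left c z]
  exact sub_mem h hc

theorem rank_le_of_symm_two {a b : K} (h1 : a + b ∈ L) (h2 : a * b ∈ L)
    (h : ∀ M : IntermediateField k K, L ≤ M → a ∈ M → b ∈ M → Module.rank M K ≤ m) :
    Module.rank L K ≤ (2 * m : ℕ) :=
  rank_le_of_quadratic (z := a) (a * b) (-(a + b)) h2 (neg_mem h1) (by ring) fun M hM ha =>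
    h M hM ha (mem_of_add_mem ha (hM h1))

theorem rank_le_of_symm_three {a b c : K} (h1 : a + b + c ∈ L) (h2 : a * b + a * c + b * c ∈ L)
    (h3 : a * b * c ∈ L)
    (h : ∀ M : IntermediateField k K, L ≤ M → a ∈ M → b ∈ M → c ∈ M → Module.rank M K ≤ m) :
    Module.rank L K ≤ (6 * m : ℕ) := by
  rw [show 6 * m = 3 * (2 * m) by ring]
  refine rank_le_of_cubic (z := a) (-(a * b * c)) (a * b + a * c + b * c) (-(a + b + c))
    (neg_mem h3) h2 (neg_mem h1) (by ring) fun M hM ha => ?_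
  have h1' : b + c ∈ M := mem_of_add_mem ha (by simpa only [add_assoc] using hM h1)
  have h2' : b * c ∈ M := mem_of_add_mem (mul_mem ha h1') (by
    rw [mul_add]
    exact hM h2)
  exact rank_le_of_symm_two h1' h2' fun N hN => h N (hM.trans hN) (hN ha)

theorem rank_le_of_symm_four {a b c d : K} (h1 : a + b + c + d ∈ L)
    (h2 : a * b + a * c + a * d + b * c + b * d + c * d ∈ L)
    (h3 : a * b * c + a * b * d + a * c * d + b * c * d ∈ L) (h4 : a * b * c * d ∈ L)
    (h : ∀ M : IntermediateField k K, L ≤ M → a ∈ M → b ∈ M → c ∈ M → d ∈ M →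
      Module.rank M K ≤ m) :
    Module.rank L K ≤ (24 * m : ℕ) := by
  rw [show 24 * m = 4 * (6 * m) by ring]
  refine rank_le_of_quartic (z := a) _ _ _ _ h4 (neg_mem h3) h2 (neg_mem h1) (by ring)
    fun M hM ha => ?_
  have h1' : b + c + d ∈ M := mem_of_add_mem ha (by convert hM h1 using 1; ring)
  have h2' : b * c + b * d + c * d ∈ M := mem_of_add_mem (mul_mem ha h1') (by
    convert hM h2 using 1; ring)
  have h3' : b * c * d ∈ M := mem_of_add_mem (mul_mem ha h2') (by convert hM h3 using 1; ring)
  exact rank_le_of_symm_three h1' h2' h3' fun N hN => h N (hM.trans hN) (hN ha)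

theorem rank_le_of_symm_five {a b c d e : K} (h1 : a + b + c + d + e ∈ L)
    (h2 : a * b + a * c + a * d + a * e + b * c + b * d + b * e + c * d + c * e + d * e ∈ L)
    (h3 : a * b * c + a * b * d + a * b * e + a * c * d + a * c * e + a * d * e + b * c * d +
      b * c * e + b * d * e + c * d * e ∈ L)
    (h4 : a * b * c * d + a * b * c * e + a * b * d * e + a * c * d * e + b * c * d * e ∈ L)
    (h5 : a * b * c * d * e ∈ L)
    (h : ∀ M : IntermediateField k K, L ≤ M → a ∈ M → b ∈ M → c ∈ M → d ∈ M → e ∈ M →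
      Module.rank M K ≤ m) :
    Module.rank L K ≤ (120 * m : ℕ) := by
  rw [show 120 * m = 5 * (24 * m) by ring]
  refine rank_le_of_quintic (z := a) _ _ _ _ _ (neg_mem h5) h4 (neg_mem h3) h2 (neg_mem h1)
    (by ring) fun M hM ha => ?_
  have h1' : b + c + d + e ∈ M := mem_of_add_mem ha (by convert hM h1 using 1; ring)
  have h2' : b * c + b * d + b * e + c * d + c * e + d * e ∈ M :=
    mem_of_add_mem (mul_mem ha h1') (by convert hM h2 using 1; ring)
  have h3' : b * c * d + b * c * e + b * d * e + c * d * e ∈ M :=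
    mem_of_add_mem (mul_mem ha h2') (by convert hM h3 using 1; ring)
  have h4' : b * c * d * e ∈ M := mem_of_add_mem (mul_mem ha h3') (by convert hM h4 using 1; ring)
  exact rank_le_of_symm_four h1' h2' h3' h4' fun N hN => h N (hM.trans hN) (hN ha)

theorem rank_le_one_of_mem {x : Fin 5 → K} (hgen : IntermediateField.adjoin k (Set.range x) = ⊤)
    (h0 : x 0 ∈ L) (h1 : x 1 ∈ L) (h2 : x 2 ∈ L) (h3 : x 3 ∈ L) (h4 : x 4 ∈ L) :
    Module.rank L K ≤ (1 : ℕ) :=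
  rank_le_one_of_adjoin_eq_top hgen (by simp [Fin.forall_fin_succ, *])

end chains

section classes

variable {k K : Type*} [Field k] [Field K] [Algebra k K]

theorem hasInvariants_trivial : HasInvariants k K [] 1 := fun x hx hgen =>
  ⟨x, by simp, fun L hL => rank_le_one_of_adjoin_eq_top hgen hL⟩

theorem hasInvariants_of_gens (c d : ℕ) {n : ℕ} (c₀ c₁ c₂ c₃ c₄ d₀ d₁ d₂ d₃ d₄ : Fin 5)
    (hc : ∀ i : Fin 5, Fin.ofNat 5 (fiveDigit c i) = ![c₀, c₁, c₂, c₃, c₄] i)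
    (hd : ∀ i : Fin 5, Fin.ofNat 5 (fiveDigit d i) = ![d₀, d₁, d₂, d₃, d₄] i)
    (h : ∀ x : Fin 5 → K, AlgebraicIndependent k x →
      IntermediateField.adjoin k (Set.range x) = ⊤ → ∃ f₀ f₁ f₂ f₃ f₄ : K,
        (∀ φ : K ≃ₐ[k] K, φ (x 0) = x c₀ → φ (x 1) = x c₁ → φ (x 2) = x c₂ → φ (x 3) = x c₃ →
          φ (x 4) = x c₄ → φ f₀ = f₀ ∧ φ f₁ = f₁ ∧ φ f₂ = f₂ ∧ φ f₃ = f₃ ∧ φ f₄ = f₄) ∧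
        (∀ φ : K ≃ₐ[k] K, φ (x 0) = x d₀ → φ (x 1) = x d₁ → φ (x 2) = x d₂ → φ (x 3) = x d₃ →
          φ (x 4) = x d₄ → φ f₀ = f₀ ∧ φ f₁ = f₁ ∧ φ f₂ = f₂ ∧ φ f₃ = f₃ ∧ φ f₄ = f₄) ∧
        ∀ L : IntermediateField k K, f₀ ∈ L → f₁ ∈ L → f₂ ∈ L → f₃ ∈ L → f₄ ∈ L →
          Module.rank L K ≤ n) : HasInvariants k K [c, d] n := fun x hx hgen => by
  obtain ⟨f₀, f₁, f₂, f₃, f₄, hf, hf', hr⟩ := h x hx hgen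
  refine ⟨![f₀, f₁, f₂, f₃, f₄], fun b hb φ hφ => ?_,
    fun L hL => hr L (hL 0) (hL 1) (hL 2) (hL 3) (hL 4)⟩
  simp only [List.mem_cons, List.not_mem_nil, or_false] at hb
  obtain rfl | rfl := hb
  · simp only [hc] at hφ
    simpa [Fin.forall_fin_succ] using hf φ (hφ 0) (hφ 1) (hφ 2) (hφ 3) (hφ 4)
  · simp only [hd] at hφ
    simpa [Fin.forall_fin_succ] using hf' φ (hφ 0) (hφ 1) (hφ 2) (hφ 3) (hφ 4)

theorem hasInvariants_of_gen (c : ℕ) {n : ℕ} (c₀ c₁ c₂ c₃ c₄ : Fin 5)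
    (hc : ∀ i : Fin 5, Fin.ofNat 5 (fiveDigit c i) = ![c₀, c₁, c₂, c₃, c₄] i)
    (h : ∀ x : Fin 5 → K, AlgebraicIndependent k x →
      IntermediateField.adjoin k (Set.range x) = ⊤ → ∃ f₀ f₁ f₂ f₃ f₄ : K,
        (∀ φ : K ≃ₐ[k] K, φ (x 0) = x c₀ → φ (x 1) = x c₁ → φ (x 2) = x c₂ → φ (x 3) = x c₃ →
          φ (x 4) = x c₄ → φ f₀ = f₀ ∧ φ f₁ = f₁ ∧ φ f₂ = f₂ ∧ φ f₃ = f₃ ∧ φ f₄ = f₄) ∧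
        ∀ L : IntermediateField k K, f₀ ∈ L → f₁ ∈ L → f₂ ∈ L → f₃ ∈ L → f₄ ∈ L →
          Module.rank L K ≤ n) : HasInvariants k K [c] n := fun x hx hgen => by
  obtain ⟨f, hf, hr⟩ := hasInvariants_of_gens c c c₀ c₁ c₂ c₃ c₄ c₀ c₁ c₂ c₃ c₄ hc hc
    (fun x hx hgen => by
      obtain ⟨f₀, f₁, f₂, f₃, f₄, hf, hr⟩ := h x hx hgen
      exact ⟨f₀, f₁, f₂, f₃, f₄, hf, hf, hr⟩) x hx hgen
  exact ⟨f, fun b hb => hf b (by simpa using hb), hr⟩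

theorem hasInvariants_swap : HasInvariants k K [2926] 2 := by
  refine hasInvariants_of_gen 2926 1 0 2 3 4 (by decide) fun x hx hgen =>
    ⟨x 0 + x 1, x 0 * x 1, x 2, x 3, x 4, ?_, fun L h0 h1 h2 h3 h4 => ?_⟩
  · intro φ h0 h1 h2 h3 h4
    refine ⟨?_, ?_, ?_, ?_, ?_⟩ <;> simp only [map_add, map_mul, h0, h1, h2, h3, h4] <;> ring
  · exact rank_le_of_symm_two h0 h1 fun M hM m0 m1 =>
      rank_le_one_of_mem hgen m0 m1 (hM h2) (hM h3) (hM h4)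

theorem hasInvariants_swap_swap : HasInvariants k K [2926, 2830] 4 := by
  refine hasInvariants_of_gens 2926 2830 1 0 2 3 4 0 1 3 2 4 (by decide) (by decide)
    fun x hx hgen =>
    ⟨x 0 + x 1, x 0 * x 1, x 2 + x 3, x 2 * x 3, x 4, ?_, ?_,
      fun L h0 h1 h2 h3 h4 => ?_⟩
  · intro φ h0 h1 h2 h3 h4
    refine ⟨?_, ?_, ?_, ?_, ?_⟩ <;> simp only [map_add, map_mul, h0, h1, h2, h3, h4] <;> ring
  · intro φ h0 h1 h2 h3 h4
    refine ⟨?_, ?_, ?_, ?_, ?_⟩ <;> simp only [map_add, map_mul, h0, h1, h2, h3, h4] <;> ring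
  · exact rank_le_of_symm_two h0 h1 fun M hM m0 m1 =>
      rank_le_of_symm_two (hM h2) (hM h3) fun N hN n2 n3 =>
        rank_le_one_of_mem hgen (hN m0) (hN m1) n2 n3 (hN (hM h4))

theorem hasInvariants_double_swap : HasInvariants k K [2826] 2 := by
  refine hasInvariants_of_gen 2826 1 0 3 2 4 (by decide) fun x hx hgen =>
    ⟨x 0 + x 1, x 0 * x 1, x 2 + x 3, x 0 * x 2 + x 1 * x 3, x 4, ?_, fun L h0 h1 h2 h3 h4 => ?_⟩
  · intro φ h0 h1 h2 h3 h4
    refine ⟨?_, ?_, ?_, ?_, ?_⟩ <;> simp only [map_add, map_mul, h0, h1, h2, h3, h4] <;> ring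
  · refine rank_le_of_symm_two (m := 1) h0 h1 fun M hM m0 m1 => ?_
    have hne : x 0 - x 1 ≠ 0 := sub_ne_zero.mpr (hx.injective.ne (by decide))
    have m2 : x 2 ∈ M := mem_of_mul_mem (sub_mem m0 m1) hne (by
      rw [show (x 0 - x 1) * x 2 = x 0 * x 2 + x 1 * x 3 - x 1 * (x 2 + x 3) by ring]
      exact sub_mem (hM h3) (mul_mem m1 (hM h2)))
    exact rank_le_one_of_mem hgen m0 m1 m2 (mem_of_add_mem m2 (hM h2)) (hM h4)

theorem hasInvariants_symm_three : HasInvariants k K [2886, 2926] 6 := by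
  refine hasInvariants_of_gens 2886 2926 1 2 0 3 4 1 0 2 3 4 (by decide) (by decide)
    fun x hx hgen =>
    ⟨x 0 + x 1 + x 2, x 0 * x 1 + x 0 * x 2 + x 1 * x 2, x 0 * x 1 * x 2, x 3, x 4, ?_, ?_,
      fun L h0 h1 h2 h3 h4 => ?_⟩
  · intro φ h0 h1 h2 h3 h4
    refine ⟨?_, ?_, ?_, ?_, ?_⟩ <;> simp only [map_add, map_mul, h0, h1, h2, h3, h4] <;> ring
  · intro φ h0 h1 h2 h3 h4
    refine ⟨?_, ?_, ?_, ?_, ?_⟩ <;> simp only [map_add, map_mul, h0, h1, h2, h3, h4] <;> ring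
  · exact rank_le_of_symm_three h0 h1 h2 fun M hM m0 m1 m2 =>
      rank_le_one_of_mem hgen m0 m1 m2 (hM h3) (hM h4)

theorem hasInvariants_symm_three_two : HasInvariants k K [2386, 2926] 12 := by
  refine hasInvariants_of_gens 2386 2926 1 2 0 4 3 1 0 2 3 4 (by decide) (by decide)
    fun x hx hgen =>
    ⟨x 0 + x 1 + x 2, x 0 * x 1 + x 0 * x 2 + x 1 * x 2, x 0 * x 1 * x 2, x 3 + x 4,
      x 3 * x 4, ?_, ?_, fun L h0 h1 h2 h3 h4 => ?_⟩
  · intro φ h0 h1 h2 h3 h4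
    refine ⟨?_, ?_, ?_, ?_, ?_⟩ <;> simp only [map_add, map_mul, h0, h1, h2, h3, h4] <;> ring
  · intro φ h0 h1 h2 h3 h4
    refine ⟨?_, ?_, ?_, ?_, ?_⟩ <;> simp only [map_add, map_mul, h0, h1, h2, h3, h4] <;> ring
  · exact rank_le_of_symm_three (m := 2) h0 h1 h2 fun M hM m0 m1 m2 =>
      rank_le_of_symm_two (hM h3) (hM h4) fun N hN n3 n4 =>
        rank_le_one_of_mem hgen (hN m0) (hN m1) (hN m2) n3 n4

theorem hasInvariants_symm_four : HasInvariants k K [2586, 2926] 24 := by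
  refine hasInvariants_of_gens 2586 2926 1 2 3 0 4 1 0 2 3 4 (by decide) (by decide)
    fun x hx hgen =>
    ⟨x 0 + x 1 + x 2 + x 3, 
      x 0 * x 1 + x 0 * x 2 + x 0 * x 3 + x 1 * x 2 + x 1 * x 3 + x 2 * x 3,
      x 0 * x 1 * x 2 + x 0 * x 1 * x 3 + x 0 * x 2 * x 3 + x 1 * x 2 * x 3,
      x 0 * x 1 * x 2 * x 3, x 4, ?_, ?_,
      fun L h0 h1 h2 h3 h4 => ?_⟩
  · intro φ h0 h1 h2 h3 h4
    refine ⟨?_, ?_, ?_, ?_, ?_⟩ <;> simp only [map_add, map_mul, h0, h1, h2, h3, h4] <;> ring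
  · intro φ h0 h1 h2 h3 h4
    refine ⟨?_, ?_, ?_, ?_, ?_⟩ <;> simp only [map_add, map_mul, h0, h1, h2, h3, h4] <;> ring
  · exact rank_le_of_symm_four h0 h1 h2 h3 fun M hM m0 m1 m2 m3 =>
      rank_le_one_of_mem hgen m0 m1 m2 m3 (hM h4)

theorem hasInvariants_symm_five : HasInvariants k K [586, 2926] 120 := by
  refine hasInvariants_of_gens 586 2926 1 2 3 4 0 1 0 2 3 4 (by decide) (by decide)
    fun x hx hgen =>
    ⟨x 0 + x 1 + x 2 + x 3 + x 4,
      x 0 * x 1 + x 0 * x 2 + x 0 * x 3 + x 0 * x 4 + x 1 * x 2 + x 1 * x 3 + x 1 * x 4 +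
        x 2 * x 3 + x 2 * x 4 + x 3 * x 4,
      x 0 * x 1 * x 2 + x 0 * x 1 * x 3 + x 0 * x 1 * x 4 + x 0 * x 2 * x 3 + x 0 * x 2 * x 4 +
        x 0 * x 3 * x 4 + x 1 * x 2 * x 3 + x 1 * x 2 * x 4 + x 1 * x 3 * x 4 + x 2 * x 3 * x 4,
      x 0 * x 1 * x 2 * x 3 + x 0 * x 1 * x 2 * x 4 + x 0 * x 1 * x 3 * x 4 +
        x 0 * x 2 * x 3 * x 4 + x 1 * x 2 * x 3 * x 4,
      x 0 * x 1 * x 2 * x 3 * x 4, ?_, ?_,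
      fun L h0 h1 h2 h3 h4 => ?_⟩
  · intro φ h0 h1 h2 h3 h4
    refine ⟨?_, ?_, ?_, ?_, ?_⟩ <;> simp only [map_add, map_mul, h0, h1, h2, h3, h4] <;> ring
  · intro φ h0 h1 h2 h3 h4
    refine ⟨?_, ?_, ?_, ?_, ?_⟩ <;> simp only [map_add, map_mul, h0, h1, h2, h3, h4] <;> ring
  · exact rank_le_of_symm_five h0 h1 h2 h3 h4 fun M hM m0 m1 m2 m3 m4 =>
      rank_le_one_of_mem hgen m0 m1 m2 m3 m4

theorem hasInvariants_dihedral_four : HasInvariants k K [2926, 2642] 8 := by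
  refine hasInvariants_of_gens 2926 2642 1 0 2 3 4 2 3 0 1 4 (by decide) (by decide)
    fun x hx hgen =>
    ⟨x 0 + x 1 + (x 2 + x 3), (x 0 + x 1) * (x 2 + x 3), x 0 * x 1 + x 2 * x 3,
      (x 0 + x 1) * (x 0 * x 1) + (x 2 + x 3) * (x 2 * x 3), x 4, ?_, ?_,
      fun L h0 h1 h2 h3 h4 => ?_⟩
  · intro φ h0 h1 h2 h3 h4
    refine ⟨?_, ?_, ?_, ?_, ?_⟩ <;> simp only [map_add, map_mul, h0, h1, h2, h3, h4] <;> ring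
  · intro φ h0 h1 h2 h3 h4
    refine ⟨?_, ?_, ?_, ?_, ?_⟩ <;> simp only [map_add, map_mul, h0, h1, h2, h3, h4] <;> ring
  · refine rank_le_of_symm_two (m := 4) h0 h1 fun M hM ms mt => ?_
    have hne : (x 0 + x 1) - (x 2 + x 3) ≠ 0 := by
      have h := hx.aeval_ne_zero_of
        ((MvPolynomial.X 0 + MvPolynomial.X 1) - (MvPolynomial.X 2 + MvPolynomial.X 3))
        (![1, 0, 0, 0, 0] : Fin 5 → k) (by simp)
      simpa only [map_sub, map_add, MvPolynomial.aeval_X] using h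
    have mp : x 0 * x 1 ∈ M := mem_of_mul_mem (sub_mem ms mt) hne (by
      rw [show ((x 0 + x 1) - (x 2 + x 3)) * (x 0 * x 1) =
        (x 0 + x 1) * (x 0 * x 1) + (x 2 + x 3) * (x 2 * x 3) -
        (x 2 + x 3) * (x 0 * x 1 + x 2 * x 3) by ring]
      exact sub_mem (hM h3) (mul_mem mt (hM h2)))
    have mq : x 2 * x 3 ∈ M := mem_of_add_mem mp (hM h2)
    exact rank_le_of_symm_two (m := 2) ms mp fun N hN n0 n1 =>
      rank_le_of_symm_two (m := 1) (hN mt) (hN mq) fun P hP p2 p3 =>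
        rank_le_one_of_mem hgen (hP n0) (hP n1) p2 p3 (hP (hN (hM h4)))

theorem hasInvariants_symm_three_twisted : HasInvariants k K [2886, 2426] 6 := by
  refine hasInvariants_of_gens 2886 2426 1 2 0 3 4 1 0 2 4 3 (by decide) (by decide)
    fun x hx hgen =>
    ⟨x 0 + x 1 + x 2, x 0 * x 1 + x 0 * x 2 + x 1 * x 2, x 0 * x 1 * x 2, x 3 + x 4,
      (x 0 ^ 2 * x 1 + x 1 ^ 2 * x 2 + x 2 ^ 2 * x 0) * x 3 +
        (x 1 ^ 2 * x 0 + x 2 ^ 2 * x 1 + x 0 ^ 2 * x 2) * x 4, ?_, ?_,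
      fun L h0 h1 h2 h3 h4 => ?_⟩
  · intro φ h0 h1 h2 h3 h4
    refine ⟨?_, ?_, ?_, ?_, ?_⟩ <;>
      simp only [map_add, map_mul, map_pow, h0, h1, h2, h3, h4] <;> ring
  · intro φ h0 h1 h2 h3 h4
    refine ⟨?_, ?_, ?_, ?_, ?_⟩ <;>
      simp only [map_add, map_mul, map_pow, h0, h1, h2, h3, h4] <;> ring
  · refine rank_le_of_symm_three (m := 1) h0 h1 h2 fun M hM m0 m1 m2 => ?_
    have hne : (x 0 - x 1) * (x 0 - x 2) * (x 1 - x 2) ≠ 0 := by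
      simp [sub_eq_zero, hx.injective.eq_iff]
    have m3 : x 3 ∈ M := mem_of_mul_mem (by aesop) hne (by
      rw [show (x 0 - x 1) * (x 0 - x 2) * (x 1 - x 2) * x 3 =
        (x 0 ^ 2 * x 1 + x 1 ^ 2 * x 2 + x 2 ^ 2 * x 0) * x 3 +
        (x 1 ^ 2 * x 0 + x 2 ^ 2 * x 1 + x 0 ^ 2 * x 2) * x 4 -
        (x 1 ^ 2 * x 0 + x 2 ^ 2 * x 1 + x 0 ^ 2 * x 2) * (x 3 + x 4) by ring]
      exact sub_mem (hM h4) (mul_mem (by aesop) (hM h3)))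
    exact rank_le_one_of_mem hgen m0 m1 m2 m3 (mem_of_add_mem m3 (hM h3))

end classes

section cyclicThree

variable {k K : Type*} [Field k] [Field K] [Algebra k K]

/-- The simple ratio of three elements of a field. -/
def simpleRatio (a b c : K) : K := (a - b) / (b - c)

def cyclicTrace (a b c : K) : K := simpleRatio a b c + simpleRatio b c a + simpleRatio c a b

def cyclicMoment (a b c a' b' c' : K) : K :=
  a' * simpleRatio a b c + b' * simpleRatio b c a + c' * simpleRatio c a b

theorem cyclicTrace_rotate (a b c : K) : cyclicTrace b c a = cyclicTrace a b c := by
  unfold cyclicTrace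
  ring

theorem cyclicMoment_rotate (a b c a' b' c' : K) :
    cyclicMoment b c a b' c' a' = cyclicMoment a b c a' b' c' := by
  unfold cyclicMoment
  ring

section

variable (φ : K ≃ₐ[k] K)

theorem map_simpleRatio (a b c : K) : φ (simpleRatio a b c) = simpleRatio (φ a) (φ b) (φ c) := by
  simp [simpleRatio]

theorem map_cyclicTrace (a b c : K) : φ (cyclicTrace a b c) = cyclicTrace (φ a) (φ b) (φ c) := by
  simp [cyclicTrace, map_simpleRatio]

theorem map_cyclicMoment (a b c a' b' c' : K) : φ (cyclicMoment a b c a' b' c') =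
    cyclicMoment (φ a) (φ b) (φ c) (φ a') (φ b') (φ c') := by
  simp [cyclicMoment, map_simpleRatio]

end

theorem rank_le_of_cyclic_three {L : IntermediateField k K} {m : ℕ} {a b c : K} (hab : a ≠ b)
    (hbc : b ≠ c) (hca : c ≠ a)
    (hu : (a - b) ^ 2 * (c - a) + (b - c) ^ 2 * (a - b) + (c - a) ^ 2 * (b - c) ≠ 0)
    (hd : (a - b) ^ 2 * (b - c) ^ 2 + (b - c) ^ 2 * (c - a) ^ 2 + (c - a) ^ 2 * (a - b) ^ 2 ≠ 0)
    (h1 : cyclicTrace a b c ∈ L) (h2 : cyclicMoment a b c a b c ∈ L)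
    (h3 : cyclicMoment a b c c a b ∈ L)
    (h : ∀ M : IntermediateField k K, L ≤ M → a ∈ M → b ∈ M → c ∈ M → Module.rank M K ≤ m) :
    Module.rank L K ≤ (3 * m : ℕ) := by
  have hab' := sub_ne_zero.mpr hab
  have hbc' := sub_ne_zero.mpr hbc
  have hca' := sub_ne_zero.mpr hca
  refine rank_le_of_cubic (z := simpleRatio a b c) (-1) (-(cyclicTrace a b c + 3))
    (-cyclicTrace a b c) (neg_mem (one_mem L)) (by aesop) (neg_mem h1) ?_ fun M hM ht => ?_
  · unfold cyclicTrace simpleRatio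
    field_simp
    ring
  have ht' : simpleRatio b c a ∈ M := by
    rw [show simpleRatio b c a = -1 / (1 + simpleRatio a b c) by
      have : 1 + simpleRatio a b c = -(c - a) / (b - c) := by
        unfold simpleRatio
        field_simp
        ring
      rw [this]
      unfold simpleRatio
      field_simp]
    aesop
  have ht'' : simpleRatio c a b ∈ M := by
    refine mem_of_add_mem (add_mem ht ht') (hM h1)
  have hq : b - c ∈ M := by
    refine mem_of_mul_mem (c := simpleRatio a b c ^ 2 + simpleRatio a b c -
      simpleRatio a b c * simpleRatio b c a - simpleRatio c a b) (by aesop) ?_ ?_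
    · intro e
      apply hd
      unfold simpleRatio at e
      field_simp at e
      linear_combination -e
    · have := sub_mem (hM h2) (hM h3)
      convert this using 1
      unfold cyclicMoment simpleRatio
      field_simp
      ring
  have hb : a - b ∈ M := by
    rw [show a - b = simpleRatio a b c * (b - c) by unfold simpleRatio; field_simp]
    exact mul_mem ht hq
  have hu' : cyclicTrace a b c ≠ 0 := by
    intro e
    apply hu
    unfold cyclicTrace simpleRatio at e
    field_simp at e
    linear_combination e
  have ha : a ∈ M := by
    refine mem_of_mul_mem (hM h1) hu' ?_
    rw [show cyclicTrace a b c * a = cyclicMoment a b c a b c + (a - b) * simpleRatio b c a +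
      (a - b + (b - c)) * simpleRatio c a b by unfold cyclicTrace cyclicMoment; ring]
    exact add_mem (add_mem (hM h2) (mul_mem hb ht')) (mul_mem (add_mem hb hq) ht'')
  have hb' : b ∈ M := by simpa using sub_mem ha hb
  exact h M hM ha hb' (by simpa using sub_mem hb' hq)

/-- The genericity conditions of `rank_le_of_cyclic_three`. -/
theorem AlgebraicIndependent.cyclic_three_ne_zero {x : Fin 5 → K} (hx : AlgebraicIndependent k x) :
    (x 0 - x 1) ^ 2 * (x 2 - x 0) + (x 1 - x 2) ^ 2 * (x 0 - x 1) +
      (x 2 - x 0) ^ 2 * (x 1 - x 2) ≠ 0 ∧ (x 0 - x 1) ^ 2 * (x 1 - x 2) ^ 2 +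
      (x 1 - x 2) ^ 2 * (x 2 - x 0) ^ 2 + (x 2 - x 0) ^ 2 * (x 0 - x 1) ^ 2 ≠ 0 := by
  have h := hx.aeval_ne_zero_of
    ((.X 0 - .X 1) ^ 2 * (.X 2 - .X 0) + (.X 1 - .X 2) ^ 2 * (.X 0 - .X 1) +
      (.X 2 - .X 0) ^ 2 * (.X 1 - .X 2)) (![0, 0, 1, 0, 0] : Fin 5 → k) (by simp)
  have h' := hx.aeval_ne_zero_of
    ((.X 0 - .X 1) ^ 2 * (.X 1 - .X 2) ^ 2 + (.X 1 - .X 2) ^ 2 * (.X 2 - .X 0) ^ 2 +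
      (.X 2 - .X 0) ^ 2 * (.X 0 - .X 1) ^ 2) (![0, 0, 1, 0, 0] : Fin 5 → k) (by simp)
  constructor
  · simpa only [map_sub, map_add, map_mul, map_pow, MvPolynomial.aeval_X] using h
  · simpa only [map_sub, map_add, map_mul, map_pow, MvPolynomial.aeval_X] using h'

theorem hasInvariants_cyclic_three : HasInvariants k K [2886] 3 := by
  refine hasInvariants_of_gen 2886 1 2 0 3 4 (by decide) fun x hx hgen =>
    ⟨cyclicTrace (x 0) (x 1) (x 2), cyclicMoment (x 0) (x 1) (x 2) (x 0) (x 1) (x 2),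
      cyclicMoment (x 0) (x 1) (x 2) (x 2) (x 0) (x 1), x 3, x 4, ?_, fun L h0 h1 h2 h3 h4 => ?_⟩
  · intro φ h0 h1 h2 h3 h4
    simp only [map_cyclicTrace, map_cyclicMoment, h0, h1, h2, h3, h4, and_true]
    exact ⟨cyclicTrace_rotate .., cyclicMoment_rotate .., cyclicMoment_rotate ..⟩
  · obtain ⟨hu, hd⟩ := hx.cyclic_three_ne_zero
    exact rank_le_of_cyclic_three (m := 1) (hx.injective.ne (by decide))
      (hx.injective.ne (by decide)) (hx.injective.ne (by decide)) hu hd h0 h1 h2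
      fun M hM m0 m1 m2 => rank_le_one_of_mem hgen m0 m1 m2 (hM h3) (hM h4)

theorem hasInvariants_cyclic_three_swap : HasInvariants k K [2886, 2430] 6 := by
  refine hasInvariants_of_gens 2886 2430 1 2 0 3 4 0 1 2 4 3 (by decide) (by decide)
    fun x hx hgen =>
    ⟨cyclicTrace (x 0) (x 1) (x 2), cyclicMoment (x 0) (x 1) (x 2) (x 0) (x 1) (x 2),
      cyclicMoment (x 0) (x 1) (x 2) (x 2) (x 0) (x 1), x 3 + x 4, x 3 * x 4, ?_, ?_,
      fun L h0 h1 h2 h3 h4 => ?_⟩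
  · intro φ h0 h1 h2 h3 h4
    simp only [map_cyclicTrace, map_cyclicMoment, h0, h1, h2, h3, h4, and_true, map_add, map_mul]
    exact ⟨cyclicTrace_rotate .., cyclicMoment_rotate .., cyclicMoment_rotate ..⟩
  · intro φ h0 h1 h2 h3 h4
    simp only [map_cyclicTrace, map_cyclicMoment, h0, h1, h2, h3, h4, true_and, map_add, map_mul]
    exact ⟨add_comm .., mul_comm ..⟩
  · obtain ⟨hu, hd⟩ := hx.cyclic_three_ne_zero
    exact rank_le_of_cyclic_three (m := 2) (hx.injective.ne (by decide))
      (hx.injective.ne (by decide)) (hx.injective.ne (by decide)) hu hd h0 h1 h2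
      fun M hM m0 m1 m2 => rank_le_of_symm_two (m := 1) (hM h3) (hM h4) fun N hN n3 n4 =>
        rank_le_one_of_mem hgen (hN m0) (hN m1) (hN m2) n3 n4

end cyclicThree

section klein

variable {k K : Type*} [Field k] [Field K] [Algebra k K]

/-- The fixed-point parameter of the involution exchanging `a` with `b` and `c` with `d`. -/
def kleinRatio (a b c d : K) : K := (a * b - c * d) / (a + b - c - d)

theorem kleinRatio_comm (a b c d : K) : kleinRatio b a d c = kleinRatio a b c d := by
  unfold kleinRatio
  congr 1 <;> ring

theorem kleinRatio_swap (a b c d : K) : kleinRatio c d a b = kleinRatio a b c d := by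
  unfold kleinRatio
  rw [← neg_div_neg_eq]
  congr 1 <;> ring

theorem kleinRatio_swap' (a b c d : K) : kleinRatio d c b a = kleinRatio a b c d := by
  rw [kleinRatio_swap, kleinRatio_comm]

theorem kleinRatio_comm' (a b c d : K) : kleinRatio b a c d = kleinRatio a b c d := by
  unfold kleinRatio
  congr 1 <;> ring

theorem map_kleinRatio (φ : K ≃ₐ[k] K) (a b c d : K) :
    φ (kleinRatio a b c d) = kleinRatio (φ a) (φ b) (φ c) (φ d) := by
  simp [kleinRatio]

theorem mul_add_mul_mem_of_klein {L : IntermediateField k K} {a b c d : K}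
    (hd1 : a + b - c - d ≠ 0) (hd2 : b + c - a - d ≠ 0) (hd3 : c + a - b - d ≠ 0)
    (h0 : a + b + c + d ∈ L) (h1 : kleinRatio a b c d ∈ L) (h2 : kleinRatio b c a d ∈ L)
    (h3 : kleinRatio c a b d ∈ L) : a * b + c * d ∈ L := by
  rw [show a * b + c * d = (a + b + c + d) * kleinRatio a b c d +
      2 * (kleinRatio b c a d * kleinRatio c a b d -
        kleinRatio a b c d * (kleinRatio b c a d + kleinRatio c a b d)) by
    unfold kleinRatio
    field_simp
    ring]
  exact add_mem (mul_mem h0 h1) (mul_mem (ofNat_mem L 2)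
    (sub_mem (mul_mem h2 h3) (mul_mem h1 (add_mem h2 h3))))

theorem rank_le_of_klein {L : IntermediateField k K} {m : ℕ} {a b c d : K} (hab : a ≠ b)
    (hd1 : a + b - c - d ≠ 0) (hd2 : b + c - a - d ≠ 0) (hd3 : c + a - b - d ≠ 0)
    (h0 : a + b + c + d ∈ L) (h1 : kleinRatio a b c d ∈ L) (h2 : kleinRatio b c a d ∈ L)
    (h3 : kleinRatio c a b d ∈ L)
    (h : ∀ M : IntermediateField k K, L ≤ M → a ∈ M → b ∈ M → c ∈ M → d ∈ M →
      Module.rank M K ≤ m) : Module.rank L K ≤ (4 * m : ℕ) := by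
  have u1 : a * b + c * d ∈ L := mul_add_mul_mem_of_klein hd1 hd2 hd3 h0 h1 h2 h3
  have u2 : b * c + a * d ∈ L := mul_add_mul_mem_of_klein hd2 hd3 hd1
    (by rwa [show b + c + a + d = a + b + c + d by ring]) h2 h3 h1
  have u3 : c * a + b * d ∈ L := mul_add_mul_mem_of_klein hd3 hd1 hd2
    (by rwa [show c + a + b + d = a + b + c + d by ring]) h3 h1 h2
  have t3 : a * b * c + a * b * d + a * c * d + b * c * d ∈ L := by
    rw [show a * b * c + a * b * d + a * c * d + b * c * d = (a + b + c + d) *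
      (kleinRatio a b c d * kleinRatio b c a d + kleinRatio a b c d * kleinRatio c a b d +
        kleinRatio b c a d * kleinRatio c a b d) -
      8 * (kleinRatio a b c d * kleinRatio b c a d * kleinRatio c a b d) by
        unfold kleinRatio
        field_simp
        ring]
    exact sub_mem (mul_mem h0 (add_mem (add_mem (mul_mem h1 h2) (mul_mem h1 h3)) (mul_mem h2 h3)))
      (mul_mem (ofNat_mem L 8) (mul_mem (mul_mem h1 h2) h3))
  rw [show 4 * m = 2 * (2 * m) by ring]
  refine rank_le_of_quadratic (z := a + b) (b * c + a * d + (c * a + b * d)) (-(a + b + c + d))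
    (add_mem u2 u3) (neg_mem h0) (by ring) fun M hM hs => ?_
  have hcd : c + d ∈ M := mem_of_add_mem hs (by rw [← add_assoc]; exact hM h0)
  have hp : a * b ∈ M := by
    refine mem_of_mul_mem (sub_mem hs hcd) (c := a + b - (c + d)) (by rwa [← sub_sub]) ?_
    rw [show (a + b - (c + d)) * (a * b) = (a + b) * (a * b + c * d) -
      (a * b * c + a * b * d + a * c * d + b * c * d) by ring]
    exact sub_mem (mul_mem hs (hM u1)) (hM t3)
  refine rank_le_of_symm_two hs hp fun N hN ha hb => ?_
  have hc : c ∈ N := by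
    refine mem_of_mul_mem (sub_mem ha hb) (sub_ne_zero.mpr hab) ?_
    rw [show (a - b) * c = c * a + b * d - b * (c + d) by ring]
    exact sub_mem (hN (hM u3)) (mul_mem hb (hN hcd))
  exact h N (hM.trans hN) ha hb hc (mem_of_add_mem hc (hN hcd))

theorem AlgebraicIndependent.add_sub_sub_ne_zero {x : Fin 5 → K} (hx : AlgebraicIndependent k x)
    {i j l m : Fin 5} (hj : j ≠ i) (hl : l ≠ i) (hm : m ≠ i) : x i + x j - x l - x m ≠ 0 := by
  have h := hx.aeval_ne_zero_of (.X i + .X j - .X l - .X m) (Pi.single i 1 : Fin 5 → k)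
    (by simp [hj, hl, hm])
  simpa only [map_sub, map_add, MvPolynomial.aeval_X] using h

theorem rank_le_of_klein_of_algebraicIndependent {x : Fin 5 → K} (hx : AlgebraicIndependent k x)
    {L : IntermediateField k K} {m : ℕ} (h0 : x 0 + x 1 + x 2 + x 3 ∈ L)
    (h1 : kleinRatio (x 0) (x 1) (x 2) (x 3) ∈ L) (h2 : kleinRatio (x 1) (x 2) (x 0) (x 3) ∈ L)
    (h3 : kleinRatio (x 2) (x 0) (x 1) (x 3) ∈ L)
    (h : ∀ M : IntermediateField k K, L ≤ M → x 0 ∈ M → x 1 ∈ M → x 2 ∈ M → x 3 ∈ M →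
      Module.rank M K ≤ m) : Module.rank L K ≤ (4 * m : ℕ) :=
  rank_le_of_klein (hx.injective.ne (by decide))
    (hx.add_sub_sub_ne_zero (by decide) (by decide) (by decide))
    (hx.add_sub_sub_ne_zero (by decide) (by decide) (by decide))
    (hx.add_sub_sub_ne_zero (by decide) (by decide) (by decide)) h0 h1 h2 h3 h

theorem hasInvariants_klein : HasInvariants k K [2826, 2642] 4 := by
  refine hasInvariants_of_gens 2826 2642 1 0 3 2 4 2 3 0 1 4 (by decide) (by decide)
    fun x hx hgen => ⟨kleinRatio (x 0) (x 1) (x 2) (x 3), kleinRatio (x 1) (x 2) (x 0) (x 3),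
      kleinRatio (x 2) (x 0) (x 1) (x 3), x 0 + x 1 + x 2 + x 3, x 4, ?_, ?_,
      fun L h0 h1 h2 h3 h4 => ?_⟩
  · intro φ h0 h1 h2 h3 h4
    simp only [map_kleinRatio, map_add, h0, h1, h2, h3, h4, and_true]
    exact ⟨kleinRatio_comm .., kleinRatio_swap .., kleinRatio_swap' .., by ring⟩
  · intro φ h0 h1 h2 h3 h4
    simp only [map_kleinRatio, map_add, h0, h1, h2, h3, h4, and_true]
    exact ⟨kleinRatio_swap .., kleinRatio_swap' .., kleinRatio_comm .., by ring⟩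
  · exact rank_le_of_klein_of_algebraicIndependent (m := 1) hx h3 h0 h1 h2
      fun M hM m0 m1 m2 m3 => rank_le_one_of_mem hgen m0 m1 m2 m3 (hM h4)

theorem hasInvariants_alternating_four : HasInvariants k K [2886, 2826] 12 := by
  refine hasInvariants_of_gens 2886 2826 1 2 0 3 4 1 0 3 2 4 (by decide) (by decide)
    fun x hx hgen => ?_
  let z : Fin 5 → K := ![kleinRatio (x 0) (x 1) (x 2) (x 3), kleinRatio (x 1) (x 2) (x 0) (x 3),
    kleinRatio (x 2) (x 0) (x 1) (x 3), x 0 + x 1 + x 2 + x 3, x 4]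
  have hz : ∀ L : IntermediateField k K, (∀ i, z i ∈ L) → Module.rank L K ≤ (4 * 1 : ℕ) :=
    fun L hL => rank_le_of_klein_of_algebraicIndependent hx (hL 3) (hL 0) (hL 1) (hL 2)
      fun M hM m0 m1 m2 m3 => rank_le_one_of_mem hgen m0 m1 m2 m3 (hM (hL 4))
  have hzi : AlgebraicIndependent k z := algebraicIndependent_of_rank_le hx
    (hz _ fun i => IntermediateField.subset_adjoin _ _ (Set.mem_range_self i))
  refine ⟨cyclicTrace (z 0) (z 1) (z 2), cyclicMoment (z 0) (z 1) (z 2) (z 0) (z 1) (z 2),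
    cyclicMoment (z 0) (z 1) (z 2) (z 2) (z 0) (z 1), z 3, z 4, ?_, ?_,
    fun L h0 h1 h2 h3 h4 => ?_⟩
  · intro φ h0 h1 h2 h3 h4
    have e0 : φ (z 0) = z 1 := by simp [z, map_kleinRatio, h0, h1, h2, h3]
    have e1 : φ (z 1) = z 2 := by simp [z, map_kleinRatio, h0, h1, h2, h3]
    have e2 : φ (z 2) = z 0 := by simp [z, map_kleinRatio, h0, h1, h2, h3]
    have e3 : φ (z 3) = z 3 := by
      simp only [z, Matrix.cons_val, map_add, h0, h1, h2, h3]
      ring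
    simp only [map_cyclicTrace, map_cyclicMoment, e0, e1, e2, e3, true_and]
    exact ⟨cyclicTrace_rotate .., cyclicMoment_rotate .., cyclicMoment_rotate .., h4⟩
  · intro φ h0 h1 h2 h3 h4
    have e0 : φ (z 0) = z 0 := by
      simp only [z, Matrix.cons_val, map_kleinRatio, h0, h1, h2, h3]
      exact kleinRatio_comm ..
    have e1 : φ (z 1) = z 1 := by
      simp only [z, Matrix.cons_val, map_kleinRatio, h0, h1, h2, h3]
      exact kleinRatio_swap ..
    have e2 : φ (z 2) = z 2 := by
      simp only [z, Matrix.cons_val, map_kleinRatio, h0, h1, h2, h3]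
      exact kleinRatio_swap' ..
    have e3 : φ (z 3) = z 3 := by
      simp only [z, Matrix.cons_val, map_add, h0, h1, h2, h3]
      ring
    simp only [map_cyclicTrace, map_cyclicMoment, e0, e1, e2, e3, true_and]
    exact h4
  · obtain ⟨hu, hd⟩ := hzi.cyclic_three_ne_zero
    exact rank_le_of_cyclic_three (m := 4 * 1) (hzi.injective.ne (by decide))
      (hzi.injective.ne (by decide)) (hzi.injective.ne (by decide)) hu hd h0 h1 h2
      fun M hM m0 m1 m2 => hz M (by simp [Fin.forall_fin_succ, m0, m1, m2, hM h3, hM h4])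

end klein

section cyclicFour

variable {k K : Type*} [Field k] [Field K] [Algebra k K]

theorem rank_le_of_cyclic_four {L : IntermediateField k K} {m : ℕ} {a b c d : K}
    (hp : a - c ≠ 0) (hq : b - d ≠ 0) (hpq : (a - c) ^ 2 + (b - d) ^ 2 ≠ 0)
    (hd : a + c - b - d ≠ 0) (h0 : kleinRatio a c b d ∈ L)
    (h1 : (a + c - b - d) * ((a - c) ^ 2 + (b - d) ^ 2) / ((a - c) * (b - d)) ∈ L)
    (h2 : (a - c) / (b - d) - (b - d) / (a - c) ∈ L)
    (h3 : (a - b) * (d - c) / (b - d) ^ 2 + (b - c) * (a - d) / (a - c) ^ 2 ∈ L)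
    (h : ∀ M : IntermediateField k K, L ≤ M → a ∈ M → b ∈ M → c ∈ M → d ∈ M →
      Module.rank M K ≤ m) : Module.rank L K ≤ (4 * m : ℕ) := by
  rw [show 4 * m = 2 * (2 * m) by ring]
  refine rank_le_of_quadratic (z := (a - c) / (b - d)) (-1)
    (-((a - c) / (b - d) - (b - d) / (a - c))) (neg_mem (one_mem L)) (neg_mem h2)
    (by field_simp; ring) fun M hM hr => ?_
  have hr' : (b - d) / (a - c) ∈ M := by
    rw [← inv_div]
    exact inv_mem hr
  have hrr : (a - c) / (b - d) + (b - d) / (a - c) ∈ M := add_mem hr hr'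
  have hrr0 : (a - c) / (b - d) + (b - d) / (a - c) ≠ 0 := by
    rw [div_add_div _ _ hq hp]
    exact div_ne_zero (by convert hpq using 1; ring) (mul_ne_zero hq hp)
  have hg : (a - b) * (d - c) / ((a - c) * (b - d)) ∈ M := by
    refine mem_of_mul_mem hrr hrr0 ?_
    convert sub_mem (hM h3) hr' using 1
    field_simp
    ring
  refine rank_le_of_quadratic (z := (a - b) / (b - d))
    ((a - b) * (d - c) / ((a - c) * (b - d)) * ((a - c) / (b - d))) (-((a - c) / (b - d) - 1))
    (mul_mem hg hr) (neg_mem (sub_mem hr (one_mem M))) (by field_simp; ring) fun N hN hm => ?_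
  have hr := hN hr
  have hq' : b - d ∈ N := by
    refine mem_of_mul_mem (c := (2 * ((a - b) / (b - d)) - (a - c) / (b - d) + 1) *
      ((a - c) / (b - d) + (b - d) / (a - c)))
      (mul_mem (add_mem (sub_mem (mul_mem (ofNat_mem N 2) hm) hr) (one_mem N)) (hN hrr))
      (mul_ne_zero ?_ hrr0) ?_
    · rw [show 2 * ((a - b) / (b - d)) - (a - c) / (b - d) + 1 = (a + c - b - d) / (b - d) by
        field_simp
        ring]
      exact div_ne_zero hd hq
    · convert hN (hM h1) using 1
      field_simp
      ring
  have hd' : a - b ∈ N := by simpa [hq] using mul_mem hm hq'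
  have hp' : a - c ∈ N := by simpa [hq] using mul_mem hr hq'
  have hbd : a + c - b - d ∈ N := by
    rw [show a + c - b - d = (a - b) + (a - b) - (a - c) + (b - d) by ring]
    exact add_mem (sub_mem (add_mem hd' hd') hp') hq'
  have hb : b ∈ N := by
    refine mem_of_mul_mem hbd hd ?_
    rw [show (a + c - b - d) * b = kleinRatio a c b d * (a + c - b - d) -
      (a - b) * ((a - b) - (a - c)) by
        unfold kleinRatio
        field_simp
        ring]
    exact sub_mem (mul_mem (hN (hM h0)) hbd) (mul_mem hd' (sub_mem hd' hp'))
  have ha : a ∈ N := by simpa using add_mem hd' hb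
  exact h N (hM.trans hN) ha hb (by simpa using sub_mem ha hp') (by simpa using sub_mem hb hq')

theorem hasInvariants_cyclic_four : HasInvariants k K [2586] 4 := by
  refine hasInvariants_of_gen 2586 1 2 3 0 4 (by decide) fun x hx hgen =>
    ⟨kleinRatio (x 0) (x 2) (x 1) (x 3), (x 0 + x 2 - x 1 - x 3) *
      ((x 0 - x 2) ^ 2 + (x 1 - x 3) ^ 2) / ((x 0 - x 2) * (x 1 - x 3)),
      (x 0 - x 2) / (x 1 - x 3) - (x 1 - x 3) / (x 0 - x 2),
      (x 0 - x 1) * (x 3 - x 2) / (x 1 - x 3) ^ 2 + (x 1 - x 2) * (x 0 - x 3) / (x 0 - x 2) ^ 2,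
      x 4, ?_, fun L h0 h1 h2 h3 h4 => ?_⟩
  all_goals
    have hp : x 0 - x 2 ≠ 0 := sub_ne_zero.mpr (hx.injective.ne (by decide))
    have hq : x 1 - x 3 ≠ 0 := sub_ne_zero.mpr (hx.injective.ne (by decide))
  · intro φ h0 h1 h2 h3 h4
    have hp' : x 2 - x 0 ≠ 0 := sub_ne_zero.mpr (hx.injective.ne (by decide))
    simp only [map_kleinRatio, map_add, map_sub, map_mul, map_div₀, map_pow, h0, h1, h2, h3, h4,
      and_true]
    refine ⟨?_, ?_, ?_, ?_⟩
    · rw [kleinRatio_swap, kleinRatio_comm']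
    all_goals
      field_simp
      ring
  · have h := hx.aeval_ne_zero_of ((.X 0 - .X 2) ^ 2 + (.X 1 - .X 3) ^ 2)
      (![1, 0, 0, 0, 0] : Fin 5 → k) (by simp)
    exact rank_le_of_cyclic_four (m := 1) hp hq
      (by simpa only [map_sub, map_add, map_pow, MvPolynomial.aeval_X] using h)
      (hx.add_sub_sub_ne_zero (by decide) (by decide) (by decide)) h0 h1 h2 h3
      fun M hM m0 m1 m2 m3 => rank_le_one_of_mem hgen m0 m1 m2 m3 (hM h4)

end cyclicFour

section quinary

open Finset

variable {R S : Type*} [CommRing R] [CommRing S]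

/-- The product of the entries `d i j` with `j ≠ i`. -/
def rowProd (d : Fin 5 → Fin 5 → R) (i : Fin 5) : R :=
  d i (i + 1) * d i (i + 2) * d i (i + 3) * d i (i + 4)

/-- When `d i j = x i - x j`, the degree two invariant of the binary quartic with the four roots
`x j`, `j ≠ i`. -/
def quarticInv (d : Fin 5 → Fin 5 → R) (i : Fin 5) : R :=
  (d (i + 1) (i + 2) * d (i + 3) (i + 4)) ^ 2 +
    d (i + 1) (i + 2) * d (i + 3) (i + 4) * (d (i + 1) (i + 3) * d (i + 4) (i + 2)) +
    (d (i + 1) (i + 3) * d (i + 4) (i + 2)) ^ 2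

/-- A monomial in `rowProd` and `quarticInv`. -/
def rootWeight (p q : ℕ) (d : Fin 5 → Fin 5 → R) (i : Fin 5) : R :=
  rowProd d i ^ p * quarticInv d i ^ q

/-- The moments of the weights `rootWeight` at the points `x i`. -/
def rootMoment (p q e : ℕ) (x : Fin 5 → R) : R :=
  ∑ i, rootWeight p q (fun i j => x i - x j) i * x i ^ e

/-- The linear covariant attached to the weights `rootWeight`. -/
def rootForm (p q : ℕ) (d : Fin 5 → Fin 5 → R) (l : Fin 5) : R :=
  ∑ i, rootWeight p q d i * d l i

theorem map_rootWeight (f : R →+* S) (p q : ℕ) (d : Fin 5 → Fin 5 → R) (i : Fin 5) :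
    f (rootWeight p q d i) = rootWeight p q (fun i j => f (d i j)) i := by
  simp [rootWeight, rowProd, quarticInv]

theorem map_rootMoment (f : R →+* S) (p q e : ℕ) (x : Fin 5 → R) :
    f (rootMoment p q e x) = rootMoment p q e (fun i => f (x i)) := by
  simp [rootMoment, map_rootWeight]

theorem rootForm_sub (p q : ℕ) (x : Fin 5 → R) (l : Fin 5) :
    rootForm p q (fun i j => x i - x j) l = rootMoment p q 0 x * x l - rootMoment p q 1 x := by
  simp only [rootForm, rootMoment, sum_mul, ← sum_sub_distrib]
  exact sum_congr rfl fun i _ => by ring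

theorem rowProd_scale {d m : Fin 5 → Fin 5 → R} {a : R} {c : Fin 5 → R}
    (h : ∀ i j, d i j = a * c i * c j * m i j) (i : Fin 5) :
    rowProd d i = a ^ 4 * c i ^ 3 * (c 0 * c 1 * c 2 * c 3 * c 4) * rowProd m i := by
  simp only [rowProd, h]
  fin_cases i <;> simp <;> ring

theorem sq_mul_quarticInv_scale {d m : Fin 5 → Fin 5 → R} {a : R} {c : Fin 5 → R}
    (h : ∀ i j, d i j = a * c i * c j * m i j) (i : Fin 5) :
    c i ^ 2 * quarticInv d i =
      a ^ 4 * (c 0 * c 1 * c 2 * c 3 * c 4) ^ 2 * quarticInv m i := by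
  simp only [quarticInv, h]
  fin_cases i <;> simp <;> ring

end quinary

section quinary

open Finset

variable {R S : Type*} [CommRing R] [CommRing S]

theorem prod_rowProd_scale {d m : Fin 5 → Fin 5 → R} {a : R} {c : Fin 5 → R}
    (h : ∀ i j, d i j = a * c i * c j * m i j) :
    ∏ i, rowProd d i =
      a ^ 20 * (c 0 * c 1 * c 2 * c 3 * c 4) ^ 8 * ∏ i, rowProd m i := by
  simp only [rowProd_scale h, Fin.prod_univ_five]
  ring

theorem mul_rootWeight_one_two_scale {d m : Fin 5 → Fin 5 → R} {a : R} {c : Fin 5 → R}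
    (h : ∀ i j, d i j = a * c i * c j * m i j) (i : Fin 5) :
    c i * rootWeight 1 2 d i =
      a ^ 12 * (c 0 * c 1 * c 2 * c 3 * c 4) ^ 5 * rootWeight 1 2 m i := by
  have h2 := sq_mul_quarticInv_scale h i
  simp only [rootWeight, rowProd_scale h]
  generalize c 0 * c 1 * c 2 * c 3 * c 4 = C at h2 ⊢
  calc _ = a ^ 4 * C * rowProd m i * (c i ^ 2 * quarticInv d i) ^ 2 := by ring
    _ = _ := by rw [h2]; ring

theorem mul_rootWeight_three_five_scale {d m : Fin 5 → Fin 5 → R} {a : R} {c : Fin 5 → R}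
    (h : ∀ i j, d i j = a * c i * c j * m i j) (i : Fin 5) :
    c i * rootWeight 3 5 d i =
      a ^ 32 * (c 0 * c 1 * c 2 * c 3 * c 4) ^ 13 * rootWeight 3 5 m i := by
  have h2 := sq_mul_quarticInv_scale h i
  simp only [rootWeight, rowProd_scale h]
  generalize c 0 * c 1 * c 2 * c 3 * c 4 = C at h2 ⊢
  calc _ = a ^ 12 * C ^ 3 * rowProd m i ^ 3 * (c i ^ 2 * quarticInv d i) ^ 5 := by ring
    _ = _ := by rw [h2]; ring

theorem rootForm_scale {d m : Fin 5 → Fin 5 → R} {a b : R} {c : Fin 5 → R} {p q : ℕ}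
    (h : ∀ i j, d i j = a * c i * c j * m i j)
    (hw : ∀ i, c i * rootWeight p q d i = b * rootWeight p q m i) (l : Fin 5) :
    rootForm p q d l = a * c l * b * rootForm p q m l := by
  simp only [rootForm, mul_sum]
  refine sum_congr rfl fun i _ => ?_
  rw [h l i]
  linear_combination (a * c l * m l i) * hw i

theorem rootMoment_three_five_zero_apply (y : R) :
    rootMoment 3 5 0 ![y, 0, 0, 1, 1] = (y ^ 2 * (y - 1) ^ 2) ^ 3 := by
  simp [rootMoment, rootWeight, rowProd, quarticInv, Fin.sum_univ_five]
  ring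

theorem rootMoment_det_apply (y : R) :
    rootMoment 3 5 0 ![1, y, y ^ 2, 0, 0] * rootMoment 1 2 1 ![1, y, y ^ 2, 0, 0] -
      rootMoment 1 2 0 ![1, y, y ^ 2, 0, 0] * rootMoment 3 5 1 ![1, y, y ^ 2, 0, 0] =
    y ^ 38 * (2 - 11 * y + y ^ 2 * (14 + 34 * y - 118 * y ^ 2 + 91 * y ^ 3 + 102 * y ^ 4 -
      228 * y ^ 5 + 102 * y ^ 6 + 91 * y ^ 7 - 118 * y ^ 8 + 34 * y ^ 9 + 14 * y ^ 10 -
      11 * y ^ 11 + 2 * y ^ 12)) := by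
  simp [rootMoment, rootWeight, rowProd, quarticInv, Fin.sum_univ_five]
  ring

end quinary

section quinary

open Finset

section

variable {R : Type*} [CommRing R]

theorem rootForm_three_five_apply (y : R) (l : Fin 5) :
    rootForm 3 5 (fun i j => (![0, y, 0, 1, 1] : Fin 5 → R) (i - l) -
      (![0, y, 0, 1, 1] : Fin 5 → R) (j - l)) l = (y ^ 2 * (y - 1) ^ 2) ^ 3 * -y := by
  fin_cases l <;> simp [rootForm, rootWeight, rowProd, quarticInv, Fin.sum_univ_five] <;> ring

end

variable {k K : Type*} [Field k] [Field K] [Algebra k K]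

theorem AlgebraicIndependent.rootMoment_ne_zero {x : Fin 5 → K} (hx : AlgebraicIndependent k x) :
    rootMoment 3 5 0 x ≠ 0 := by
  have h := hx.aeval_ne_zero_of (rootMoment 3 5 0 .X)
    (![.X, 0, 0, 1, 1] : Fin 5 → Polynomial k) (by
      rw [← RingHom.coe_coe, map_rootMoment]
      simp only [RingHom.coe_coe, MvPolynomial.aeval_X]
      erw [rootMoment_three_five_zero_apply]
      exact pow_ne_zero _ (mul_ne_zero (pow_ne_zero _ Polynomial.X_ne_zero)
        (pow_ne_zero _ (Polynomial.X_sub_C_ne_zero 1))))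
  rw [← RingHom.coe_coe, map_rootMoment] at h
  simpa only [RingHom.coe_coe, MvPolynomial.aeval_X] using h

theorem AlgebraicIndependent.rootForm_ne_zero {x : Fin 5 → K} (hx : AlgebraicIndependent k x)
    (l : Fin 5) : rootForm 3 5 (fun i j => x i - x j) l ≠ 0 := by
  rw [rootForm_sub]
  have h := hx.aeval_ne_zero_of (rootMoment 3 5 0 .X * .X l - rootMoment 3 5 1 .X)
    (fun j => (![0, .X, 0, 1, 1] : Fin 5 → Polynomial k) (j - l)) (by
      rw [map_sub, map_mul, ← RingHom.coe_coe, map_rootMoment, map_rootMoment]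
      simp only [RingHom.coe_coe, MvPolynomial.aeval_X]
      rw [← rootForm_sub 3 5 (fun j => (![0, .X, 0, 1, 1] : Fin 5 → Polynomial k) (j - l)) l,
        rootForm_three_five_apply]
      exact mul_ne_zero (pow_ne_zero _ (mul_ne_zero (pow_ne_zero _ Polynomial.X_ne_zero)
        (pow_ne_zero _ (Polynomial.X_sub_C_ne_zero 1))))
        (neg_ne_zero.mpr Polynomial.X_ne_zero))
  rw [map_sub, map_mul, ← RingHom.coe_coe, map_rootMoment, map_rootMoment] at h
  simpa only [RingHom.coe_coe, MvPolynomial.aeval_X] using h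

theorem AlgebraicIndependent.rootMoment_det_ne_zero {x : Fin 5 → K}
    (hx : AlgebraicIndependent k x) :
    rootMoment 3 5 0 x * rootMoment 1 2 1 x - rootMoment 1 2 0 x * rootMoment 3 5 1 x ≠ 0 := by
  have h := hx.aeval_ne_zero_of (rootMoment 3 5 0 .X * rootMoment 1 2 1 .X -
      rootMoment 1 2 0 .X * rootMoment 3 5 1 .X)
    (![1, .X, .X ^ 2, 0, 0] : Fin 5 → Polynomial k) (by
      rw [map_sub, map_mul, map_mul, ← RingHom.coe_coe, map_rootMoment, map_rootMoment,
        map_rootMoment, map_rootMoment]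
      simp only [RingHom.coe_coe, MvPolynomial.aeval_X]
      erw [rootMoment_det_apply]
      refine mul_ne_zero (pow_ne_zero _ Polynomial.X_ne_zero) fun h0 => ?_
      have h2 : (2 : k) = 0 := by simpa using congrArg (Polynomial.coeff · 0) h0
      have h11 : (11 : k) = 0 := by
        have h2' : (2 : Polynomial k) = 0 := by
          rw [← map_ofNat Polynomial.C 2, h2, map_zero]
        rw [h2', zero_sub, pow_two, mul_assoc, mul_comm _ (Polynomial.X : Polynomial k),
          ← mul_neg, ← mul_add, mul_eq_zero_iff_left Polynomial.X_ne_zero] at h0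
        simpa using congrArg (Polynomial.eval 0) h0
      exact one_ne_zero (α := k) (by linear_combination h11 - 5 * h2))
  rw [map_sub, map_mul, map_mul, ← RingHom.coe_coe, map_rootMoment, map_rootMoment,
        map_rootMoment, map_rootMoment] at h
  simpa only [RingHom.coe_coe, MvPolynomial.aeval_X] using h

end quinary

section quinary

open Finset

variable {k K : Type*} [Field k] [Field K] [Algebra k K]

/-- The cross-ratio of the points `x j` with `j ≠ i`. -/
def crossRatio (x : Fin 5 → K) (i : Fin 5) : K :=
  (x (i + 1) - x (i + 4)) * (x (i + 2) - x (i + 3)) /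
    ((x (i + 1) - x (i + 2)) * (x (i + 3) - x (i + 4)))

/-- The normalized differences of five points with the given cross-ratios. -/
def normalizedDiff (u v : K) : Fin 5 → Fin 5 → K :=
  ![![0, -1, -1, -1, -1], ![1, 0, -1, -u, -v], ![1, 1, 0, 1 - u, 1 - v],
    ![1, u, u - 1, 0, u - v], ![1, v, v - 1, v - u, 0]]

theorem normalizedDiff_mem {L : IntermediateField k K} {u v : K} (hu : u ∈ L) (hv : v ∈ L)
    (i j : Fin 5) : normalizedDiff u v i j ∈ L := by
  have h1 := one_mem L
  fin_cases i <;> fin_cases j <;> simp [normalizedDiff] <;>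
    apply_rules [sub_mem, neg_mem, zero_mem]

theorem sub_eq_normalizedDiff {x : Fin 5 → K} (hx : Function.Injective x) (i j : Fin 5) :
    x i - x j = (x 2 - x 1) / ((x 1 - x 0) * (x 2 - x 0)) *
      (![(x 1 - x 0) * (x 2 - x 0) / (x 2 - x 1), x 1 - x 0, x 2 - x 0, x 3 - x 0,
        x 4 - x 0] : Fin 5 → K) i *
      (![(x 1 - x 0) * (x 2 - x 0) / (x 2 - x 1), x 1 - x 0, x 2 - x 0, x 3 - x 0,
        x 4 - x 0] : Fin 5 → K) j *
      normalizedDiff (1 + crossRatio x 0 / (1 + crossRatio x 2))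
        (1 + (1 + crossRatio x 0) / crossRatio x 2) i j := by
  have d : ∀ i j : Fin 5, i ≠ j → x i - x j ≠ 0 := fun i j h => sub_ne_zero.mpr (hx.ne h)
  have h01 := d 1 0 (by decide)
  have h02 := d 2 0 (by decide)
  have h03 := d 3 0 (by decide)
  have h04 := d 4 0 (by decide)
  have h12 := d 2 1 (by decide)
  have h1 : 1 + crossRatio x 2 = (x 3 - x 0) * (x 4 - x 1) / ((x 3 - x 4) * (x 0 - x 1)) := by
    have := d 3 4 (by decide)
    have := d 0 1 (by decide)
    simp [crossRatio]
    field_simp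
    ring
  have hu : 1 + crossRatio x 0 / (1 + crossRatio x 2) =
      (x 3 - x 1) * (x 2 - x 0) / ((x 3 - x 0) * (x 2 - x 1)) := by
    have := d 3 4 (by decide)
    have := d 0 1 (by decide)
    have := d 1 2 (by decide)
    have := d 4 1 (by decide)
    rw [h1]
    simp [crossRatio]
    field_simp
    ring
  have hv : 1 + (1 + crossRatio x 0) / crossRatio x 2 =
      (x 4 - x 1) * (x 2 - x 0) / ((x 4 - x 0) * (x 2 - x 1)) := by
    have := d 3 4 (by decide)
    have := d 0 1 (by decide)
    have := d 1 2 (by decide)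
    have := d 3 1 (by decide)
    simp [crossRatio]
    field_simp
    ring
  rw [hu, hv]
  clear h1 hu hv d
  fin_cases i <;> fin_cases j <;> simp [normalizedDiff] <;> field_simp <;> ring

end quinary

section quinary

open Finset IntermediateField

variable {k K : Type*} [Field k] [Field K] [Algebra k K]

/-- Three rational functions invariant under all permutations of `x` which, together with the
cross-ratios, recover `x`. -/
def rootInvariant (x : Fin 5 → K) : Fin 3 → K :=
  ![(∏ i, rowProd (fun i j => x i - x j) i) * rootMoment 1 2 0 x / rootMoment 3 5 0 x,
    (∏ i, rowProd (fun i j => x i - x j) i) * rootMoment 1 2 1 x / rootMoment 3 5 0 x,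
    rootMoment 3 5 1 x / rootMoment 3 5 0 x]

theorem mem_of_crossRatio_mem {x : Fin 5 → K} (hx : AlgebraicIndependent k x)
    {L : IntermediateField k K} (hs : crossRatio x 0 ∈ L) (hr : crossRatio x 2 ∈ L)
    (hg : ∀ i, rootInvariant x i ∈ L) (l : Fin 5) : x l ∈ L := by
  set D := ∏ i, rowProd (fun i j => x i - x j) i with hD
  have hD0 : D ≠ 0 := by
    have d : ∀ i j : Fin 5, i ≠ j → x i - x j ≠ 0 :=
      fun i j h => sub_ne_zero.mpr (hx.injective.ne h)
    refine prod_ne_zero_iff.mpr fun i _ => ?_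
    refine mul_ne_zero (mul_ne_zero (mul_ne_zero (d _ _ ?_) (d _ _ ?_)) (d _ _ ?_)) (d _ _ ?_) <;>
      revert i <;> decide
  have hN := hx.rootMoment_ne_zero
  have hT := hx.rootForm_ne_zero l
  have hdet := hx.rootMoment_det_ne_zero
  have hu : 1 + crossRatio x 0 / (1 + crossRatio x 2) ∈ L :=
    add_mem (one_mem L) (div_mem hs (add_mem (one_mem L) hr))
  have hv : 1 + (1 + crossRatio x 0) / crossRatio x 2 ∈ L :=
    add_mem (one_mem L) (div_mem (add_mem (one_mem L) hs) hr)
  have hm := normalizedDiff_mem hu hv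
  have hsc := sub_eq_normalizedDiff hx.injective
  set m := normalizedDiff (1 + crossRatio x 0 / (1 + crossRatio x 2))
    (1 + (1 + crossRatio x 0) / crossRatio x 2)
  have e0 := prod_rowProd_scale hsc
  have e1 := rootForm_scale hsc (mul_rootWeight_one_two_scale hsc) l
  have e2 := rootForm_scale hsc (mul_rootWeight_three_five_scale hsc) l
  have hy : D * rootForm 1 2 (fun i j => x i - x j) l /
      rootForm 3 5 (fun i j => x i - x j) l ∈ L := by
    have : D * rootForm 1 2 (fun i j => x i - x j) l /
        rootForm 3 5 (fun i j => x i - x j) l =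
        (∏ i, rowProd m i) * rootForm 1 2 m l / rootForm 3 5 m l := by
      rw [e2] at hT
      have h1 := right_ne_zero_of_mul hT
      have h2 := left_ne_zero_of_mul hT
      rw [hD, e0, e1, e2, div_eq_div_iff hT h1]
      ring
    rw [this]
    have hrow : ∀ i, rowProd m i ∈ L := fun i =>
      mul_mem (mul_mem (mul_mem (hm _ _) (hm _ _)) (hm _ _)) (hm _ _)
    have hw : ∀ p q i, rootWeight p q m i ∈ L := fun p q i => by
      unfold rootWeight quarticInv
      apply_rules [add_mem, mul_mem, pow_mem]
    exact div_mem (mul_mem (prod_mem fun i _ => hrow i)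
      (sum_mem fun i _ => mul_mem (hw _ _ _) (hm _ _)))
      (sum_mem fun i _ => mul_mem (hw _ _ _) (hm _ _))
  have h3 := hg 0
  have h4 := hg 1
  have h5 := hg 2
  simp only [rootInvariant, ← hD] at h3 h4 h5
  simp only [Matrix.cons_val] at h3 h4 h5
  rw [rootForm_sub] at hT hy
  rw [rootForm_sub] at hy
  generalize rootMoment 1 2 0 x = N₀ at *
  generalize rootMoment 1 2 1 x = Q₀ at *
  generalize rootMoment 3 5 0 x = N₁ at *
  generalize rootMoment 3 5 1 x = Q₁ at *
  refine mem_of_mul_mem (c := D * (N₀ * x l - Q₀) / (N₁ * x l - Q₁) - D * N₀ / N₁)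
    (sub_mem hy h3) ?_ ?_
  · rw [div_sub_div _ _ hT hN]
    refine div_ne_zero ?_ (mul_ne_zero hT hN)
    rw [show D * (N₀ * x l - Q₀) * N₁ - (N₁ * x l - Q₁) * (D * N₀) =
      -(D * (N₁ * Q₀ - N₀ * Q₁)) by ring]
    exact neg_ne_zero.mpr (mul_ne_zero hD0 hdet)
  · rw [show (D * (N₀ * x l - Q₀) / (N₁ * x l - Q₁) - D * N₀ / N₁) * x l =
      D * (N₀ * x l - Q₀) / (N₁ * x l - Q₁) * (Q₁ / N₁) - D * Q₀ / N₁ by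
        generalize hT' : N₁ * x l - Q₁ = T at hT ⊢
        obtain rfl : Q₁ = N₁ * x l - T := by rw [← hT']; ring
        field_simp
        ring]
    exact sub_mem (mul_mem hy h5) h4

/-- `f` permutes the roots compatibly with `rowProd` and `quarticInv`. -/
structure IsRootSymmetry (R : Type*) [CommRing R] (f : Fin 5 → Fin 5) : Prop where
  bijective : Function.Bijective f
  rowProd_comp : ∀ (x : Fin 5 → R) (i : Fin 5),
    rowProd (fun i j => x (f i) - x (f j)) i = rowProd (fun i j => x i - x j) (f i)
  quarticInv_comp : ∀ (x : Fin 5 → R) (i : Fin 5),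
    quarticInv (fun i j => x (f i) - x (f j)) i = quarticInv (fun i j => x i - x j) (f i)

theorem IsRootSymmetry.rootMoment_comp {R : Type*} [CommRing R] {f : Fin 5 → Fin 5}
    (hf : IsRootSymmetry R f) (p q e : ℕ) (x : Fin 5 → R) :
    rootMoment p q e (fun i => x (f i)) = rootMoment p q e x := by
  unfold rootMoment rootWeight
  simp only [hf.rowProd_comp, hf.quarticInv_comp]
  exact hf.bijective.sum_comp fun i => rowProd (fun i j => x i - x j) i ^ p *
    quarticInv (fun i j => x i - x j) i ^ q * x i ^ e

theorem IsRootSymmetry.map_rootInvariant {f : Fin 5 → Fin 5} (hf : IsRootSymmetry K f)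
    {x : Fin 5 → K} {φ : K ≃ₐ[k] K} (h : ∀ i, φ (x i) = x (f i)) (i : Fin 3) :
    φ (rootInvariant x i) = rootInvariant x i := by
  have hm : ∀ p q e, φ (rootMoment p q e x) = rootMoment p q e x := fun p q e => by
    have e := map_rootMoment (φ : K →+* K) p q e x
    simpa only [RingHom.coe_coe, h, hf.rootMoment_comp] using e
  have hD : φ (∏ i, rowProd (fun i j => x i - x j) i) = ∏ i, rowProd (fun i j => x i - x j) i := by
    rw [map_prod, ← hf.bijective.prod_comp fun i => rowProd (fun i j => x i - x j) i]
    refine prod_congr rfl fun i _ => ?_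
    rw [← hf.rowProd_comp]
    simp [rowProd, h]
  fin_cases i <;> simp [rootInvariant, -map_prod, hm, hD]

theorem isRootSymmetry_cycle (R : Type*) [CommRing R] : IsRootSymmetry R ![1, 2, 3, 4, 0] := by
  refine ⟨by decide, fun x i => ?_, fun x i => ?_⟩ <;> fin_cases i <;> simp [rowProd, quarticInv]

theorem isRootSymmetry_reflection (R : Type*) [CommRing R] : IsRootSymmetry R ![0, 4, 3, 2, 1] := by
  refine ⟨by decide, fun x i => ?_, fun x i => ?_⟩ <;> fin_cases i <;>
    simp [rowProd, quarticInv] <;> ring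

theorem isRootSymmetry_double (R : Type*) [CommRing R] : IsRootSymmetry R ![0, 2, 4, 1, 3] := by
  refine ⟨by decide, fun x i => ?_, fun x i => ?_⟩ <;> fin_cases i <;>
    simp [rowProd, quarticInv] <;> ring

theorem isRootSymmetry_three_cycle (R : Type*) [CommRing R] :
    IsRootSymmetry R ![1, 2, 0, 3, 4] := by
  refine ⟨by decide, fun x i => ?_, fun x i => ?_⟩ <;> fin_cases i <;>
    simp [rowProd, quarticInv] <;> ring

end quinary

section pentagon

variable {k K : Type*} [Field k] [Field K] [Algebra k K]

/-- The nondegeneracy of a pair of cross-ratios of five distinct points. -/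
structure IsCrossPair (s r : K) : Prop where
  left : s ≠ 0
  right : r ≠ 0
  one_add_left : 1 + s ≠ 0
  one_add_right : 1 + r ≠ 0
  one_add_add : 1 + s + r ≠ 0

/-- The product of the five adjacent cross-ratios. -/
def pentProd (s r : K) : K := (1 + s) * (1 + r) * (1 + s + r) / (s * r)

/-- The cyclic sum of products of consecutive cross-ratios. -/
def pentSum (s r : K) : K :=
  s * r + r * ((1 + r) / s) + (1 + r) / s * ((1 + s + r) / (s * r)) +
    (1 + s + r) / (s * r) * ((1 + s) / r) + (1 + s) / r * s

/-- A dihedral invariant of five points which is integral over the alternating invariants. -/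
def pentTrace (s r : K) : K :=
  (2 - 5 * pentProd s r + pentProd s r ^ 2 - pentSum s r) / pentProd s r

theorem IsCrossPair.pentProd_ne_zero {s r : K} (h : IsCrossPair s r) : pentProd s r ≠ 0 :=
  div_ne_zero (mul_ne_zero (mul_ne_zero h.3 h.4) h.5) (mul_ne_zero h.1 h.2)

theorem IsCrossPair.pentTrace_mul {s r : K} (h : IsCrossPair s r) :
    pentTrace s r * pentProd s r = 2 - 5 * pentProd s r + pentProd s r ^ 2 - pentSum s r :=
  div_mul_cancel₀ _ h.pentProd_ne_zero

theorem isCrossPair_crossRatio {x : Fin 5 → K} (hx : Function.Injective x) :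
    IsCrossPair (crossRatio x 0) (crossRatio x 2) := by
  have d : ∀ i j : Fin 5, i ≠ j → x i - x j ≠ 0 := fun i j h => sub_ne_zero.mpr (hx.ne h)
  have h12 := d 1 2 (by decide)
  have h34 := d 3 4 (by decide)
  have h01 := d 0 1 (by decide)
  have h1 : 1 + crossRatio x 0 = (x 1 - x 3) * (x 2 - x 4) / ((x 1 - x 2) * (x 3 - x 4)) := by
    simp [crossRatio]
    field_simp
    ring
  have h2 : 1 + crossRatio x 2 = (x 3 - x 0) * (x 4 - x 1) / ((x 3 - x 4) * (x 0 - x 1)) := by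
    simp [crossRatio]
    field_simp
    ring
  have h3 : 1 + crossRatio x 0 + crossRatio x 2 = (x 4 - x 1) * (x 1 - x 3) * (x 2 - x 0) /
      ((x 3 - x 4) * (x 0 - x 1) * (x 1 - x 2)) := by
    simp [crossRatio]
    field_simp
    ring
  refine ⟨?_, ?_, h1 ▸ ?_, h2 ▸ ?_, h3 ▸ ?_⟩
  · exact div_ne_zero (mul_ne_zero (d _ _ (by decide)) (d _ _ (by decide)))
      (mul_ne_zero (d _ _ (by decide)) (d _ _ (by decide)))
  · exact div_ne_zero (mul_ne_zero (d _ _ (by decide)) (d _ _ (by decide)))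
      (mul_ne_zero (d _ _ (by decide)) (d _ _ (by decide)))
  · exact div_ne_zero (mul_ne_zero (d _ _ (by decide)) (d _ _ (by decide))) (mul_ne_zero h12 h34)
  · exact div_ne_zero (mul_ne_zero (d _ _ (by decide)) (d _ _ (by decide))) (mul_ne_zero h34 h01)
  · exact div_ne_zero (mul_ne_zero (mul_ne_zero (d _ _ (by decide)) (d _ _ (by decide)))
      (d _ _ (by decide))) (mul_ne_zero (mul_ne_zero h34 h01) h12)

section

variable {s r : K}

theorem IsCrossPair.pentProd_cycle (h : IsCrossPair s r) :
    pentProd ((1 + s + r) / (s * r)) ((1 + s) / r) = pentProd s r := by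
  obtain ⟨hs, hr, hs1, hr1, hsr⟩ := h
  unfold pentProd
  field_simp
  ring

theorem IsCrossPair.pentSum_cycle (h : IsCrossPair s r) :
    pentSum ((1 + s + r) / (s * r)) ((1 + s) / r) = pentSum s r := by
  obtain ⟨hs, hr, hs1, hr1, hsr⟩ := h
  unfold pentSum
  field_simp
  ring

theorem IsCrossPair.pentProd_reflection (h : IsCrossPair s r) :
    pentProd s ((1 + s) / r) = pentProd s r := by
  obtain ⟨hs, hr, hs1, hr1, hsr⟩ := h
  unfold pentProd
  field_simp
  ring

theorem IsCrossPair.pentSum_reflection (h : IsCrossPair s r) :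
    pentSum s ((1 + s) / r) = pentSum s r := by
  obtain ⟨hs, hr, hs1, hr1, hsr⟩ := h
  unfold pentSum
  field_simp
  ring

theorem IsCrossPair.pentProd_double (h : IsCrossPair s r) :
    pentProd (-s / (1 + s)) (-(1 + r) / (1 + s + r)) = -(pentProd s r)⁻¹ := by
  obtain ⟨hs, hr, hs1, hr1, hsr⟩ := h
  unfold pentProd
  field_simp
  ring

theorem IsCrossPair.pentTrace_double (h : IsCrossPair s r) :
    pentTrace (-s / (1 + s)) (-(1 + r) / (1 + s + r)) = -pentTrace s r - 1 := by
  have e := h.pentProd_double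
  have h0 := h.pentProd_ne_zero
  obtain ⟨hs, hr, hs1, hr1, hsr⟩ := h
  unfold pentTrace
  rw [e]
  unfold pentSum
  field_simp
  unfold pentProd
  field_simp
  ring

end

end pentagon

section pentagon

open IntermediateField

variable {k K : Type*} [Field k] [Field K] [Algebra k K] {s r : K}

theorem IsCrossPair.quintic (h : IsCrossPair s r) : s ^ 5 + (3 - pentProd s r) * s ^ 4 +
    (pentSum s r + 5 + (pentProd s r - 3)) * s ^ 3 +
    -((pentProd s r - 3) + (pentProd s r - 3) ^ 2 - 2 * (pentSum s r + 5 + (pentProd s r - 3)) +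
      (2 * (pentProd s r - 3) + 5)) * s ^ 2 +
    (5 + 2 * (pentProd s r - 3) + pentSum s r) * s + -pentProd s r = 0 := by
  obtain ⟨hs, hr, hs1, hr1, hsr⟩ := h
  unfold pentSum pentProd
  field_simp
  ring

theorem IsCrossPair.quadratic (h : IsCrossPair s r) :
    r ^ 2 + ((2 + s) - pentProd s r * s / (1 + s)) * r + (1 + s) = 0 := by
  obtain ⟨hs, hr, hs1, hr1, hsr⟩ := h
  unfold pentProd
  field_simp
  ring

theorem IsCrossPair.rank_le_of_pentProd_mem (h : IsCrossPair s r) {L : IntermediateField k K}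
    {m : ℕ} (ht : pentProd s r ∈ L) (hw : pentTrace s r ∈ L)
    (hL : ∀ M : IntermediateField k K, L ≤ M → s ∈ M → Module.rank M K ≤ m) :
    Module.rank L K ≤ (5 * m : ℕ) := by
  have hq : pentSum s r ∈ L := by
    rw [show pentSum s r = 2 - 5 * pentProd s r + pentProd s r ^ 2 -
      pentTrace s r * pentProd s r by rw [h.pentTrace_mul]; ring]
    exact sub_mem (add_mem (sub_mem (ofNat_mem L 2) (mul_mem (ofNat_mem L 5) ht)) (pow_mem ht 2))
      (mul_mem hw ht)
  have h2 := ofNat_mem L 2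
  have h3 := ofNat_mem L 3
  have h5 := ofNat_mem L 5
  have e := h.quintic
  refine rank_le_of_quintic (-pentProd s r) (5 + 2 * (pentProd s r - 3) + pentSum s r)
    (-((pentProd s r - 3) + (pentProd s r - 3) ^ 2 - 2 * (pentSum s r + 5 + (pentProd s r - 3)) +
      (2 * (pentProd s r - 3) + 5))) (pentSum s r + 5 + (pentProd s r - 3)) (3 - pentProd s r)
      ?_ ?_ ?_ ?_ ?_ e hL <;>
    apply_rules [sub_mem, add_mem, mul_mem, neg_mem, pow_mem]

theorem IsCrossPair.rank_le_of_left_mem (h : IsCrossPair s r) {L : IntermediateField k K}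
    {m : ℕ} (ht : pentProd s r ∈ L) (hs : s ∈ L)
    (hL : ∀ M : IntermediateField k K, L ≤ M → r ∈ M → Module.rank M K ≤ m) :
    Module.rank L K ≤ (2 * m : ℕ) := by
  have h1 := one_mem L
  refine rank_le_of_quadratic (1 + s) ((2 + s) - pentProd s r * s / (1 + s)) (add_mem h1 hs)
    (sub_mem (add_mem (ofNat_mem L 2) hs) (div_mem (mul_mem ht hs) (add_mem h1 hs)))
    h.quadratic hL

end pentagon

section pentagon

open IntermediateField

variable {k K : Type*} [Field k] [Field K] [Algebra k K] {x : Fin 5 → K}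

theorem rank_le_one_of_crossRatio_mem (hx : AlgebraicIndependent k x)
    (hgen : adjoin k (Set.range x) = ⊤) {L : IntermediateField k K}
    (hg : ∀ i, rootInvariant x i ∈ L) (hs : crossRatio x 0 ∈ L) (hr : crossRatio x 2 ∈ L) :
    Module.rank L K ≤ (1 : ℕ) :=
  rank_le_one_of_adjoin_eq_top hgen (mem_of_crossRatio_mem hx hs hr hg)

theorem AlgebraicIndependent.crossRatio (hx : AlgebraicIndependent k x)
    (hgen : adjoin k (Set.range x) = ⊤) : AlgebraicIndependent k ![crossRatio x 0, crossRatio x 2,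
      rootInvariant x 0, rootInvariant x 1, rootInvariant x 2] := by
  refine algebraicIndependent_of_rank_le hx (n := 1) ?_
  have h := fun i => subset_adjoin k _ (Set.mem_range_self (f := ![_root_.crossRatio x 0,
    _root_.crossRatio x 2, rootInvariant x 0, rootInvariant x 1, rootInvariant x 2]) i)
  refine rank_le_one_of_crossRatio_mem hx hgen ?_ (h 0) (h 1)
  intro i
  fin_cases i
  exacts [h 2, h 3, h 4]

theorem map_crossRatio (φ : K ≃ₐ[k] K) (i : Fin 5) :
    φ (crossRatio x i) = crossRatio (fun j => φ (x j)) i := by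
  simp [crossRatio]

theorem map_crossRatio_cycle (hx : Function.Injective x) {φ : K ≃ₐ[k] K}
    (h : ∀ i, φ (x i) = x (![1, 2, 3, 4, 0] i)) :
    φ (crossRatio x 0) = (1 + crossRatio x 0 + crossRatio x 2) / (crossRatio x 0 * crossRatio x 2) ∧
      φ (crossRatio x 2) = (1 + crossRatio x 0) / crossRatio x 2 := by
  have d : ∀ i j : Fin 5, i ≠ j → x i - x j ≠ 0 := fun i j h => sub_ne_zero.mpr (hx.ne h)
  have h01 := d 0 1 (by decide)
  have h04 := d 4 0 (by decide)
  have h12 := d 1 2 (by decide)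
  have h13 := d 3 1 (by decide)
  have h14 := d 1 4 (by decide)
  have h23 := d 2 3 (by decide)
  have h34 := d 3 4 (by decide)
  simp only [map_crossRatio, h]
  constructor <;> simp [crossRatio] <;> field_simp <;> ring

theorem map_crossRatio_reflection (hx : Function.Injective x) {φ : K ≃ₐ[k] K}
    (h : ∀ i, φ (x i) = x (![0, 4, 3, 2, 1] i)) :
    φ (crossRatio x 0) = crossRatio x 0 ∧
      φ (crossRatio x 2) = (1 + crossRatio x 0) / crossRatio x 2 := by
  have d : ∀ i j : Fin 5, i ≠ j → x i - x j ≠ 0 := fun i j h => sub_ne_zero.mpr (hx.ne h)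
  have h01 := d 0 1 (by decide)
  have h04 := d 4 0 (by decide)
  have h04' := d 0 4 (by decide)
  have h12 := d 1 2 (by decide)
  have h12' := d 2 1 (by decide)
  have h13 := d 3 1 (by decide)
  have h14 := d 1 4 (by decide)
  have h23 := d 2 3 (by decide)
  have h34 := d 3 4 (by decide)
  have h34' := d 4 3 (by decide)
  simp only [map_crossRatio, h]
  constructor <;> simp [crossRatio] <;> field_simp <;> ring

theorem map_crossRatio_double (hx : Function.Injective x) {φ : K ≃ₐ[k] K}
    (h : ∀ i, φ (x i) = x (![0, 2, 4, 1, 3] i)) :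
    φ (crossRatio x 0) = -crossRatio x 0 / (1 + crossRatio x 0) ∧
      φ (crossRatio x 2) = -(1 + crossRatio x 2) / (1 + crossRatio x 0 + crossRatio x 2) := by
  obtain ⟨-, -, h1, -, h2⟩ := isCrossPair_crossRatio hx
  have d : ∀ i j : Fin 5, i ≠ j → x i - x j ≠ 0 := fun i j h => sub_ne_zero.mpr (hx.ne h)
  have h01 := d 0 1 (by decide)
  have h02 := d 0 2 (by decide)
  have h12 := d 1 2 (by decide)
  have h13 := d 1 3 (by decide)
  have h24 := d 2 4 (by decide)
  have h34 := d 3 4 (by decide)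
  simp only [map_crossRatio, h]
  rw [eq_div_iff h1, eq_div_iff h2]
  constructor <;> simp [crossRatio] <;> field_simp <;> ring

theorem map_crossRatio_three_cycle (hx : Function.Injective x) {φ : K ≃ₐ[k] K}
    (h : ∀ i, φ (x i) = x (![1, 2, 0, 3, 4] i)) :
    φ (crossRatio x 0) = -((1 + crossRatio x 0) * (1 + crossRatio x 2)) /
      (1 + crossRatio x 0 + crossRatio x 2) ∧ φ (crossRatio x 2) = crossRatio x 0 := by
  obtain ⟨-, -, h1, -, h2⟩ := isCrossPair_crossRatio hx
  have d : ∀ i j : Fin 5, i ≠ j → x i - x j ≠ 0 := fun i j h => sub_ne_zero.mpr (hx.ne h)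
  have h01 := d 0 1 (by decide)
  have h20 := d 2 0 (by decide)
  have h12 := d 1 2 (by decide)
  have h34 := d 3 4 (by decide)
  simp only [map_crossRatio, h]
  rw [eq_div_iff h2]
  constructor <;> simp [crossRatio] <;> field_simp <;> ring

theorem map_pentProd (φ : K ≃ₐ[k] K) (s r : K) : φ (pentProd s r) = pentProd (φ s) (φ r) := by
  simp [pentProd]

theorem map_pentSum (φ : K ≃ₐ[k] K) (s r : K) : φ (pentSum s r) = pentSum (φ s) (φ r) := by
  simp [pentSum]

theorem map_pentTrace (φ : K ≃ₐ[k] K) (s r : K) : φ (pentTrace s r) = pentTrace (φ s) (φ r) := by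
  simp [pentTrace, map_pentProd, map_pentSum, map_ofNat]

theorem map_pent_cycle (hx : Function.Injective x) {φ : K ≃ₐ[k] K}
    (h : ∀ i, φ (x i) = x (![1, 2, 3, 4, 0] i)) :
    φ (pentProd (crossRatio x 0) (crossRatio x 2)) = pentProd (crossRatio x 0) (crossRatio x 2) ∧
    φ (pentTrace (crossRatio x 0) (crossRatio x 2)) =
      pentTrace (crossRatio x 0) (crossRatio x 2) := by
  obtain ⟨e1, e2⟩ := map_crossRatio_cycle hx h
  have hp := isCrossPair_crossRatio hx
  refine ⟨by rw [map_pentProd, e1, e2, hp.pentProd_cycle], ?_⟩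
  rw [map_pentTrace, e1, e2, pentTrace, hp.pentProd_cycle, hp.pentSum_cycle, pentTrace]

theorem hasInvariants_dihedral_five : HasInvariants k K [586, 970] 10 := by
  refine hasInvariants_of_gens 586 970 1 2 3 4 0 0 4 3 2 1 (by decide) (by decide)
    fun x hx hgen => ?_
  have hp := isCrossPair_crossRatio hx.injective
  refine ⟨pentProd (crossRatio x 0) (crossRatio x 2), pentTrace (crossRatio x 0) (crossRatio x 2),
    rootInvariant x 0, rootInvariant x 1, rootInvariant x 2, ?_, ?_,
      fun L h0 h1 h2 h3 h4 => ?_⟩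
  · intro φ h0 h1 h2 h3 h4
    have h : ∀ i, φ (x i) = x (![1, 2, 3, 4, 0] i) := by
      simp [Fin.forall_fin_succ, h0, h1, h2, h3, h4]
    obtain ⟨e1, e2⟩ := map_pent_cycle hx.injective h
    have e := (isRootSymmetry_cycle K).map_rootInvariant h
    exact ⟨e1, e2, e 0, e 1, e 2⟩
  · intro φ h0 h1 h2 h3 h4
    have h : ∀ i, φ (x i) = x (![0, 4, 3, 2, 1] i) := by
      simp [Fin.forall_fin_succ, h0, h1, h2, h3, h4]
    obtain ⟨e1, e2⟩ := map_crossRatio_reflection hx.injective h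
    have e := (isRootSymmetry_reflection K).map_rootInvariant h
    refine ⟨by rw [map_pentProd, e1, e2, hp.pentProd_reflection], ?_, e 0, e 1, e 2⟩
    rw [map_pentTrace, e1, e2, pentTrace, hp.pentProd_reflection, hp.pentSum_reflection, pentTrace]
  · refine hp.rank_le_of_pentProd_mem (m := 2 * 1) h0 h1 fun M hM hs =>
      hp.rank_le_of_left_mem (hM h0) hs fun N hN hr => ?_
    exact rank_le_one_of_crossRatio_mem hx hgen (by
      simp [Fin.forall_fin_succ, hN (hM h2), hN (hM h3), hN (hM h4)]) (hN hs) hr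

theorem hasInvariants_affine_five : HasInvariants k K [586, 2110] 20 := by
  refine hasInvariants_of_gens 586 2110 1 2 3 4 0 0 2 4 1 3 (by decide) (by decide)
    fun x hx hgen => ?_
  have hp := isCrossPair_crossRatio hx.injective
  have ht0 : pentProd (crossRatio x 0) (crossRatio x 2) ≠ 0 := hp.pentProd_ne_zero
  have ht1 : pentProd (crossRatio x 0) (crossRatio x 2) ^ 2 + 1 ≠ 0 := by
    have h := (hx.crossRatio hgen).aeval_ne_zero_of
      (((1 + .X 0) * (1 + .X 1) * (1 + .X 0 + .X 1)) ^ 2 + (.X 0 * .X 1) ^ 2)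
      (![0, 0, 0, 0, 0] : Fin 5 → k) (by simp)
    have h' : ((1 + crossRatio x 0) * (1 + crossRatio x 2) *
        (1 + crossRatio x 0 + crossRatio x 2)) ^ 2 + (crossRatio x 0 * crossRatio x 2) ^ 2 ≠ 0 := by
      simpa only [map_add, map_mul, map_pow, map_one, MvPolynomial.aeval_X, Matrix.cons_val] using h
    rw [pentProd, div_pow, div_add_one (pow_ne_zero _ (mul_ne_zero hp.1 hp.2))]
    exact div_ne_zero h' (pow_ne_zero _ (mul_ne_zero hp.1 hp.2))
  set t := pentProd (crossRatio x 0) (crossRatio x 2) with ht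
  set w := pentTrace (crossRatio x 0) (crossRatio x 2) with hw
  refine ⟨t - t⁻¹, w * t + (w + 1) * t⁻¹,
    rootInvariant x 0, rootInvariant x 1, rootInvariant x 2, ?_, ?_,
      fun L h0 h1 h2 h3 h4 => ?_⟩
  · intro φ h0 h1 h2 h3 h4
    have h : ∀ i, φ (x i) = x (![1, 2, 3, 4, 0] i) := by
      simp [Fin.forall_fin_succ, h0, h1, h2, h3, h4]
    obtain ⟨e1, e2⟩ := map_pent_cycle hx.injective h
    have e := (isRootSymmetry_cycle K).map_rootInvariant h
    refine ⟨?_, ?_, e 0, e 1, e 2⟩ <;> simp [ht, hw, e1, e2]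
  · intro φ h0 h1 h2 h3 h4
    have h : ∀ i, φ (x i) = x (![0, 2, 4, 1, 3] i) := by
      simp [Fin.forall_fin_succ, h0, h1, h2, h3, h4]
    obtain ⟨e1, e2⟩ := map_crossRatio_double hx.injective h
    have e := (isRootSymmetry_double K).map_rootInvariant h
    have et : φ t = -t⁻¹ := by rw [ht, map_pentProd, e1, e2, hp.pentProd_double]
    have ew : φ w = -w - 1 := by rw [hw, map_pentTrace, e1, e2, hp.pentTrace_double]
    refine ⟨?_, ?_, e 0, e 1, e 2⟩ <;> simp only [map_sub, map_add, map_mul, map_inv₀, map_one, et,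
      ew, inv_neg, inv_inv] <;> ring
  · refine rank_le_of_quadratic (z := t) (m := 5 * (2 * 1)) (-1) (-(t - t⁻¹))
      (neg_mem (one_mem L)) (neg_mem h0) (by field_simp; ring) fun E hE htE => ?_
    have hwE : w ∈ E := mem_of_mul_mem (add_mem (pow_mem htE 2) (one_mem E)) ht1 (by
      rw [show (t ^ 2 + 1) * w = (w * t + (w + 1) * t⁻¹) * t - 1 by field_simp; ring]
      exact sub_mem (mul_mem (hE h1) htE) (one_mem E))
    refine hp.rank_le_of_pentProd_mem (m := 2 * 1) htE hwE fun M hM hs =>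
      hp.rank_le_of_left_mem (hM htE) hs fun N hN hr => ?_
    exact rank_le_one_of_crossRatio_mem hx hgen (by
      simp [Fin.forall_fin_succ, hN (hM (hE h2)), hN (hM (hE h3)), hN (hM (hE h4))]) (hN hs) hr

end pentagon

section pentagon

open IntermediateField

variable {k K : Type*} [Field k] [Field K] [Algebra k K]

/-- The third elementary symmetric polynomial in six elements. -/
def elemThree (a b c d e f : K) : K :=
  a * b * c + a * b * d + a * b * e + a * b * f + a * c * d + a * c * e + a * c * f + a * d * e +
    a * d * f + a * e * f + b * c * d + b * c * e + b * c * f + b * d * e + b * d * f + b * e * f +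
    c * d * e + c * d * f + c * e * f + d * e * f

/-- The third elementary symmetric polynomial in the inverses of the six conjugates
of `pentProd s r` under even permutations. -/
def pentElemThree (s r : K) : K :=
  elemThree (s * r / ((1 + s) * (1 + r) * (1 + s + r)))
    ((1 + s) * (1 + s + r) / (s * r * (1 + r))) (s * (1 + s) * (1 + r) / (r * (1 + s + r)))
    ((1 + r) * (1 + s + r) / (s * r * (1 + s))) (s * r * (1 + s + r) / ((1 + s) * (1 + r)))
    (r * (1 + s) * (1 + r) / (s * (1 + s + r)))

theorem map_pentElemThree (φ : K ≃ₐ[k] K) (s r : K) :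
    φ (pentElemThree s r) = pentElemThree (φ s) (φ r) := by
  simp [pentElemThree, elemThree]

variable {s r : K}

theorem IsCrossPair.pentElemThree_cycle (h : IsCrossPair s r) :
    pentElemThree ((1 + s + r) / (s * r)) ((1 + s) / r) = pentElemThree s r := by
  obtain ⟨hs, hr, hs1, hr1, hsr⟩ := h
  have e1 : 1 + (1 + s + r) / (s * r) = (1 + s) * (1 + r) / (s * r) := by field_simp; ring
  have e2 : 1 + (1 + s) / r = (1 + s + r) / r := by field_simp; ring
  have e3 : (1 + s) * (1 + r) / (s * r) + (1 + s) / r = (1 + s) * (1 + s + r) / (s * r) := by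
    field_simp; ring
  unfold pentElemThree
  rw [e1, e2, e3]
  generalize 1 + s + r = c at *
  generalize 1 + s = a at *
  generalize 1 + r = b at *
  unfold elemThree
  field_simp
  ring

theorem IsCrossPair.pentElemThree_three_cycle (h : IsCrossPair s r) :
    pentElemThree (-((1 + s) * (1 + r)) / (1 + s + r)) s = pentElemThree s r := by
  obtain ⟨hs, hr, hs1, hr1, hsr⟩ := h
  have e1 : 1 + -((1 + s) * (1 + r)) / (1 + s + r) = -(s * r) / (1 + s + r) := by field_simp; ring
  have e3 : -(s * r) / (1 + s + r) + s = s * (1 + s) / (1 + s + r) := by field_simp; ring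
  unfold pentElemThree
  rw [e1, e3]
  generalize 1 + s + r = c at *
  generalize 1 + s = a at *
  generalize 1 + r = b at *
  unfold elemThree
  field_simp
  ring

theorem IsCrossPair.pentTrace_three_cycle (h : IsCrossPair s r) :
    pentTrace (-((1 + s) * (1 + r)) / (1 + s + r)) s = pentTrace s r := by
  obtain ⟨hs, hr, hs1, hr1, hsr⟩ := h
  have e1 : 1 + -((1 + s) * (1 + r)) / (1 + s + r) = -(s * r) / (1 + s + r) := by field_simp; ring
  have e3 : -(s * r) / (1 + s + r) + s = s * (1 + s) / (1 + s + r) := by field_simp; ring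
  unfold pentTrace pentSum pentProd
  rw [e1, e3]
  field_simp
  ring

theorem IsCrossPair.sextic (h : IsCrossPair s r) :
    pentProd s r ^ 6 + -(2 * pentTrace s r + 4) * pentProd s r ^ 5 +
      ((pentTrace s r + 1) ^ 2 + 1) * pentProd s r ^ 4 + -pentElemThree s r * pentProd s r ^ 3 +
      (pentTrace s r ^ 2 + 1) * pentProd s r ^ 2 + -(2 * pentTrace s r - 2) * pentProd s r + 1
      = 0 := by
  obtain ⟨hs, hr, hs1, hr1, hsr⟩ := h
  unfold pentTrace pentSum pentProd pentElemThree elemThree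
  field_simp
  ring

end pentagon

section pentagon

open IntermediateField

variable {k K : Type*} [Field k] [Field K] [Algebra k K]

theorem hasInvariants_alternating_five : HasInvariants k K [586, 2886] 60 := by
  refine hasInvariants_of_gens 586 2886 1 2 3 4 0 1 2 0 3 4 (by decide) (by decide)
    fun x hx hgen => ?_
  have hp := isCrossPair_crossRatio hx.injective
  have hsix := hp.sextic
  refine ⟨pentTrace (crossRatio x 0) (crossRatio x 2),
    pentElemThree (crossRatio x 0) (crossRatio x 2),
    rootInvariant x 0, rootInvariant x 1, rootInvariant x 2, ?_, ?_,
      fun L h0 h1 h2 h3 h4 => ?_⟩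
  · intro φ h0 h1 h2 h3 h4
    have h : ∀ i, φ (x i) = x (![1, 2, 3, 4, 0] i) := by
      simp [Fin.forall_fin_succ, h0, h1, h2, h3, h4]
    have e := (isRootSymmetry_cycle K).map_rootInvariant h
    refine ⟨(map_pent_cycle hx.injective h).2, ?_, e 0, e 1, e 2⟩
    obtain ⟨e1, e2⟩ := map_crossRatio_cycle hx.injective h
    rw [map_pentElemThree, e1, e2, hp.pentElemThree_cycle]
  · intro φ h0 h1 h2 h3 h4
    have h : ∀ i, φ (x i) = x (![1, 2, 0, 3, 4] i) := by
      simp [Fin.forall_fin_succ, h0, h1, h2, h3, h4]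
    obtain ⟨e1, e2⟩ := map_crossRatio_three_cycle hx.injective h
    have e := (isRootSymmetry_three_cycle K).map_rootInvariant h
    refine ⟨?_, ?_, e 0, e 1, e 2⟩
    · rw [map_pentTrace, e1, e2, hp.pentTrace_three_cycle]
    · rw [map_pentElemThree, e1, e2, hp.pentElemThree_three_cycle]
  · have o1 := one_mem L
    have o2 := ofNat_mem L 2
    have o4 := ofNat_mem L 4
    refine rank_le_of_sextic (m := 5 * (2 * 1)) _ _ _ _ _ _ o1 ?_ ?_ ?_ ?_ ?_ hsix
      fun E hE htE => ?_
    any_goals apply_rules [sub_mem, add_mem, mul_mem, neg_mem, pow_mem]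
    refine hp.rank_le_of_pentProd_mem (m := 2 * 1) htE (hE h0) fun M hM hs =>
      hp.rank_le_of_left_mem (hM htE) hs fun N hN hr => ?_
    exact rank_le_one_of_crossRatio_mem hx hgen (by
      simp [Fin.forall_fin_succ, hN (hM (hE h2)), hN (hM (hE h3)), hN (hM (hE h4))]) (hN hs) hr

end pentagon

section pentagon

open IntermediateField

/-- The cubic form which is the denominator of `pentProd`. -/
def cubicDen {R : Type*} [CommRing R] (a b c : R) : R :=
  c ^ 3 + b * c ^ 2 + b ^ 2 * c + 3 * a * c ^ 2 + a * b * c + 3 * a ^ 2 * c + a ^ 3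

section

variable {K : Type*} [Field K]

/-- The cyclic sum of the products of the square of a cross-ratio and the next one. -/
def pentMoment (s r : K) : K :=
  s ^ 2 * r + r ^ 2 * ((1 + r) / s) + ((1 + r) / s) ^ 2 * ((1 + s + r) / (s * r)) +
    ((1 + s + r) / (s * r)) ^ 2 * ((1 + s) / r) + ((1 + s) / r) ^ 2 * s

/-- The product of `pentTrace` and `pentProd`. -/
def pentAux (t q : K) : K := 2 - 5 * t + t ^ 2 - q

/-- The first coordinate of a parametrization of the cyclic invariants. -/
def pentNumLeft (t w : K) : K := t * w - 18 * w + 34 * t + 13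

/-- The second coordinate of a parametrization of the cyclic invariants. -/
def pentNumRight (t w m : K) : K := m - 3 * w + t ^ 2 + 2 * t + 3

/-- The third coordinate of a parametrization of the cyclic invariants. -/
def pentDen (t w : K) : K := 25 * w - t ^ 3 + 4 * t ^ 2 - 47 * t - 18

/-- The cubic form which is the numerator of `pentProd`. -/
def cubicNum (a b c : K) : K :=
  17 * c ^ 3 + 18 * b * c ^ 2 + 18 * b ^ 2 * c + 69 * a * c ^ 2 + 43 * a * b * c +
    25 * a * b ^ 2 + 94 * a ^ 2 * c + 25 * a ^ 2 * b + 43 * a ^ 3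

variable {s r : K}

theorem IsCrossPair.pentMoment_sq (h : IsCrossPair s r) :
    let t := pentProd s r
    let w := pentAux t (pentSum s r)
    let m := pentMoment s r
    m ^ 2 + m * (1 - 9 * t + 6 * t ^ 2 - t ^ 3 + w + t * w) = w ^ 3 + w ^ 2 * (-3 + t - 3 * t ^ 2) +
      w * (2 + 6 * t - 3 * t ^ 2 - 10 * t ^ 3 + 3 * t ^ 4) +
      (-1 + 2 * t - 26 * t ^ 2 + 25 * t ^ 3 - 21 * t ^ 4 + 8 * t ^ 5 - t ^ 6) := by
  obtain ⟨hs, hr, hs1, hr1, hsr⟩ := h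
  unfold pentMoment pentAux pentSum pentProd
  field_simp
  ring

theorem mul_cubicDen {t w m : K} (h : m ^ 2 + m * (1 - 9 * t + 6 * t ^ 2 - t ^ 3 + w + t * w) =
      w ^ 3 + w ^ 2 * (-3 + t - 3 * t ^ 2) +
      w * (2 + 6 * t - 3 * t ^ 2 - 10 * t ^ 3 + 3 * t ^ 4) +
      (-1 + 2 * t - 26 * t ^ 2 + 25 * t ^ 3 - 21 * t ^ 4 + 8 * t ^ 5 - t ^ 6)) :
    t * cubicDen (pentNumLeft t w) (pentNumRight t w m) (pentDen t w) =
      cubicNum (pentNumLeft t w) (pentNumRight t w m) (pentDen t w) := by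
  unfold cubicDen cubicNum pentNumLeft pentNumRight pentDen
  linear_combination (-t ^ 4 + 22 * t ^ 3 - 119 * t ^ 2 - 22 * t - 1) * h

theorem IsCrossPair.pentMoment_cycle (h : IsCrossPair s r) :
    pentMoment ((1 + s + r) / (s * r)) ((1 + s) / r) = pentMoment s r := by
  obtain ⟨hs, hr, hs1, hr1, hsr⟩ := h
  unfold pentMoment
  field_simp
  ring

end

end pentagon

section pentagon

open IntermediateField

section numerators

variable {R S : Type*} [CommRing R] [CommRing S]

/-- The numerator of `pentProd`. -/
def pentProdNum (s r : R) : R := (1 + s) * (1 + r) * (1 + s + r)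

/-- The numerator of `pentAux`. -/
def pentAuxNum (s r : R) : R :=
  2 * (s * r) ^ 2 - 5 * pentProdNum s r * (s * r) + pentProdNum s r ^ 2 -
    ((s * r) ^ 3 + r ^ 3 * s * (1 + r) + r * (1 + r) * (1 + s + r) + s * (1 + s) * (1 + s + r) +
      s ^ 3 * r * (1 + s))

/-- The numerator of `pentMoment`. -/
def pentMomentNum (s r : R) : R :=
  s ^ 5 * r ^ 4 + r ^ 5 * s ^ 2 * (1 + r) + r ^ 2 * (1 + r) ^ 2 * (1 + s + r) +
    s * (1 + s) * (1 + s + r) ^ 2 + s ^ 4 * r * (1 + s) ^ 2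

/-- The numerator of `pentNumLeft`. -/
def leftNum (s r : R) : R :=
  pentProdNum s r * pentAuxNum s r - 18 * pentAuxNum s r * (s * r) +
    34 * pentProdNum s r * (s * r) ^ 2 + 13 * (s * r) ^ 3

/-- The numerator of `pentNumRight`. -/
def rightNum (s r : R) : R :=
  pentMomentNum s r - 3 * pentAuxNum s r * (s * r) + pentProdNum s r ^ 2 * (s * r) +
    2 * pentProdNum s r * (s * r) ^ 2 + 3 * (s * r) ^ 3

/-- The numerator of `pentDen`. -/
def denNum (s r : R) : R :=
  25 * pentAuxNum s r * (s * r) - pentProdNum s r ^ 3 + 4 * pentProdNum s r ^ 2 * (s * r) -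
    47 * pentProdNum s r * (s * r) ^ 2 - 18 * (s * r) ^ 3

theorem map_pentProdNum (f : R →+* S) (s r : R) :
    f (pentProdNum s r) = pentProdNum (f s) (f r) := by
  simp [pentProdNum]

theorem map_pentAuxNum (f : R →+* S) (s r : R) :
    f (pentAuxNum s r) = pentAuxNum (f s) (f r) := by
  simp [pentAuxNum, map_pentProdNum, map_ofNat]

theorem map_leftNum (f : R →+* S) (s r : R) : f (leftNum s r) = leftNum (f s) (f r) := by
  simp [leftNum, map_pentProdNum, map_pentAuxNum, map_ofNat]

theorem map_rightNum (f : R →+* S) (s r : R) : f (rightNum s r) = rightNum (f s) (f r) := by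
  simp [rightNum, pentMomentNum, map_pentProdNum, map_pentAuxNum, map_ofNat]

theorem map_denNum (f : R →+* S) (s r : R) : f (denNum s r) = denNum (f s) (f r) := by
  simp [denNum, map_pentProdNum, map_pentAuxNum, map_ofNat]

/-- The numerator of the slope of `pentMoment` as a linear function of `r`. -/
def slopeNum (s r : R) : R :=
  s ^ 5 * r ^ 2 + s ^ 2 * (r * (r ^ 2 + 1 + s) + (r ^ 2 + 1 + s) ^ 2 - (1 + s) * r ^ 2) +
    (r ^ 2 * (2 + s) + r * (r ^ 2 + 1 + s)) -
    s * (-(r ^ 2 * s) + 2 * r * (r ^ 2 + 1 + s) + (r ^ 2 + 1 + s) ^ 2) -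
    s ^ 4 * r * (r ^ 2 + 1 + s)

theorem map_cubicDen (f : R →+* S) (a b c : R) :
    f (cubicDen a b c) = cubicDen (f a) (f b) (f c) := by
  simp [cubicDen, map_ofNat]

theorem map_slopeNum (f : R →+* S) (s r : R) : f (slopeNum s r) = slopeNum (f s) (f r) := by
  simp [slopeNum, map_ofNat]

end numerators

section

variable {K : Type*} [Field K] {s r : K}

theorem IsCrossPair.pentAux_eq (h : IsCrossPair s r) :
    pentAux (pentProd s r) (pentSum s r) = pentAuxNum s r / (s * r) ^ 2 := by
  obtain ⟨hs, hr, hs1, hr1, hsr⟩ := h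
  unfold pentAux pentAuxNum pentProdNum pentProd pentSum
  field_simp

theorem pentProd_eq (s r : K) :
    pentProd s r = pentProdNum s r / (s * r) := rfl

theorem IsCrossPair.pentMoment_eq (h : IsCrossPair s r) :
    pentMoment s r = pentMomentNum s r / (s * r) ^ 3 := by
  obtain ⟨hs, hr, hs1, hr1, hsr⟩ := h
  unfold pentMoment pentMomentNum
  field_simp

theorem IsCrossPair.pentNumLeft_eq (h : IsCrossPair s r) :
    pentNumLeft (pentProd s r) (pentAux (pentProd s r) (pentSum s r)) =
      leftNum s r / (s * r) ^ 3 := by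
  rw [h.pentAux_eq, pentProd_eq]
  obtain ⟨hs, hr, hs1, hr1, hsr⟩ := h
  unfold pentNumLeft leftNum
  field_simp

theorem IsCrossPair.pentNumRight_eq (h : IsCrossPair s r) :
    pentNumRight (pentProd s r) (pentAux (pentProd s r) (pentSum s r)) (pentMoment s r) =
      rightNum s r / (s * r) ^ 3 := by
  rw [h.pentAux_eq, pentProd_eq, h.pentMoment_eq]
  obtain ⟨hs, hr, hs1, hr1, hsr⟩ := h
  unfold pentNumRight rightNum
  field_simp

theorem IsCrossPair.pentDen_eq (h : IsCrossPair s r) :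
    pentDen (pentProd s r) (pentAux (pentProd s r) (pentSum s r)) =
      denNum s r / (s * r) ^ 3 := by
  rw [h.pentAux_eq, pentProd_eq]
  obtain ⟨hs, hr, hs1, hr1, hsr⟩ := h
  unfold pentDen denNum
  field_simp

/-- With `e = 1 + s` and `g = r + e / r`, the cross-ratio `r` is determined by `pentMoment s r`. -/
theorem IsCrossPair.slope_mul (h : IsCrossPair s r) :
    let e := 1 + s
    let g := r + e / r
    slopeNum s r / (s ^ 3 * r ^ 2) * r = pentMoment s r -
      ((-e - g * e) / s + (1 + g + e) / s ^ 3 +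
        (g + 2 * (g ^ 2 - e) + g ^ 3 - 2 * g * e) / s ^ 2 + (g ^ 2 - e) * s) ∧
    slopeNum s r / (s ^ 3 * r ^ 2) = s ^ 2 + (g + g ^ 2 - e) / s + (1 + g + e) / s ^ 3 -
      (1 + 2 * g + g ^ 2 - e) / s ^ 2 - g * s ∧
    g = pentProd s r * s / (1 + s) - (2 + s) := by
  obtain ⟨hs, hr, hs1, hr1, hsr⟩ := h
  intro e g
  simp only [e, g]
  unfold slopeNum pentMoment pentProd
  refine ⟨?_, ?_, ?_⟩
  · field_simp
    ring
  · field_simp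
    ring
  · field_simp
    ring

end

end pentagon

section pentagon

open IntermediateField

variable {k K : Type*} [Field k] [Field K] [Algebra k K]

section membership

variable {L : IntermediateField k K} {a b c : K}

theorem coe_ofNat (n : ℕ) [n.AtLeastTwo] : ((ofNat(n) : L) : K) = ofNat(n) :=
  map_ofNat L.val n

theorem cubicDen_mem (ha : a ∈ L) (hb : b ∈ L) : cubicDen a b 1 ∈ L := by
  lift a to L using ha
  lift b to L using hb
  convert (cubicDen a b 1).2
  simp [cubicDen, coe_ofNat]

theorem cubicNum_mem (ha : a ∈ L) (hb : b ∈ L) : cubicNum a b 1 ∈ L := by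
  lift a to L using ha
  lift b to L using hb
  convert (cubicNum a b 1).2
  simp [cubicNum, coe_ofNat]

theorem pentDen_mem (ha : a ∈ L) (hb : b ∈ L) : pentDen a b ∈ L := by
  lift a to L using ha
  lift b to L using hb
  convert (pentDen a b).2
  simp [pentDen, coe_ofNat]

theorem mem_of_pentNumRight_mem (ha : a ∈ L) (hb : b ∈ L) (h : pentNumRight a b c ∈ L) :
    c ∈ L := by
  have e : c = pentNumRight a b c - (a ^ 2 + 2 * a + 3 - 3 * b) := by
    rw [pentNumRight]
    ring
  have h2 := ofNat_mem L 2
  have h3 := ofNat_mem L 3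
  rw [e]
  exact sub_mem h (sub_mem (add_mem (add_mem (pow_mem ha 2) (mul_mem h2 ha)) h3) (mul_mem h3 hb))

theorem mem_of_pentNumLeft_div_mem (ha : a ∈ L) (hd : pentDen a b ≠ 0)
    (h0 : a - 18 - 25 * (pentNumLeft a b / pentDen a b) ≠ 0)
    (h : pentNumLeft a b / pentDen a b ∈ L) : b ∈ L := by
  have e := div_mul_cancel₀ (pentNumLeft a b) hd
  generalize pentNumLeft a b / pentDen a b = z at *
  refine mem_of_mul_mem (c := a - 18 - 25 * z) (z := b) ?_ h0 ?_
  · exact sub_mem (sub_mem ha (ofNat_mem L 18)) (mul_mem (ofNat_mem L 25) h)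
  · rw [show (a - 18 - 25 * z) * b = -z * (a ^ 3 - 4 * a ^ 2 + 47 * a + 18) - 34 * a - 13 by
      rw [pentNumLeft, pentDen] at e
      linear_combination -e]
    lift a to L using ha
    lift z to L using h
    convert (-z * (a ^ 3 - 4 * a ^ 2 + 47 * a + 18) - 34 * a - 13).2
    simp [coe_ofNat]

theorem slope_mem (ha : a ∈ L) (hb : b ∈ L) :
    a ^ 2 + (b + b ^ 2 - (1 + a)) / a + (1 + b + (1 + a)) / a ^ 3 -
      (1 + 2 * b + b ^ 2 - (1 + a)) / a ^ 2 - b * a ∈ L := by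
  lift a to L using ha
  lift b to L using hb
  convert (a ^ 2 + (b + b ^ 2 - (1 + a)) / a + (1 + b + (1 + a)) / a ^ 3 -
      (1 + 2 * b + b ^ 2 - (1 + a)) / a ^ 2 - b * a).2
  simp [coe_ofNat]

theorem slope_mul_mem (ha : a ∈ L) (hb : b ∈ L) (hc : c ∈ L) :
    c - ((-(1 + a) - b * (1 + a)) / a + (1 + b + (1 + a)) / a ^ 3 +
      (b + 2 * (b ^ 2 - (1 + a)) + b ^ 3 - 2 * b * (1 + a)) / a ^ 2 +
        (b ^ 2 - (1 + a)) * a) ∈ L := by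
  lift a to L using ha
  lift b to L using hb
  lift c to L using hc
  convert (c - ((-(1 + a) - b * (1 + a)) / a + (1 + b + (1 + a)) / a ^ 3 +
      (b + 2 * (b ^ 2 - (1 + a)) + b ^ 3 - 2 * b * (1 + a)) / a ^ 2 +
        (b ^ 2 - (1 + a)) * a)).2
  simp [coe_ofNat]

end membership

theorem cubicDen_div {K : Type*} [Field K] {a b c d : K} (hd : d ≠ 0) (hc : c ≠ 0) :
    cubicDen (a / d / (c / d)) (b / d / (c / d)) 1 = cubicDen a b c / c ^ 3 := by
  unfold cubicDen
  field_simp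

theorem cubicDen_div_mul {K : Type*} [Field K] {a b c t : K} (hc : c ≠ 0)
    (h : t * cubicDen a b c = cubicNum a b c) :
    cubicDen (a / c) (b / c) 1 * t = cubicNum (a / c) (b / c) 1 := by
  rw [show cubicDen (a / c) (b / c) 1 = cubicDen a b c / c ^ 3 by
      unfold cubicDen
      field_simp,
    show cubicNum (a / c) (b / c) 1 = cubicNum a b c / c ^ 3 by
      unfold cubicNum
      field_simp, ← h]
  ring

theorem AlgebraicIndependent.denNum_ne_zero {z : Fin 5 → K} (hz : AlgebraicIndependent k z) :
    denNum (z 0) (z 1) ≠ 0 := by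
  have h := hz.aeval_ne_zero_of (denNum (.X 0) (.X 1)) (![0, 0, 0, 0, 0] : Fin 5 → k) (by
    rw [← RingHom.coe_coe, map_denNum]
    simp [denNum, pentProdNum])
  rw [← RingHom.coe_coe, map_denNum] at h
  simpa only [RingHom.coe_coe, MvPolynomial.aeval_X] using h

theorem AlgebraicIndependent.slopeNum_ne_zero {z : Fin 5 → K} (hz : AlgebraicIndependent k z) :
    slopeNum (z 0) (z 1) ≠ 0 := by
  have h := hz.aeval_ne_zero_of (slopeNum (.X 0) (.X 1))
    (![0, .X, 0, 0, 0] : Fin 5 → Polynomial k) (by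
    rw [← RingHom.coe_coe, map_slopeNum]
    simp only [RingHom.coe_coe, MvPolynomial.aeval_X, Matrix.cons_val]
    rw [show slopeNum (0 : Polynomial k) .X = .X * (.X + .C 1) ^ 2 by
      simp only [slopeNum, map_one]
      ring]
    exact mul_ne_zero Polynomial.X_ne_zero (pow_ne_zero _ (Polynomial.X_add_C_ne_zero 1)))
  rw [← RingHom.coe_coe, map_slopeNum] at h
  simpa only [RingHom.coe_coe, MvPolynomial.aeval_X] using h

theorem AlgebraicIndependent.cubicDen_ne_zero {z : Fin 5 → K} (hz : AlgebraicIndependent k z) :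
    cubicDen (leftNum (z 0) (z 1)) (rightNum (z 0) (z 1)) (denNum (z 0) (z 1)) ≠ 0 := by
  have h := hz.aeval_ne_zero_of (cubicDen (leftNum (.X 0) (.X 1)) (rightNum (.X 0) (.X 1))
    (denNum (.X 0) (.X 1))) (![-1, -1, 0, 0, 0] : Fin 5 → k) (by
    rw [← RingHom.coe_coe, map_cubicDen, map_leftNum, map_rightNum, map_denNum]
    simp only [RingHom.coe_coe, MvPolynomial.aeval_X, Matrix.cons_val]
    norm_num [cubicDen, leftNum, rightNum, denNum, pentMomentNum, pentAuxNum, pentProdNum])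
  rw [← RingHom.coe_coe, map_cubicDen, map_leftNum, map_rightNum, map_denNum] at h
  simpa only [RingHom.coe_coe, MvPolynomial.aeval_X] using h

theorem AlgebraicIndependent.pentProdNum_mul_sub_ne_zero {z : Fin 5 → K}
    (hz : AlgebraicIndependent k z) :
    (pentProdNum (z 0) (z 1) - 18 * (z 0 * z 1)) * denNum (z 0) (z 1) -
      25 * leftNum (z 0) (z 1) * (z 0 * z 1) ≠ 0 := by
  have h := hz.aeval_ne_zero_of ((pentProdNum (.X 0) (.X 1) - 18 * (.X 0 * .X 1)) *
    denNum (.X 0) (.X 1) - 25 * leftNum (.X 0) (.X 1) * (.X 0 * .X 1))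
    (![0, 0, 0, 0, 0] : Fin 5 → k) (by
    rw [← RingHom.coe_coe]
    simp only [map_sub, map_mul, map_denNum, map_leftNum, map_pentProdNum]
    simp [denNum, pentProdNum])
  rw [← RingHom.coe_coe] at h
  simpa only [map_sub, map_mul, map_denNum, map_leftNum, map_pentProdNum, RingHom.coe_coe,
    MvPolynomial.aeval_X, map_ofNat] using h

theorem hasInvariants_cyclic_five : HasInvariants k K [586] 5 := by
  refine hasInvariants_of_gen 586 1 2 3 4 0 (by decide) fun x hx hgen => ?_
  have hp := isCrossPair_crossRatio hx.injective
  have hz := hx.crossRatio hgen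
  have hden := hz.denNum_ne_zero
  have hslope := hz.slopeNum_ne_zero
  have hcub := hz.cubicDen_ne_zero
  have hlin := hz.pentProdNum_mul_sub_ne_zero
  simp only [Matrix.cons_val] at hden hslope hcub hlin
  have eA := hp.pentNumLeft_eq
  have eB := hp.pentNumRight_eq
  have eC := hp.pentDen_eq
  have hrel := mul_cubicDen hp.pentMoment_sq
  obtain ⟨hs1, hs2, hs3⟩ := hp.slope_mul
  have htr := hp.pentTrace_mul
  have hcy := hp.pentMoment_cycle
  have hsr := mul_ne_zero hp.1 hp.2
  have ht0 := hp.pentProd_ne_zero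
  have hpt := pentProd_eq (crossRatio x 0) (crossRatio x 2)
  have hact := @map_crossRatio_cycle k K _ _ _ x hx.injective
  have hpc := @map_pent_cycle k K _ _ _ x hx.injective
  have hone := @rank_le_one_of_crossRatio_mem k K _ _ _ x hx hgen
  generalize crossRatio x 0 = s at *
  generalize crossRatio x 2 = r at *
  have hq : pentAux (pentProd s r) (pentSum s r) = pentTrace s r * pentProd s r := htr.symm
  rw [hq] at eA eB eC hrel
  have hmul : ∀ φ : K ≃ₐ[k] K, φ (pentMoment s r) = pentMoment (φ s) (φ r) := fun φ => by
    simp [pentMoment]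
  generalize pentMoment s r = m at *
  have hC0 : pentDen (pentProd s r) (pentTrace s r * pentProd s r) ≠ 0 := by
    rw [eC]
    exact div_ne_zero hden (pow_ne_zero _ hsr)
  set t := pentProd s r with ht
  set w := pentTrace s r with hw
  refine ⟨pentNumLeft t (w * t) / pentDen t (w * t), pentNumRight t (w * t) m / pentDen t (w * t),
    rootInvariant x 0, rootInvariant x 1, rootInvariant x 2, ?_, fun L h0 h1 h2 h3 h4 => ?_⟩
  · intro φ h0 h1 h2 h3 h4
    have h : ∀ i, φ (x i) = x (![1, 2, 3, 4, 0] i) := by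
      simp [Fin.forall_fin_succ, h0, h1, h2, h3, h4]
    have e := (isRootSymmetry_cycle K).map_rootInvariant h
    obtain ⟨e1, e2⟩ := hpc h
    obtain ⟨e3, e4⟩ := hact h
    have e5 : φ m = m := by rw [hmul, e3, e4, hcy]
    refine ⟨?_, ?_, e 0, e 1, e 2⟩ <;>
      simp [pentNumLeft, pentNumRight, pentDen, map_ofNat, e1, e2, e5]
  · have hs0 := hp.1
    have hr0 := hp.2
    have htL : t ∈ L := by
      have hc0 : cubicDen (pentNumLeft t (w * t) / pentDen t (w * t))
          (pentNumRight t (w * t) m / pentDen t (w * t)) 1 ≠ 0 := by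
        rw [eA, eB, eC, cubicDen_div (pow_ne_zero 3 hsr) hden]
        exact div_ne_zero hcub (pow_ne_zero _ hden)
      refine mem_of_mul_mem (cubicDen_mem h0 h1) hc0 ?_
      rw [cubicDen_div_mul hC0 hrel]
      exact cubicNum_mem h0 h1
    have hWL : w * t ∈ L := by
      refine mem_of_pentNumLeft_div_mem htL hC0 ?_ h0
      rw [eA, eC, hpt, show pentProdNum s r / (s * r) - 18 -
        25 * (leftNum s r / (s * r) ^ 3 / (denNum s r / (s * r) ^ 3)) =
        ((pentProdNum s r - 18 * (s * r)) * denNum s r - 25 * leftNum s r * (s * r)) /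
          (s * r * denNum s r) by field_simp]
      exact div_ne_zero hlin (mul_ne_zero hsr hden)
    have hwL : w ∈ L := mem_of_mul_mem htL ht0 (by rwa [mul_comm])
    have hmL : m ∈ L := by
      refine mem_of_pentNumRight_mem htL hWL ?_
      rw [← div_mul_cancel₀ (pentNumRight t (w * t) m) hC0]
      exact mul_mem h1 (pentDen_mem htL hWL)
    refine hp.rank_le_of_pentProd_mem (m := 1) htL hwL fun M hM hsM => ?_
    have htM := hM htL
    have hmM := hM hmL
    have heM : 1 + s ∈ M := add_mem (one_mem M) hsM
    have hgM : r + (1 + s) / r ∈ M := by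
      rw [hs3]
      exact sub_mem (div_mem (mul_mem htM hsM) heM) (add_mem (ofNat_mem M 2) hsM)
    refine hone (by simp [Fin.forall_fin_succ, hM h2, hM h3, hM h4]) hsM
      (mem_of_mul_mem (c := slopeNum s r / (s ^ 3 * r ^ 2)) ?_
        (div_ne_zero hslope (mul_ne_zero (pow_ne_zero _ hp.1) (pow_ne_zero _ hp.2))) ?_)
    · rw [hs2]
      exact slope_mem hsM hgM
    · rw [hs1]
      exact slope_mul_mem hsM hgM hmM

end pentagon

theorem permClasses_gens_length : permClasses.map (fun C => (C.gens, C.elems.length)) =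
    [([], 1), ([2926], 2), ([2826], 2), ([2886], 3), ([2926, 2830], 4), ([2826, 2642], 4),
      ([2586], 4), ([586], 5), ([2886, 2430], 6), ([2886, 2926], 6), ([2886, 2426], 6),
      ([2926, 2642], 8), ([586, 970], 10), ([2886, 2826], 12), ([2386, 2926], 12),
      ([586, 2110], 20), ([2586, 2926], 24), ([586, 2886], 60), ([586, 2926], 120)] := by
  decide +kernel

theorem hasInvariants_of_mem_permClasses {k K : Type*} [Field k] [Field K] [Algebra k K] :
    ∀ C ∈ permClasses, HasInvariants k K C.gens C.elems.length := by
  suffices h : ∀ p ∈ permClasses.map (fun C => (C.gens, C.elems.length)),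
      HasInvariants k K p.1 p.2 from
    fun C hC => h _ (List.mem_map_of_mem hC)
  rw [permClasses_gens_length]
  simp only [List.forall_mem_cons]
  exact ⟨hasInvariants_trivial, hasInvariants_swap, hasInvariants_double_swap,
    hasInvariants_cyclic_three, hasInvariants_swap_swap, hasInvariants_klein,
    hasInvariants_cyclic_four, hasInvariants_cyclic_five, hasInvariants_cyclic_three_swap,
    hasInvariants_symm_three, hasInvariants_symm_three_twisted, hasInvariants_dihedral_four,
    hasInvariants_dihedral_five, hasInvariants_alternating_four, hasInvariants_symm_three_two,
    hasInvariants_affine_five, hasInvariants_symm_four, hasInvariants_alternating_five,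
    hasInvariants_symm_five, List.forall_mem_nil _⟩

/-- For any subgroup `G` of `S_5` acting on the rational function field in 5 variables
over any field `k` by permuting the variables, the fixed field is purely
transcendental over `k`. -/
theorem fixed_field_S5_rational
    (k K : Type*) [Field k] [Field K] [Algebra k K]
    (x : Fin 5 → K) (hx : AlgebraicIndependent k x)
    (hgen : IntermediateField.adjoin k (Set.range x) = ⊤)
    (G : Subgroup (Equiv.Perm (Fin 5)))
    (ρ : G →* (K ≃ₐ[k] K)) (hρ : ∀ (g : G) (i : Fin 5), ρ g (x i) = x (g.1 i)) :
    IsRationalExtension k (IntermediateField.fixedField ρ.range) := by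
  exact isRationalExtension_of_hasInvariants x hx hgen G ρ hρ hasInvariants_of_mem_permClasses
end

section
/- Let p be a prime, let k be a field with char k = p, and let a be an integer whose residue is a primitive root modulo p. Let G_{p(p−1)} = ⟨σ, τ⟩ act on the rational function field k(x₀,...,x_{p−1}) by σ: xᵢ ↦ x_{i+1 mod p} and τ: xᵢ ↦ x_{a·i mod p}. Then for every divisor d of p−1, writing p−1 = de, the fixed field k(x₀,...,x_{p−1})^{⟨σ, τᵉ⟩} is purely transcendental over k. -/
open IntermediateField Polynomial

theorem algebraicIndependent_coe_of_card_le {k K ι : Type*} [Field k] [Field K] [Algebra k K]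
    [Finite ι] {x : ι → K} (hx : AlgebraicIndependent k x) (s : Set K) (hs : s.Finite)
    (hcard : s.ncard ≤ Nat.card ι) [Algebra.IsAlgebraic (adjoin k s) K] :
    AlgebraicIndependent k ((↑) : s → K) := by
  have : Algebra.IsAlgebraic (Algebra.adjoin k s) K :=
    isAlgebraic_adjoin_iff_top.mp ‹_›
  obtain ⟨t, hts, ht⟩ := exists_isTranscendenceBasis_subset (R := k) s
  have h₁ := hx.lift_cardinalMk_le_trdeg
  rw [← ht.cardinalMk_eq_trdeg, ← Nat.cast_card, Cardinal.lift_natCast] at h₁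
  have : Finite t := hs.subset hts
  rw [← Nat.cast_card, Cardinal.lift_natCast, Nat.cast_le, Nat.card_coe_set_eq] at h₁
  obtain rfl := Set.eq_of_subset_of_ncard_le hts (hcard.trans h₁) hs
  exact ht.1

theorem card_le_finrank_fixedField_of_injective {k K ι : Type*} [Field k] [Field K] [Algebra k K]
    [Fintype ι] (H : Subgroup (K ≃ₐ[k] K)) [FiniteDimensional (fixedField H) K] (t : K)
    (g : ι → H) (hg : Function.Injective fun i ↦ (g i : K ≃ₐ[k] K) t) :
    Fintype.card ι ≤ Module.finrank (fixedField H) K := by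
  classical
  have ht : IsIntegral (fixedField H) t := .of_finite _ _
  set q := (minpoly (fixedField H) t).map (algebraMap (fixedField H) K) with hq
  have hq0 : q ≠ 0 := (Polynomial.map_ne_zero (minpoly.ne_zero ht))
  have hsub : (Finset.univ.image fun i ↦ (g i : K ≃ₐ[k] K) t).val ⊆ q.roots := by
    intro y hy
    obtain ⟨i, -, rfl⟩ := Finset.mem_image.1 hy
    rw [mem_roots hq0, IsRoot.def, hq, eval_map_algebraMap]
    have hfix : ∀ r : fixedField H, (g i : K ≃ₐ[k] K) (algebraMap (fixedField H) K r)
      = algebraMap (fixedField H) K r := fun r ↦ r.2 (g i)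
    let f : K →ₐ[fixedField H] K :=
      { (g i : K ≃ₐ[k] K).toRingEquiv.toRingHom with commutes' := hfix }
    exact (aeval_algHom_apply f t _).trans (by rw [minpoly.aeval, map_zero])
  have h := card_le_degree_of_subset_roots hsub
  rw [Finset.card_image_of_injective _ hg, Finset.card_univ, hq, natDegree_map] at h
  exact h.trans (minpoly.natDegree_le t)

theorem fixedField_eq_of_natDegree_le {k K ι : Type*} [Field k] [Field K] [Algebra k K]
    [Fintype ι] (H : Subgroup (K ≃ₐ[k] K)) (L : IntermediateField k K) (hL : L ≤ fixedField H)
    (t : K) (ht : adjoin L {t} = ⊤) (q : L[X]) (hq : q.Monic) (hqt : aeval t q = 0)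
    (hdeg : q.natDegree ≤ Fintype.card ι)
    (g : ι → H) (hg : Function.Injective fun i ↦ (g i : K ≃ₐ[k] K) t) :
    FiniteDimensional L K ∧ L = fixedField H := by
  have hint : IsIntegral L t := ⟨q, hq, hqt⟩
  have hfin : FiniteDimensional L K := by
    have := adjoin.finiteDimensional hint
    rw [ht] at this
    exact Module.Finite.equiv (topEquiv (F := L) (E := K)).toLinearEquiv
  refine ⟨hfin, eq_of_le_of_finrank_le' hL ?_⟩
  have hfin' : FiniteDimensional (fixedField H) K := by
    let := (inclusion hL).toRingHom.toAlgebra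
    have : IsScalarTower L (fixedField H) K := .of_algebraMap_eq fun _ ↦ rfl
    exact Module.Finite.right L _ K
  calc Module.finrank L K = (minpoly L t).natDegree := by
        rw [← adjoin.finrank hint, ht, finrank_top']
    _ ≤ q.natDegree := natDegree_le_natDegree (minpoly.min L t hq hqt)
    _ ≤ _ := hdeg.trans (card_le_finrank_fixedField_of_injective H t g hg)
theorem mem_of_shifted_power_sums_mem {p : ℕ} [Fact p.Prime] {K S : Type*} [Field K] [CharP K p]
    [SetLike S K] [SubfieldClass S K] (M : S) (x : ZMod p → K) {t u : K} (ht : t ∈ M)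
    (hu : u ∈ M) (hu0 : u ≠ 0)
    (hw : ∀ j < p, ∑ i, ((ZMod.castHom dvd_rfl K i - t) / u) ^ j * x i ∈ M) (m : ZMod p) :
    x m ∈ M := by
  have hp : p.Prime := Fact.out
  set φ := ZMod.castHom (dvd_refl p) K with hφ
  have hφM : φ m ∈ M := by
    obtain ⟨n, rfl⟩ := ZMod.natCast_zmod_surjective m
    rw [map_natCast]
    exact natCast_mem M n
  have hshift : ∀ j < p, ∑ i, (φ i - φ m) ^ j * x i ∈ M := by
    intro j hj
    have : ∑ i, (φ i - φ m) ^ j * x i = ∑ l ∈ Finset.range (j + 1),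
        u ^ l * (t - φ m) ^ (j - l) * (j.choose l : K) * ∑ i, ((φ i - t) / u) ^ l * x i := by
      simp_rw [Finset.mul_sum]
      rw [Finset.sum_comm]
      refine Finset.sum_congr rfl fun i _ ↦ ?_
      have : φ i - φ m = u * ((φ i - t) / u) + (t - φ m) := by field_simp; ring
      rw [this, add_pow, Finset.sum_mul]
      refine Finset.sum_congr rfl fun l _ ↦ ?_
      rw [mul_pow]
      ring
    rw [this]
    refine sum_mem fun l hl ↦ mul_mem (mul_mem (mul_mem (pow_mem hu _)
      (pow_mem (sub_mem ht hφM) _)) (natCast_mem M _)) (hw l ?_)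
    have := Finset.mem_range.1 hl
    omega
  have hx : x m = ∑ i, (φ i - φ m) ^ 0 * x i - ∑ i, (φ i - φ m) ^ (p - 1) * x i := by
    rw [← Finset.sum_sub_distrib, Finset.sum_eq_single m]
    · simp [Nat.sub_eq_zero_iff_le, hp.one_lt]
    · intro i _ him
      rw [pow_zero, ← map_sub, ← map_pow, ZMod.pow_card_sub_one_eq_one (sub_ne_zero.2 him)]
      simp
    · simp
  rw [hx]
  exact sub_mem (hshift 0 hp.pos) (hshift _ (Nat.sub_lt hp.pos one_pos))

theorem monic_X_pow_sub_X_pow_sub_C {R : Type*} [Field R] {p d : ℕ} (hp : 1 < p) (hd : d ≠ 0)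
    (v : R) : ((X ^ p - X : R[X]) ^ d - C v).Monic := by
  have h : (X ^ p - X : R[X]).Monic := monic_X_pow_sub (by rw [degree_X]; exact_mod_cast hp)
  refine (h.pow d).sub_of_left ?_
  rw [degree_eq_natDegree (h.pow d).ne_zero, natDegree_pow,
    FiniteField.X_pow_card_sub_X_natDegree_eq R hp]
  exact degree_C_le.trans_lt (by exact_mod_cast Nat.mul_pos (Nat.pos_of_ne_zero hd) (by omega))

theorem affine_pow_injective {p : ℕ} [Fact p.Prime] {K : Type*} [Field K] [CharP K p] {c t : K}
    {d : ℕ} (ht : t ∉ (⊥ : Subfield K)) (hc : c ∈ (⊥ : Subfield K))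
    (hd : Set.InjOn (c ^ ·) (Set.Iio d)) :
    Function.Injective fun i : Fin p × Fin d ↦ c ^ (i.2 : ℕ) * t - ((i.1 : ℕ) : K) := by
  rintro ⟨n, m⟩ ⟨n', m'⟩ h
  have h' : (c ^ (m : ℕ) - c ^ (m' : ℕ)) * t = (n : ℕ) - (n' : ℕ) := by
    linear_combination h
  have hm : c ^ (m : ℕ) = c ^ (m' : ℕ) := by
    by_contra hne
    replace hne := sub_ne_zero.2 hne
    rw [mul_comm] at h'
    apply ht
    rw [eq_div_of_mul_eq hne h']
    exact div_mem (sub_mem (natCast_mem _ _) (natCast_mem _ _))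
      (sub_mem (pow_mem hc _) (pow_mem hc _))
  obtain rfl := Fin.ext (hd m.2 m'.2 hm)
  rw [sub_self, zero_mul, eq_comm, sub_eq_zero] at h'
  obtain rfl := Fin.ext (CharP.natCast_injOn_Iio K p n.2 n'.2 h')
  rfl

theorem fixed_field_Gpd_char_p_rational
    (p : ℕ) [Fact p.Prime] (a : ℕ) (ha : orderOf (a : ZMod p) = p - 1)
    (k K : Type*) [Field k] [CharP k p] [Field K] [Algebra k K]
    (x : ZMod p → K) (hx : AlgebraicIndependent k x)
    (hgen : IntermediateField.adjoin k (Set.range x) = ⊤)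
    (σ τ : K ≃ₐ[k] K)
    (hσ : ∀ i : ZMod p, σ (x i) = x (i + 1))
    (hτ : ∀ i : ZMod p, τ (x i) = x ((a : ZMod p) * i)) :
    ∀ d e : ℕ, p - 1 = d * e →
      IsRationalExtension k
        (IntermediateField.fixedField (Subgroup.closure {σ, τ ^ e})) := by
  intro d e hde
  have hp : p.Prime := Fact.out
  have hp1 : 0 < p - 1 := Nat.sub_pos_of_lt hp.one_lt
  have hd0 : d ≠ 0 := by rintro rfl; omega
  have he0 : e ≠ 0 := by rintro rfl; omega
  have : CharP K p := charP_of_injective_algebraMap (algebraMap k K).injective p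
  set φ := ZMod.castHom (dvd_refl p) K with hφ
  have hφfix : ∀ (g : K ≃ₐ[k] K) (i : ZMod p), g (φ i) = φ i := fun g i ↦
    DFunLike.congr_fun (Subsingleton.elim ((g : K →+* K).comp φ) φ) i
  have ha0 : (a : ZMod p) ≠ 0 := by
    intro h
    have := pow_orderOf_eq_one (a : ZMod p)
    rw [ha, h, zero_pow hp1.ne'] at this
    exact zero_ne_one this
  set α := φ a with hα
  have hα0 : α ≠ 0 := (map_ne_zero φ).2 ha0
  have hαord : orderOf α = p - 1 := (orderOf_injective (φ : ZMod p →* K) φ.injective a).trans ha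
  have hαp : α ^ p = α := by rw [hα, ← map_pow, ZMod.pow_card]
  set y : K := ∑ i, x i with hy
  have hy0 : y ≠ 0 := by
    intro h
    have := (Fintype.linearIndependent_iff.1 hx.linearIndependent) (fun _ ↦ 1) (by simpa using h) 0
    exact one_ne_zero this
  set t : K := (∑ i, φ i * x i) / y with ht
  have hσy : σ y = y := by
    simp_rw [hy, map_sum, hσ]
    exact Equiv.sum_comp (Equiv.addRight (1 : ZMod p)) x
  have hτsum : ∀ f : ZMod p → K, ∑ i, f i * x (a * i) = ∑ i, f ((a : ZMod p)⁻¹ * i) * x i := by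
    intro f
    rw [← Equiv.sum_comp (Equiv.mulLeft₀ (a : ZMod p) ha0) fun i ↦ f ((a : ZMod p)⁻¹ * i) * x i]
    simp [ha0]
  have hσsum : ∀ f : ZMod p → K, ∑ i, f i * x (i + 1) = ∑ i, f (i - 1) * x i := by
    intro f
    rw [← Equiv.sum_comp (Equiv.addRight (1 : ZMod p)) fun i ↦ f (i - 1) * x i]
    simp
  have hτy : τ y = y := by
    simp_rw [hy, map_sum, hτ]
    simpa using hτsum fun _ ↦ 1
  have hσt : σ t = t - 1 := by
    simp_rw [ht, map_div₀, map_sum, map_mul, hφfix, hσ, hσy]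
    rw [hσsum φ]
    simp_rw [map_sub, map_one, sub_mul, one_mul, Finset.sum_sub_distrib, ← hy]
    field_simp
  have hτt : τ t = α⁻¹ * t := by
    simp_rw [ht, map_div₀, map_sum, map_mul, hφfix, hτ, hτy]
    rw [hτsum φ]
    simp_rw [map_mul, map_inv₀, ← hα, mul_assoc, ← Finset.mul_sum]
    ring
  have htbot : t ∉ (⊥ : Subfield K) := by
    rw [← ZMod.fieldRange_castHom_eq_bot p]
    rintro ⟨i, hi⟩
    rw [← hi, hφfix, eq_comm, sub_eq_self] at hσt
    exact one_ne_zero hσt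
  set u : K := t ^ p - t with hu
  have hu0 : u ≠ 0 := fun h ↦
    htbot ((Subfield.mem_bot_iff_pow_eq_self K p).2 (sub_eq_zero.1 h))
  have hσu : σ u = u := by
    rw [hu, map_sub, map_pow, hσt, sub_pow_char, one_pow]
    ring
  have hτu : τ u = α⁻¹ * u := by
    rw [hu, map_sub, map_pow, hτt, mul_pow, inv_pow, hαp]
    ring
  set w : ℕ → K := fun j ↦ ∑ i, ((φ i - t) / u) ^ j * x i with hw
  have hσw : ∀ j, σ (w j) = w j := by
    intro j
    simp_rw [hw, map_sum, map_mul, map_pow, map_div₀, map_sub, hφfix, hσ, hσt, hσu]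
    rw [hσsum fun i ↦ ((φ i - (t - 1)) / u) ^ j]
    refine Finset.sum_congr rfl fun i _ ↦ ?_
    rw [map_sub, map_one]
    ring
  have hτw : ∀ j, τ (w j) = w j := by
    intro j
    simp_rw [hw, map_sum, map_mul, map_pow, map_div₀, map_sub, hφfix, hτ, hτt, hτu]
    rw [hτsum fun i ↦ ((φ i - α⁻¹ * t) / (α⁻¹ * u)) ^ j]
    refine Finset.sum_congr rfl fun i _ ↦ ?_
    rw [map_mul, map_inv₀, ← hα, ← mul_sub, mul_div_mul_left _ _ (inv_ne_zero hα0)]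
  have hw1 : w 1 = 0 := by
    simp_rw [hw, pow_one, div_mul_eq_mul_div, ← Finset.sum_div, sub_mul, Finset.sum_sub_distrib,
      ← Finset.mul_sum, ← hy, ht]
    rw [div_mul_cancel₀ _ hy0, sub_self, zero_div]
  have hτe : ∀ {z b : K} (_ : b ∈ φ.fieldRange) (_ : τ z = b * z) (n : ℕ),
      (τ ^ n) z = b ^ n * z := by
    rintro z _ ⟨i, rfl⟩ hz n
    induction n with
    | zero => simp
    | succ n ih => rw [pow_succ', AlgEquiv.mul_apply, ih, map_mul, map_pow, hφfix, hz]; ring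
  have hαmem : α⁻¹ ∈ φ.fieldRange := inv_mem ⟨_, rfl⟩
  set H := Subgroup.closure {σ, τ ^ e} with hH
  set s : Set K := (fun j ↦ if j = 1 then u ^ d else w j) '' (Set.Iio p) with hs
  have hvs : u ^ d ∈ s := ⟨1, hp.one_lt, by simp⟩
  have hLH : adjoin k s ≤ fixedField H := by
    rw [le_iff_le, hH, Subgroup.closure_le]
    have key : ∀ g : K ≃ₐ[k] K, g (u ^ d) = u ^ d → (∀ j, g (w j) = w j) →
        g ∈ (adjoin k s).fixingSubgroup := by
      intro g hgv hgw
      rw [← Subgroup.zpowers_le, ← le_iff_le, adjoin_le_iff]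
      rintro _ ⟨j, -, rfl⟩ ⟨h, hh⟩
      refine (Subgroup.zpowers_le (H := MulAction.stabilizer (K ≃ₐ[k] K) _)).2 ?_ hh
      change g (if j = 1 then u ^ d else w j) = if j = 1 then u ^ d else w j
      split_ifs
      · exact hgv
      · exact hgw j
    rintro g (rfl | rfl)
    · exact key _ (by rw [map_pow, hσu]) hσw
    · refine key _ ?_ fun j ↦ ?_
      · rw [map_pow, hτe hαmem hτu, mul_pow, ← pow_mul, mul_comm e, ← hde, inv_pow, ← hαord,
          pow_orderOf_eq_one, inv_one, one_mul]
      · simpa using hτe (one_mem _) ((hτw j).trans (one_mul _).symm) e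
  have htop : adjoin (adjoin k s) {t} = ⊤ := by
    set M := adjoin (adjoin k s) {t}
    have htM : t ∈ M := mem_adjoin_simple_self _ t
    have hsM : ∀ z ∈ s, z ∈ M := fun z hz ↦
      M.algebraMap_mem (⟨z, subset_adjoin k s hz⟩ : adjoin k s)
    have hxM : ∀ m, x m ∈ M := by
      refine mem_of_shifted_power_sums_mem M x htM (sub_mem (pow_mem htM p) htM) hu0 fun j hj ↦ ?_
      change w j ∈ M
      by_cases h1 : j = 1
      · rw [h1, hw1]; exact zero_mem M
      · exact hsM _ ⟨j, hj, by simp [h1]⟩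
    rw [← restrictScalars_eq_top_iff (K := k), eq_top_iff, ← hgen, adjoin_le_iff]
    rintro _ ⟨m, rfl⟩
    exact hxM m
  have hpow : Set.InjOn ((α⁻¹ ^ e) ^ ·) (Set.Iio d) := by
    intro m hm m' hm' h
    simp only [← pow_mul, inv_pow, inv_inj] at h
    have hlt : ∀ n < d, e * n ∈ Set.Iio (orderOf α) := fun n hn ↦ by
      rw [hαord, hde, mul_comm d]
      exact Nat.mul_lt_mul_of_pos_left hn (Nat.pos_of_ne_zero he0)
    exact Nat.eq_of_mul_eq_mul_left (Nat.pos_of_ne_zero he0)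
      (pow_injOn_Iio_orderOf (hlt m hm) (hlt m' hm') h)
  have hσH : σ ∈ H := Subgroup.subset_closure (by simp)
  have hτH : τ ^ e ∈ H := Subgroup.subset_closure (by simp)
  have hσn : ∀ n : ℕ, (σ ^ n) t = t - n := by
    intro n
    induction n with
    | zero => simp
    | succ n ih => rw [pow_succ', AlgEquiv.mul_apply, ih, map_sub, hσt, map_natCast]; push_cast; ring
  set v : adjoin k s := ⟨u ^ d, subset_adjoin k s hvs⟩ with hv
  obtain ⟨hfin, heq⟩ := fixedField_eq_of_natDegree_le (ι := Fin p × Fin d) H (adjoin k s) hLH t htop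
    ((X ^ p - X) ^ d - C v) (monic_X_pow_sub_X_pow_sub_C hp.one_lt hd0 v)
    (by
      simp only [map_sub, map_pow, aeval_X, aeval_C]
      exact sub_self _)
    (by
      rw [natDegree_sub_C, natDegree_pow, FiniteField.X_pow_card_sub_X_natDegree_eq _ hp.one_lt]
      simp [mul_comm])
    (fun i ↦ ⟨(τ ^ e) ^ (i.2 : ℕ) * σ ^ (i.1 : ℕ), mul_mem (pow_mem hτH _) (pow_mem hσH _)⟩)
    (by
      convert affine_pow_injective (p := p) htbot (c := α⁻¹ ^ e)
        (ZMod.fieldRange_castHom_eq_bot p (K := K) ▸ pow_mem hαmem e) hpow using 2 with i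
      rw [AlgEquiv.mul_apply, hσn, map_sub, map_natCast, ← pow_mul, hτe hαmem hτt, pow_mul])
  refine ⟨s, algebraicIndependent_coe_of_card_le hx s ((Set.finite_Iio p).image _) ?_, heq⟩
  simpa using Set.ncard_image_le (Set.finite_Iio p)
end

section
/- Let L be a field and let G be a finite group acting on the rational function field L(x) (one variable over L) such that σ(L) ⊆ L for all σ ∈ G and σ(x) = a_σ x + b_σ with a_σ ∈ L \ {0}, b_σ ∈ L. Then there is a polynomial f ∈ L[x] with L(x)^G = L^G(f). More precisely, if m is the minimal degree of a non-constant polynomial in L[x]^G, then any f ∈ L[x]^G of degree m satisfies L(x)^G = L^G(f). -/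
open Polynomial

section AffineAction

variable {G L K : Type*} [Group G] [Field L] [Field K] [Algebra L K]
  [MulSemiringAction G L] [MulSemiringAction G K] {x : K}

theorem exists_aeval_eq_smul_aeval
    (hcompat : ∀ (σ : G) (a : L), σ • (algebraMap L K a) = algebraMap L K (σ • a))
    (haff : ∀ σ : G, ∃ a b : L, a ≠ 0 ∧ σ • x = algebraMap L K a * x + algebraMap L K b)
    (σ : G) (q : L[X]) :
    ∃ q' : L[X], aeval x q' = σ • aeval x q ∧ q'.natDegree = q.natDegree := by
  obtain ⟨a, b, ha, hσ⟩ := haff σ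
  refine ⟨(q.map (MulSemiringAction.toRingHom G L σ)).comp (C a * X + C b), ?_, ?_⟩
  · rw [aeval_comp]
    have hlin : aeval x (C a * X + C b) = σ • x := by simp [hσ]
    rw [hlin]
    induction q using Polynomial.induction_on' with
    | add p q hp hq => simp [Polynomial.map_add, hp, hq, smul_add]
    | monomial n c => simp [aeval_monomial, smul_mul', smul_pow', hcompat]
  · rw [natDegree_comp, natDegree_map, natDegree_linear ha, mul_one]

theorem div_and_mod_invariant
    (hcompat : ∀ (σ : G) (a : L), σ • (algebraMap L K a) = algebraMap L K (σ • a))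
    (hx : Transcendental L x)
    (haff : ∀ σ : G, ∃ a b : L, a ≠ 0 ∧ σ • x = algebraMap L K a * x + algebraMap L K b)
    {p q : L[X]} (hp : ∀ σ : G, σ • aeval x p = aeval x p) (hdeg : 0 < p.natDegree)
    (hq : ∀ σ : G, σ • aeval x q = aeval x q) :
    (∀ σ : G, σ • aeval x (q / p) = aeval x (q / p)) ∧
      ∀ σ : G, σ • aeval x (q % p) = aeval x (q % p) := by
  rw [← forall_and]
  intro σ
  have hinj := transcendental_iff_injective.mp hx
  obtain ⟨s, hs, -⟩ := exists_aeval_eq_smul_aeval hcompat haff σ (q / p)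
  obtain ⟨r, hr, hrdeg⟩ := exists_aeval_eq_smul_aeval hcompat haff σ (q % p)
  have hqp : p * (q / p) + q % p = q := EuclideanDomain.div_add_mod q p
  have hq' : p * s + r = q := by
    apply hinj
    rw [map_add, map_mul, hs, hr, ← hp σ, ← smul_mul', ← smul_add, ← map_mul, ← map_add, hqp,
      hq σ]
  have hmod : (q % p).natDegree < p.natDegree := natDegree_mod_lt q hdeg.ne'
  have hrr : r - q % p = 0 := by
    apply eq_zero_of_dvd_of_natDegree_lt (p := p)
    · exact ⟨q / p - s, by linear_combination hq' - hqp⟩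
    · exact (natDegree_sub_le _ _).trans_lt (max_lt (hrdeg ▸ hmod) hmod)
  have hp0 : p ≠ 0 := ne_zero_of_natDegree_gt hdeg
  have hss : s = q / p :=
    mul_left_cancel₀ hp0 (by linear_combination hq' - hqp - hrr)
  exact ⟨by rw [← hs, hss], by rw [← hr, sub_eq_zero.mp hrr]⟩

theorem aeval_mem_closure_of_invariant
    (hcompat : ∀ (σ : G) (a : L), σ • (algebraMap L K a) = algebraMap L K (σ • a))
    (hx : Transcendental L x)
    (haff : ∀ σ : G, ∃ a b : L, a ≠ 0 ∧ σ • x = algebraMap L K a * x + algebraMap L K b)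
    {p : L[X]} (hp : ∀ σ : G, σ • aeval x p = aeval x p) (hdeg : 0 < p.natDegree)
    (hmin : ∀ q : L[X], (∀ σ : G, σ • aeval x q = aeval x q) →
      0 < q.natDegree → p.natDegree ≤ q.natDegree)
    (q : L[X]) (hq : ∀ σ : G, σ • aeval x q = aeval x q) :
    aeval x q ∈ Subfield.closure
      (↑((FixedPoints.subfield G L).map (algebraMap L K)) ∪ {aeval x p}) := by
  have hconst (r : L[X]) (hr : ∀ σ : G, σ • aeval x r = aeval x r)
      (hlt : r.natDegree < p.natDegree) : aeval x r ∈ Subfield.closure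
        (↑((FixedPoints.subfield G L).map (algebraMap L K)) ∪ {aeval x p}) := by
    have h0 : r.natDegree = 0 := by
      by_contra h
      exact absurd (hmin r hr (Nat.pos_of_ne_zero h)) hlt.not_ge
    obtain ⟨c, rfl⟩ := natDegree_eq_zero.mp h0
    refine Subfield.subset_closure (Or.inl ⟨c, fun σ => ?_, (aeval_C x c).symm⟩)
    have h := hr σ
    rw [aeval_C, hcompat] at h
    exact (algebraMap L K).injective h
  induction hn : q.natDegree using Nat.strong_induction_on generalizing q with
  | _ n ih =>
    obtain hlt | hle := lt_or_ge q.natDegree p.natDegree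
    · exact hconst q hq hlt
    · obtain ⟨hdiv, hmod⟩ := div_and_mod_invariant hcompat hx haff hp hdeg hq
      rw [← EuclideanDomain.div_add_mod q p, map_add, map_mul]
      refine add_mem (mul_mem (Subfield.subset_closure (Or.inr rfl)) (ih _ ?_ _ hdiv rfl))
        (hconst _ hmod (natDegree_mod_lt q hdeg.ne'))
      rw [← hn]
      have hq0 : q ≠ 0 := ne_zero_of_natDegree_gt (hdeg.trans_le hle)
      by_cases hz : q / p = 0
      · rw [hz, natDegree_zero]
        lia
      · exact natDegree_lt_natDegree hz (degree_div_lt hq0 (natDegree_pos_iff_degree_pos.mp hdeg))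

theorem smul_prod_smul_eq [Fintype G] (σ : G) (v : K) :
    σ • ∏ τ : G, τ • v = ∏ τ : G, τ • v := by
  rw [Finset.smul_prod']
  exact Fintype.prod_equiv (Equiv.mulLeft σ) _ _ fun τ => by simp [mul_smul]

theorem exists_invariant_polynomial_quotient [Finite G]
    (hcompat : ∀ (σ : G) (a : L), σ • (algebraMap L K a) = algebraMap L K (σ • a))
    (hgen : IntermediateField.adjoin L {x} = ⊤)
    (haff : ∀ σ : G, ∃ a b : L, a ≠ 0 ∧ σ • x = algebraMap L K a * x + algebraMap L K b)
    {y : K} (hy : ∀ σ : G, σ • y = y) :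
    ∃ r s : L[X], (∀ σ : G, σ • aeval x r = aeval x r) ∧
      (∀ σ : G, σ • aeval x s = aeval x s) ∧ y = aeval x r / aeval x s := by
  classical
  have := Fintype.ofFinite G
  have hmem : y ∈ IntermediateField.adjoin L {x} := hgen ▸ IntermediateField.mem_top
  obtain ⟨u, v, huv⟩ := (IntermediateField.mem_adjoin_simple_iff L y).mp hmem
  by_cases hv : aeval x v = 0
  · exact ⟨0, 0, by simp, by simp, by simp [huv, hv]⟩
  have hrange (τ : G) : τ • aeval x v ∈ (aeval x : L[X] →ₐ[L] K).range := by
    obtain ⟨w, hw, -⟩ := exists_aeval_eq_smul_aeval hcompat haff τ v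
    exact ⟨w, hw⟩
  set N : K := ∏ τ : G, τ • aeval x v with hN
  have hN0 : N ≠ 0 :=
    Finset.prod_ne_zero_iff.mpr fun τ _ => (smul_ne_zero_iff_ne τ).mpr hv
  obtain ⟨s, hs⟩ : N ∈ (aeval x : L[X] →ₐ[L] K).range := prod_mem fun τ _ => hrange τ
  obtain ⟨r, hr⟩ : y * N ∈ (aeval x : L[X] →ₐ[L] K).range := by
    have hyN : y * N = aeval x u * ∏ τ ∈ Finset.univ.erase (1 : G), τ • aeval x v := by
      rw [hN, ← Finset.mul_prod_erase _ _ (Finset.mem_univ (1 : G)), one_smul, huv]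
      field_simp
    rw [hyN]
    exact mul_mem ⟨u, rfl⟩ (prod_mem fun τ _ => hrange τ)
  have hNinv (σ : G) : σ • N = N := smul_prod_smul_eq σ _
  replace hs : aeval x s = N := hs
  replace hr : aeval x r = y * N := hr
  refine ⟨r, s, fun σ => ?_, fun σ => ?_, ?_⟩
  · rw [hr, smul_mul', hy, hNinv]
  · rw [hs, hNinv]
  · rw [hr, hs, mul_div_cancel_right₀ _ hN0]

theorem fixedPoints_subfield_eq_closure [Finite G]
    (hcompat : ∀ (σ : G) (a : L), σ • (algebraMap L K a) = algebraMap L K (σ • a))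
    (hx : Transcendental L x)
    (hgen : IntermediateField.adjoin L {x} = ⊤)
    (haff : ∀ σ : G, ∃ a b : L, a ≠ 0 ∧ σ • x = algebraMap L K a * x + algebraMap L K b)
    {p : L[X]} (hp : ∀ σ : G, σ • aeval x p = aeval x p) (hdeg : 0 < p.natDegree)
    (hmin : ∀ q : L[X], (∀ σ : G, σ • aeval x q = aeval x q) →
      0 < q.natDegree → p.natDegree ≤ q.natDegree) :
    FixedPoints.subfield G K = Subfield.closure
      (↑((FixedPoints.subfield G L).map (algebraMap L K)) ∪ {aeval x p}) := by
  apply le_antisymm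
  · intro y hy
    obtain ⟨r, s, hr, hs, rfl⟩ := exists_invariant_polynomial_quotient hcompat hgen haff hy
    exact div_mem (aeval_mem_closure_of_invariant hcompat hx haff hp hdeg hmin r hr)
      (aeval_mem_closure_of_invariant hcompat hx haff hp hdeg hmin s hs)
  · rw [Subfield.closure_le]
    rintro _ (⟨c, hc, rfl⟩ | rfl)
    · exact fun σ => (hcompat σ c).trans (congrArg _ (hc σ))
    · exact hp

end AffineAction

theorem exists_nonconstant_invariant_polynomial {G L K : Type*} [Group G] [Finite G]
    [Field L] [Field K] [Algebra L K] [MulSemiringAction G K] {x : K}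
    (haff : ∀ σ : G, ∃ a b : L, a ≠ 0 ∧ σ • x = algebraMap L K a * x + algebraMap L K b) :
    ∃ p : L[X], (∀ σ : G, σ • aeval x p = aeval x p) ∧ 0 < p.natDegree := by
  have := Fintype.ofFinite G
  choose a b ha hab using haff
  have hprod : aeval x (∏ τ : G, (C (a τ) * X + C (b τ))) = ∏ τ : G, τ • x := by
    simp [map_prod, hab]
  refine ⟨∏ τ : G, (C (a τ) * X + C (b τ)), fun σ => ?_, ?_⟩
  · rw [hprod, smul_prod_smul_eq]
  · rw [natDegree_prod _ _ fun τ _ => ne_zero_of_natDegree_gt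
      ((natDegree_linear (b := b τ) (ha τ)).symm ▸ zero_lt_one)]
    simp [natDegree_linear (ha _), Fintype.card_pos]


/-- (Ahmad–Hajja–Kang.)  Let a finite group `G` act on `K = L(x)` (one variable over
`L`) with `σ(L) ⊆ L` and `σ(x) = a_σ x + b_σ`, `a_σ ∈ L \ {0}`, `b_σ ∈ L`.  Then
`L(x)^G = L^G(f)` for some polynomial `f ∈ L[x]`; in fact, if `m` is the minimal
degree of a non-constant `G`-invariant polynomial, then any invariant polynomial of
degree `m` generates `L(x)^G` over `L^G`. -/
theorem fixed_field_of_affine_action_one_variable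
    (G L K : Type*) [Group G] [Finite G] [Field L] [Field K] [Algebra L K]
    [MulSemiringAction G L] [MulSemiringAction G K]
    (hcompat : ∀ (σ : G) (a : L), σ • (algebraMap L K a) = algebraMap L K (σ • a))
    (x : K) (hx : Transcendental L x)
    (hgen : IntermediateField.adjoin L {x} = ⊤)
    (haff : ∀ σ : G, ∃ a b : L, a ≠ 0 ∧ σ • x = algebraMap L K a * x + algebraMap L K b) :
    (∃ p : Polynomial L,
      (∀ σ : G, σ • Polynomial.aeval x p = Polynomial.aeval x p) ∧
      FixedPoints.subfield G K =
        Subfield.closure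
          (↑((FixedPoints.subfield G L).map (algebraMap L K)) ∪ {Polynomial.aeval x p})) ∧
    ∀ p : Polynomial L,
      (∀ σ : G, σ • Polynomial.aeval x p = Polynomial.aeval x p) →
      0 < p.natDegree →
      (∀ q : Polynomial L,
        (∀ σ : G, σ • Polynomial.aeval x q = Polynomial.aeval x q) →
        0 < q.natDegree → p.natDegree ≤ q.natDegree) →
      FixedPoints.subfield G K =
        Subfield.closure
          (↑((FixedPoints.subfield G L).map (algebraMap L K)) ∪ {Polynomial.aeval x p}) := by
  have key (p : Polynomial L) (hp : ∀ σ : G, σ • aeval x p = aeval x p) (hdeg : 0 < p.natDegree)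
      (hmin : ∀ q : Polynomial L, (∀ σ : G, σ • aeval x q = aeval x q) →
        0 < q.natDegree → p.natDegree ≤ q.natDegree) :=
    fixedPoints_subfield_eq_closure hcompat hx hgen haff hp hdeg hmin
  refine ⟨?_, key⟩
  obtain ⟨p, ⟨hp, hdeg⟩, hmin⟩ := exists_minimalFor_of_wellFoundedLT
    (fun p : Polynomial L => (∀ σ : G, σ • aeval x p = aeval x p) ∧ 0 < p.natDegree)
    natDegree (exists_nonconstant_invariant_polynomial haff)
  refine ⟨p, hp, key p hp hdeg fun q hq hq0 => ?_⟩
  exact (le_total p.natDegree q.natDegree).elim id fun h => hmin ⟨hq, hq0⟩ h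
end
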